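/- arXiv:1409.7876 — 4 statements merged into one kernel-verified Lean document; each statement's English description precedes it below -/
import Mathlib

section
/- Let 0 < x < 1, N ≥ 2 and 0 < a_N < a_{N−1} < … < a_1 be real numbers such that ∑_{j=1}^N a_j = 1 + x, ∑_{j=1}^N a_j⁷ = 1 + x⁷ and ∑_{j=1}^N 1/a_j = 1 + 1/x. Then N = 2, a_1 = 1 and a_2 = x. -/
open Finset

/-- Spreading two nonnegative reals apart with fixed sum increases the sum of their `n`-th powers. -/
theorem pow_add_pow_le_of_add_eq {x y u v : ℝ} (n : ℕ) (hx : 0 ≤ x) (hxu : x ≤ u) (huy : u ≤ y)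
    (h : u + v = x + y) : u ^ n + v ^ n ≤ x ^ n + y ^ n := by
  rcases (hxu.trans huy).eq_or_lt with rfl | hxy
  · obtain rfl : u = x := le_antisymm huy hxu
    obtain rfl : v = u := by linarith
    rfl
  have hd : 0 < y - x := sub_pos.2 hxy
  have hconv := convexOn_pow (𝕜 := ℝ) n
  have hy : 0 ≤ y := hx.trans hxy.le
  have hθ : 0 ≤ (u - x) / (y - x) := div_nonneg (sub_nonneg.2 hxu) hd.le
  have hη : 0 ≤ (y - u) / (y - x) := div_nonneg (sub_nonneg.2 huy) hd.le
  have hsum : (u - x) / (y - x) + (y - u) / (y - x) = 1 := by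
    field_simp
    ring
  have hu := hconv.2 hy hx hθ hη hsum
  have hv := hconv.2 hx hy hθ hη hsum
  simp only [smul_eq_mul] at hu hv
  have hu' : (u - x) / (y - x) * y + (y - u) / (y - x) * x = u := by
    field_simp
    ring
  have hv' : (u - x) / (y - x) * x + (y - u) / (y - x) * y = v := by
    linear_combination (x + y) * hsum - hu' - h
  rw [hu'] at hu
  rw [hv'] at hv
  linear_combination hu + hv + (x ^ n + y ^ n) * hsum

/-- The sum of the `(n + 1)`-st powers of at least two positive reals is less than the
`(n + 1)`-st power of their sum, for `n ≠ 0`. -/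
theorem sum_pow_succ_lt_pow_sum {ι : Type*} {s : Finset ι} {f : ι → ℝ} {n : ℕ} (hn : n ≠ 0)
    (hs : s.Nontrivial) (hf : ∀ i ∈ s, 0 < f i) :
    ∑ i ∈ s, f i ^ (n + 1) < (∑ i ∈ s, f i) ^ (n + 1) := by
  rw [pow_succ', Finset.sum_mul]
  refine Finset.sum_lt_sum_of_nonempty hs.nonempty fun i hi => ?_
  obtain ⟨j, hj, hji⟩ := hs.exists_ne i
  have hlt : f i < ∑ i ∈ s, f i :=
    Finset.single_lt_sum hji hi hj (hf j hj) fun k hk _ => (hf k hk).le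
  rw [pow_succ']
  exact mul_lt_mul_of_pos_left (pow_lt_pow_left₀ hlt (hf i hi).le hn) (hf i hi)

/-- If `0 < x < 1`, `N ≥ 2` and `0 < a_N < … < a_1` satisfy
`∑ a_j = 1 + x`, `∑ a_j⁷ = 1 + x⁷` and `∑ 1/a_j = 1 + 1/x`,
then `N = 2`, `a_1 = 1` and `a_2 = x`. -/
theorem power_sum_rigidity
    (x : ℝ) (hx0 : 0 < x) (hx1 : x < 1)
    (N : ℕ) (hN : 2 ≤ N) (a : ℕ → ℝ)
    (hpos : 0 < a N)
    (hdec : ∀ j, 1 ≤ j → j < N → a (j + 1) < a j)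
    (hsum1 : ∑ j ∈ Finset.Icc 1 N, a j = 1 + x)
    (hsum7 : ∑ j ∈ Finset.Icc 1 N, (a j) ^ 7 = 1 + x ^ 7)
    (hsuminv : ∑ j ∈ Finset.Icc 1 N, 1 / a j = 1 + 1 / x) :
    N = 2 ∧ a 1 = 1 ∧ a 2 = x := by
  have ha : ∀ j, 1 ≤ j → j ≤ N → 0 < a j := fun j hj hjN =>
    Nat.decreasingInduction' (P := fun k => 0 < a k)
      (fun k hk hjk ih => ih.trans (hdec k (hj.trans hjk) hk)) hjN hpos
  have hT : ∀ j ∈ Finset.Icc 2 N, 0 < a j := fun j hj => by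
    rw [Finset.mem_Icc] at hj
    exact ha j (by lia) hj.2
  have hsplit : ∀ f : ℕ → ℝ, ∑ j ∈ Finset.Icc 1 N, f j = f 1 + ∑ j ∈ Finset.Icc 2 N, f j :=
    fun f => (Finset.add_sum_Ioc_eq_sum_Icc (f := f) (by lia : 1 ≤ N)).symm
  rw [hsplit] at hsum1 hsum7 hsuminv
  have h2 : 2 ∈ Finset.Icc 2 N := Finset.mem_Icc.2 ⟨le_rfl, hN⟩
  have h1pos : 0 < a 1 := ha 1 le_rfl (by lia)
  have h2pos : 0 < a 2 := ha 2 (by lia) hN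
  set s := ∑ j ∈ Finset.Icc 2 N, a j with hs
  have h2s : a 2 ≤ s := Finset.single_le_sum (fun j hj => (hT j hj).le) h2
  have hspos : 0 < s := h2pos.trans_le h2s
  have hinv : 1 / s ≤ ∑ j ∈ Finset.Icc 2 N, 1 / a j :=
    (one_div_le_one_div_of_le h2pos h2s).trans
      (Finset.single_le_sum (f := fun j => 1 / a j)
        (fun j hj => (one_div_pos.2 (hT j hj)).le) h2)
  have hprod : x ≤ a 1 * s := by
    have h : (1 + x) / (a 1 * s) ≤ (1 + x) / x := by
      calc (1 + x) / (a 1 * s) = 1 / a 1 + 1 / s := by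
            rw [← hsum1]
            field_simp
            ring
        _ ≤ 1 + 1 / x := by linarith
        _ = (1 + x) / x := by
            field_simp
            ring
    exact (div_le_div_iff_of_pos_left (by linarith) (by positivity) hx0).1 h
  have hmem : (a 1 - x) * (1 - a 1) ≥ 0 := by
    have : s = 1 + x - a 1 := by linarith
    rw [this] at hprod
    linarith
  have hxa : x ≤ a 1 := by
    by_contra! h
    nlinarith
  have ha1 : a 1 ≤ 1 := by
    by_contra! h
    nlinarith
  obtain rfl : N = 2 := by
    by_contra hne
    have hlt := sum_pow_succ_lt_pow_sum (n := 6) (by norm_num)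
      (⟨2, by simpa using hN, 3, by simp; lia, by norm_num⟩ : (Finset.Icc 2 N).Nontrivial) hT
    have hle := pow_add_pow_le_of_add_eq 7 hx0.le hxa ha1 (hsum1.trans (add_comm 1 x))
    norm_num only at hlt
    linarith
  have hs2 : s = a 2 := by simp [hs]
  have hlt : a 2 < a 1 := hdec 1 le_rfl (by norm_num)
  have hprod' : a 1 * a 2 = x := by
    simp only [Finset.Icc_self, Finset.sum_singleton] at hsuminv
    rw [hs2] at hsum1
    field_simp at hsuminv
    have h : (1 + x) * (a 1 * a 2 - x) = 0 := by
      linear_combination x * hsum1 - hsuminv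
    rcases mul_eq_zero.1 h with h | h <;> linarith
  rw [hs2] at hsum1
  have hroot : (a 1 - 1) * (a 1 - x) = 0 := by
    linear_combination a 1 * hsum1 - hprod'
  rcases mul_eq_zero.1 hroot with h | h
  · exact ⟨rfl, by linarith, by linarith⟩
  · linarith
end

section
/- Define f : (0,∞) → ℝ by f(x) = x⁷ + 3/x − 4x, so f''(x) = 42x⁵ + 6/x³. Then: (1) for all x > 0, f''(x) ≥ (48/5)(35/3)^{3/8}, with equality at x = (3/35)^{1/8}; (2) for 3/4 ≤ x ≤ 1, f''(x) ≤ 48; (3) for all x > 0, f(x) ≥ m₁ (1−x)² where m₁ = (24/5)(35/3)^{3/8}; and (4) for all x ∈ [3/4, 1], f(x) ≤ 24 (1−x)². -/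
lemma deriv_pow_seven_add_three_div_sub {x : ℝ} (hx : x ≠ 0) :
    deriv (fun z : ℝ => z ^ 7 + 3 / z - 4 * z) x = 7 * x ^ 6 - 3 / x ^ 2 - 4 := by
  have h := (((hasDerivAt_pow 7 x).add ((hasDerivAt_inv hx).const_mul 3)).sub
    ((hasDerivAt_id x).const_mul 4)).deriv
  have e : (fun z : ℝ => z ^ 7 + 3 / z - 4 * z)
      = (fun z : ℝ => z ^ 7) + (fun z => 3 * z⁻¹) - fun z => 4 * id z := by
    ext z
    simp [div_eq_mul_inv]
  rw [e]
  refine h.trans ?_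
  norm_num
  ring

lemma deriv_deriv_pow_seven_add_three_div_sub {x : ℝ} (hx : 0 < x) :
    deriv (fun y => deriv (fun z : ℝ => z ^ 7 + 3 / z - 4 * z) y) x
      = 42 * x ^ 5 + 6 / x ^ 3 := by
  have e : (fun y => deriv (fun z : ℝ => z ^ 7 + 3 / z - 4 * z) y) =ᶠ[nhds x]
      (fun y : ℝ => 7 * y ^ 6) - (fun y => 3 * (y ^ 2)⁻¹) - fun _ => 4 := by
    filter_upwards [eventually_ne_nhds hx.ne'] with y hy
    rw [deriv_pow_seven_add_three_div_sub hy]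
    simp [div_eq_mul_inv]
  rw [e.deriv_eq]
  have h := ((((hasDerivAt_pow 6 x).const_mul 7).sub
    (((hasDerivAt_pow 2 x).fun_inv (pow_ne_zero 2 hx.ne')).const_mul 3)).sub
    (hasDerivAt_const x (4 : ℝ))).deriv
  refine h.trans ?_
  norm_num
  field_simp
  ring

/-- Weighted AM-GM for the eighth powers of two nonnegative reals. -/
lemma eight_mul_pow_three_mul_pow_five_le {x t : ℝ} (hx : 0 ≤ x) (ht : 0 ≤ t) :
    8 * (x ^ 3 * t ^ 5) ≤ 3 * x ^ 8 + 5 * t ^ 8 := by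
  have h : 0 ≤ (x - t) ^ 2 * (3 * x ^ 6 + 6 * x ^ 5 * t + 9 * x ^ 4 * t ^ 2
      + 12 * x ^ 3 * t ^ 3 + 15 * x ^ 2 * t ^ 4 + 10 * x * t ^ 5 + 5 * t ^ 6) := by
    positivity
  linarith

lemma rpow_one_eighth_pow_eight : ((3 / 35 : ℝ) ^ ((1 : ℝ) / 8)) ^ 8 = 3 / 35 := by
  rw [← Real.rpow_natCast, ← Real.rpow_mul (by norm_num)]
  norm_num

lemma rpow_three_eighths_eq_inv :
    (35 / 3 : ℝ) ^ ((3 : ℝ) / 8) = (((3 / 35 : ℝ) ^ ((1 : ℝ) / 8)) ^ 3)⁻¹ := by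
  rw [← Real.rpow_natCast, ← Real.rpow_mul (by norm_num), ← Real.inv_rpow (by norm_num)]
  norm_num

lemma rpow_three_eighths_le : (35 / 3 : ℝ) ^ ((3 : ℝ) / 8) ≤ 13 / 5 := by
  refine le_of_pow_le_pow_left₀ (n := 8) (by norm_num) (by norm_num) ?_
  have h : ((35 / 3 : ℝ) ^ ((3 : ℝ) / 8)) ^ 8 = (35 / 3) ^ 3 := by
    rw [← Real.rpow_natCast, ← Real.rpow_mul (by norm_num), ← Real.rpow_natCast]
    norm_num
  rw [h]
  norm_num

lemma pow_seven_add_three_div_sub_eq {x : ℝ} (hx : x ≠ 0) :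
    x ^ 7 + 3 / x - 4 * x = (x ^ 6 + 2 * x ^ 5 + 3 * x ^ 4 + 4 * x ^ 3 + 5 * x ^ 2
      + 6 * x + 3) / x * (1 - x) ^ 2 := by
  field_simp
  ring

open Real

/-- Elementary inequalities for `f(x) = x⁷ + 3/x − 4x` on `(0,∞)`,
whose second derivative is `f''(x) = 42x⁵ + 6/x³`. -/
theorem f_second_derivative_bounds :
    (∀ x : ℝ, 0 < x →
      deriv (fun y => deriv (fun z : ℝ => z ^ 7 + 3 / z - 4 * z) y) x
        = 42 * x ^ 5 + 6 / x ^ 3) ∧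
    (∀ x : ℝ, 0 < x →
      (48 / 5) * ((35 / 3 : ℝ) ^ ((3:ℝ)/8)) ≤ 42 * x ^ 5 + 6 / x ^ 3) ∧
    (42 * (((3 / 35 : ℝ) ^ ((1:ℝ)/8)) ^ 5) + 6 / (((3 / 35 : ℝ) ^ ((1:ℝ)/8)) ^ 3)
      = (48 / 5) * ((35 / 3 : ℝ) ^ ((3:ℝ)/8))) ∧
    (∀ x : ℝ, 3 / 4 ≤ x → x ≤ 1 → 42 * x ^ 5 + 6 / x ^ 3 ≤ 48) ∧
    (∀ x : ℝ, 0 < x →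
      (24 / 5) * ((35 / 3 : ℝ) ^ ((3:ℝ)/8)) * (1 - x) ^ 2 ≤ x ^ 7 + 3 / x - 4 * x) ∧
    (∀ x : ℝ, 3 / 4 ≤ x → x ≤ 1 → x ^ 7 + 3 / x - 4 * x ≤ 24 * (1 - x) ^ 2) := by
  refine ⟨fun x hx => deriv_deriv_pow_seven_add_three_div_sub hx, fun x hx => ?_, ?_,
    fun x h₁ h₂ => ?_, fun x hx => ?_, fun x h₁ h₂ => ?_⟩
  · rw [rpow_three_eighths_eq_inv]
    have ht8 := rpow_one_eighth_pow_eight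
    have ht : 0 < (3 / 35 : ℝ) ^ ((1 : ℝ) / 8) := by positivity
    generalize (3 / 35 : ℝ) ^ ((1 : ℝ) / 8) = t at ht ht8 ⊢
    have hinv : (t ^ 3)⁻¹ = 35 / 3 * t ^ 5 := by
      refine inv_eq_of_mul_eq_one_right ?_
      linear_combination 35 / 3 * ht8
    have hx3 : 42 * x ^ 5 + 6 / x ^ 3 = (42 * x ^ 8 + 6) / x ^ 3 := by
      field_simp
    rw [hinv, hx3, le_div_iff₀ (by positivity)]
    linarith [eight_mul_pow_three_mul_pow_five_le hx.le ht.le]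
  · rw [rpow_three_eighths_eq_inv]
    have ht8 := rpow_one_eighth_pow_eight
    have ht : 0 < (3 / 35 : ℝ) ^ ((1 : ℝ) / 8) := by positivity
    generalize (3 / 35 : ℝ) ^ ((1 : ℝ) / 8) = t at ht ht8 ⊢
    field_simp
    linear_combination 210 * ht8
  · have hx : 0 < x := by linarith
    have hx3 : 42 * x ^ 5 + 6 / x ^ 3 = (42 * x ^ 8 + 6) / x ^ 3 := by
      field_simp
    rw [hx3, div_le_iff₀ (by positivity)]
    have h3 : (3 / 4 : ℝ) ^ 3 ≤ x ^ 3 := by gcongr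
    have h4 : (3 / 4 : ℝ) ^ 4 ≤ x ^ 4 := by gcongr
    have hsq : x ^ 2 ≤ 1 := pow_le_one₀ hx.le h₂
    have hq : 0 ≤ 7 * x ^ 7 + 7 * x ^ 6 + 7 * x ^ 5 + 7 * x ^ 4 + 7 * x ^ 3
        - x ^ 2 - x - 1 := by
      have : 0 ≤ 7 * x ^ 7 + 7 * x ^ 6 + 7 * x ^ 5 := by positivity
      norm_num at h3 h4
      linarith
    linarith [mul_nonneg (sub_nonneg.2 h₂) hq]
  · rw [pow_seven_add_three_div_sub_eq hx.ne']
    gcongr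
    rw [le_div_iff₀ hx]
    have : 0 ≤ x ^ 6 + 2 * x ^ 5 + 3 * x ^ 4 + 4 * x ^ 3 := by positivity
    nlinarith [mul_le_mul_of_nonneg_right rpow_three_eighths_le hx.le,
      sq_nonneg (x - 13 / 20)]
  · have hx : 0 < x := by linarith
    rw [pow_seven_add_three_div_sub_eq hx.ne']
    gcongr
    rw [div_le_iff₀ hx]
    have hpow : ∀ k : ℕ, 2 ≤ k → x ^ k ≤ x ^ 2 := fun k hk =>
      pow_le_pow_of_le_one hx.le h₂ hk
    nlinarith [hpow 3 (by norm_num), hpow 4 (by norm_num), hpow 5 (by norm_num),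
      hpow 6 (by norm_num), mul_nonneg (sub_nonneg.2 h₂) (by linarith : 0 ≤ 5 * x - 1)]
end

section
/- Let 0 < σ < σ' < c₀ and C₀ > 0. There exists α₀ > 0 such that: for every R > 1 there is C = C(σ, σ', c₀, C₀, R) > 0 such that, for every t₁ < t₂ and every smooth solution u of the quartic gKdV equation on [t₁,t₂] × ℝ satisfying, for all t ∈ [t₁,t₂], ∫ (u_x² + u²)(t,x) dx ≤ C₀² and ∫_{x > c₀ t + R} u²(t,x) dx ≤ α₀², and for all x₀ > 0: ∫ (u_x² + u²)(t₂,x) φ(√σ (x − c₀ t₂ − x₀)) dx ≤ 2 ∫ (u_x² + u²)(t₁,x) φ(√σ (x − c₀ t₁ − (c₀ − σ')(t₂ − t₁) − x₀)) dx + C e^{−√σ x₀}. -/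
open Real MeasureTheory Filter

noncomputable def phi (x : ℝ) : ℝ := (2 / Real.pi) * Real.arctan (Real.exp x)

open Set Topology intervalIntegral
open scoped ContDiff

/-- Spatial jet of a solution of the quartic gKdV equation on `[t₁, t₂]`: `u k` is the `k`-th
spatial derivative. -/
structure IsGKdVJet (t₁ t₂ : ℝ) (u : ℕ → ℝ → ℝ → ℝ) : Prop where
  cont : ∀ k, Continuous fun p : ℝ × ℝ => u k p.1 p.2
  hasDerivAt_x : ∀ k t x, HasDerivAt (u k t) (u (k + 1) t x) x
  hasDerivAt_t : ∀ t ∈ Icc t₁ t₂, ∀ x,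
    HasDerivAt (fun s => u 0 s x) (-(u 3 t x + 4 * u 0 t x ^ 3 * u 1 t x)) t
  hasDerivAt_t_one : ∀ t ∈ Icc t₁ t₂, ∀ x,
    HasDerivAt (fun s => u 1 s x)
      (-(u 4 t x + 12 * u 0 t x ^ 2 * u 1 t x ^ 2 + 4 * u 0 t x ^ 3 * u 2 t x)) t

/-- `χ k` is the `k`-th derivative of the smooth function `χ 0`. -/
structure IsJet (χ : ℕ → ℝ → ℝ) : Prop where
  hasDerivAt : ∀ k x, HasDerivAt (χ k) (χ (k + 1) x) x

theorem IsJet.continuous {χ : ℕ → ℝ → ℝ} (h : IsJet χ) (k : ℕ) : Continuous (χ k) :=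
  continuous_iff_continuousAt.2 fun x => (h.hasDerivAt k x).continuousAt

theorem continuous_slice {g : ℝ → ℝ → ℝ} (hg : Continuous fun p : ℝ × ℝ => g p.1 p.2) (t : ℝ) :
    Continuous (g t) :=
  hg.comp (Continuous.prodMk_right t)

theorem continuous_integral_slice {g : ℝ → ℝ → ℝ} (hg : Continuous fun p : ℝ × ℝ => g p.1 p.2)
    (a b : ℝ) : Continuous fun t => ∫ x in a..b, g t x :=
  intervalIntegral.continuous_parametric_intervalIntegral_of_continuous' hg a b

theorem integral_swap {g : ℝ → ℝ → ℝ} (hg : Continuous fun p : ℝ × ℝ => g p.1 p.2)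
    (s t a b : ℝ) :
    ∫ r in s..t, ∫ x in a..b, g r x = ∫ x in a..b, ∫ r in s..t, g r x := by
  refine intervalIntegral_intervalIntegral_swap (IntegrableOn.mono_set
    (t := uIcc s t ×ˢ uIcc a b) ?_ (prod_mono uIoc_subset_uIcc uIoc_subset_uIcc))
  exact hg.continuousOn.integrableOn_compact (isCompact_uIcc.prod isCompact_uIcc)

/-- Integrated form of a balance law with vanishing boundary flux. -/
theorem integral_balance {t₁ t₂ a b : ℝ} (h12 : t₁ ≤ t₂) {g gt Φ r : ℝ → ℝ → ℝ}
    (hg : ∀ t, Continuous (g t))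
    (hgt : Continuous fun p : ℝ × ℝ => gt p.1 p.2)
    (hr : Continuous fun p : ℝ × ℝ => r p.1 p.2)
    (hdt : ∀ t ∈ Icc t₁ t₂, ∀ x, HasDerivAt (fun s => g s x) (gt t x) t)
    (hdx : ∀ t ∈ Icc t₁ t₂, ∀ x, HasDerivAt (Φ t) (gt t x - r t x) x)
    (ha : ∀ t, Φ t a = 0) (hb : ∀ t, Φ t b = 0) :
    (∫ x in a..b, g t₂ x) - (∫ x in a..b, g t₁ x) = ∫ t in t₁..t₂, ∫ x in a..b, r t x := by
  rw [← intervalIntegral.integral_sub ((hg t₂).intervalIntegrable _ _)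
    ((hg t₁).intervalIntegrable _ _)]
  have h1 : ∀ x, g t₂ x - g t₁ x = ∫ t in t₁..t₂, gt t x := by
    intro x
    rw [intervalIntegral.integral_eq_sub_of_hasDerivAt (f := fun s => g s x)]
    · intro t ht
      rw [uIcc_of_le h12] at ht
      exact hdt t ht x
    · exact (hgt.comp (Continuous.prodMk_left x)).intervalIntegrable _ _
  simp_rw [h1]
  rw [← integral_swap hgt]
  apply intervalIntegral.integral_congr
  intro t ht
  rw [uIcc_of_le h12] at ht
  have h2 : ∫ x in a..b, (gt t x - r t x) = Φ t b - Φ t a :=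
    intervalIntegral.integral_eq_sub_of_hasDerivAt (fun x _ => hdx t ht x)
      (((continuous_slice hgt t).sub (continuous_slice hr t)).intervalIntegrable _ _)
  rw [intervalIntegral.integral_sub ((continuous_slice hgt t).intervalIntegrable _ _)
    ((continuous_slice hr t).intervalIntegrable _ _), ha, hb] at h2
  simp only
  linarith

/-- Weighted `L²` balance for `v_t + v_xxx + (v q)_x = 0`. -/
theorem mass_balance {t₁ t₂ a b : ℝ} (h12 : t₁ ≤ t₂) {v : ℕ → ℝ → ℝ → ℝ} {q q' : ℝ → ℝ → ℝ}
    (hv : ∀ k, Continuous fun p : ℝ × ℝ => v k p.1 p.2)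
    (hq : Continuous fun p : ℝ × ℝ => q p.1 p.2)
    (hq' : Continuous fun p : ℝ × ℝ => q' p.1 p.2)
    (hvx : ∀ k t x, HasDerivAt (v k t) (v (k + 1) t x) x)
    (hqx : ∀ t x, HasDerivAt (q t) (q' t x) x)
    (hvt : ∀ t ∈ Icc t₁ t₂, ∀ x, HasDerivAt (fun s => v 0 s x)
      (-(v 3 t x + v 1 t x * q t x + v 0 t x * q' t x)) t)
    {χ : ℕ → ℝ → ℝ} (hχ : IsJet χ) (ha : ∀ k, χ k a = 0) (hb : ∀ k, χ k b = 0) :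
    (∫ x in a..b, v 0 t₂ x ^ 2 * χ 0 x) - (∫ x in a..b, v 0 t₁ x ^ 2 * χ 0 x)
      = ∫ t in t₁..t₂, ∫ x in a..b, (-3 * v 1 t x ^ 2 * χ 1 x + v 0 t x ^ 2 * χ 3 x
          - v 0 t x ^ 2 * q' t x * χ 0 x + v 0 t x ^ 2 * q t x * χ 1 x) := by
  have c0 := hχ.continuous 0
  have c1 := hχ.continuous 1
  have c3 := hχ.continuous 3
  have v0 := hv 0
  have v1 := hv 1
  have v3 := hv 3
  refine integral_balance h12 (g := fun t x => v 0 t x ^ 2 * χ 0 x)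
    (gt := fun t x => 2 * v 0 t x * (-(v 3 t x + v 1 t x * q t x + v 0 t x * q' t x)) * χ 0 x)
    (Φ := fun t x => -2 * v 0 t x * v 2 t x * χ 0 x + v 1 t x ^ 2 * χ 0 x
      + 2 * v 0 t x * v 1 t x * χ 1 x - v 0 t x ^ 2 * χ 2 x - v 0 t x ^ 2 * q t x * χ 0 x)
    ?_ ?_ ?_ ?_ ?_ ?_ ?_
  · intro t
    exact ((continuous_slice v0 t).pow 2).mul c0
  · fun_prop
  · fun_prop
  · intro t ht x
    refine HasDerivAt.congr_deriv (((hvt t ht x).pow 2).mul_const (χ 0 x)) ?_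
    dsimp
    ring
  · intro t _ x
    have e0 := hvx 0 t x
    have e1 := hvx 1 t x
    have e2 := hvx 2 t x
    have f0 := hχ.hasDerivAt 0 x
    have f1 := hχ.hasDerivAt 1 x
    have f2 := hχ.hasDerivAt 2 x
    refine HasDerivAt.congr_deriv
      (((((((e0.const_mul (-2)).mul e2).mul f0).add ((e1.pow 2).mul f0)).add
      (((e0.const_mul 2).mul e1).mul f1)).sub ((e0.pow 2).mul f2)).sub
      (((e0.pow 2).mul (hqx t x)).mul f0)) ?_
    dsimp
    ring
  · intro t; simp [ha]
  · intro t; simp [hb]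

/-- Weighted balance of mass plus energy for the quartic gKdV equation. -/
theorem energy_balance {t₁ t₂ a b : ℝ} (h12 : t₁ ≤ t₂) {u : ℕ → ℝ → ℝ → ℝ}
    (hu : IsGKdVJet t₁ t₂ u) {Ψ : ℕ → ℝ → ℝ → ℝ} {Ψt : ℝ → ℝ → ℝ}
    (hΨ : ∀ k, Continuous fun p : ℝ × ℝ => Ψ k p.1 p.2)
    (hΨt : Continuous fun p : ℝ × ℝ => Ψt p.1 p.2)
    (hΨx : ∀ k < 3, ∀ t x, HasDerivAt (Ψ k t) (Ψ (k + 1) t x) x)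
    (hΨdt : ∀ t x, HasDerivAt (fun s => Ψ 0 s x) (Ψt t x) t)
    (ha : ∀ k t, Ψ k t a = 0) (hb : ∀ k t, Ψ k t b = 0) :
    (∫ x in a..b, (u 0 t₂ x ^ 2 + u 1 t₂ x ^ 2 - 2 / 5 * u 0 t₂ x ^ 5) * Ψ 0 t₂ x)
      - (∫ x in a..b, (u 0 t₁ x ^ 2 + u 1 t₁ x ^ 2 - 2 / 5 * u 0 t₁ x ^ 5) * Ψ 0 t₁ x)
      = ∫ t in t₁..t₂, ∫ x in a..b,
        ((u 0 t x ^ 2 + u 1 t x ^ 2 - 2 / 5 * u 0 t x ^ 5) * Ψt t x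
          + (-3 * u 1 t x ^ 2 + 8 / 5 * u 0 t x ^ 5 - (u 2 t x + u 0 t x ^ 4) ^ 2
            - 2 * u 2 t x ^ 2 + 8 * u 0 t x ^ 3 * u 1 t x ^ 2) * Ψ 1 t x
          + (u 0 t x ^ 2 + u 1 t x ^ 2) * Ψ 3 t x) := by
  have p0 := hΨ 0
  have p1 := hΨ 1
  have p3 := hΨ 3
  have v0 := hu.cont 0
  have v1 := hu.cont 1
  have v2 := hu.cont 2
  have v3 := hu.cont 3
  have v4 := hu.cont 4
  refine integral_balance h12
    (g := fun t x => (u 0 t x ^ 2 + u 1 t x ^ 2 - 2 / 5 * u 0 t x ^ 5) * Ψ 0 t x)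
    (gt := fun t x => (2 * u 0 t x * (-(u 3 t x + 4 * u 0 t x ^ 3 * u 1 t x))
      + 2 * u 1 t x *
        (-(u 4 t x + 12 * u 0 t x ^ 2 * u 1 t x ^ 2 + 4 * u 0 t x ^ 3 * u 2 t x))
      - 2 * u 0 t x ^ 4 * (-(u 3 t x + 4 * u 0 t x ^ 3 * u 1 t x))) * Ψ 0 t x
      + (u 0 t x ^ 2 + u 1 t x ^ 2 - 2 / 5 * u 0 t x ^ 5) * Ψt t x)
    (Φ := fun t x => (-2 * (u 0 t x * u 2 t x) + u 1 t x ^ 2 - 8 / 5 * u 0 t x ^ 5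
        - 2 * (u 1 t x * (u 3 t x + 4 * (u 0 t x ^ 3 * u 1 t x)))
        + (u 2 t x + u 0 t x ^ 4) ^ 2) * Ψ 0 t x
      + (2 * (u 0 t x * u 1 t x) + 2 * (u 1 t x * u 2 t x)) * Ψ 1 t x
      - (u 0 t x ^ 2 + u 1 t x ^ 2) * Ψ 2 t x)
    ?_ ?_ ?_ ?_ ?_ ?_ ?_
  · intro t
    have := continuous_slice v0 t
    have := continuous_slice v1 t
    have := continuous_slice p0 t
    fun_prop
  · fun_prop
  · fun_prop
  · intro t ht x
    have e0 := hu.hasDerivAt_t t ht x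
    have e1 := hu.hasDerivAt_t_one t ht x
    refine HasDerivAt.congr_deriv
      ((((e0.pow 2).add (e1.pow 2)).sub ((e0.pow 5).const_mul (2 / 5))).mul
      (hΨdt t x)) ?_
    dsimp
    ring
  · intro t _ x
    have e0 := hu.hasDerivAt_x 0 t x
    have e1 := hu.hasDerivAt_x 1 t x
    have e2 := hu.hasDerivAt_x 2 t x
    have e3 := hu.hasDerivAt_x 3 t x
    have f0 := hΨx 0 (by norm_num) t x
    have f1 := hΨx 1 (by norm_num) t x
    have f2 := hΨx 2 (by norm_num) t x
    refine HasDerivAt.congr_deriv ((((((((e0.mul e2).const_mul (-2)).add (e1.pow 2)).sub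
      ((e0.pow 5).const_mul (8 / 5))).sub
      ((e1.mul (e3.add (((e0.pow 3).mul e1).const_mul 4))).const_mul 2)).add
      ((e2.add (e0.pow 4)).pow 2)).mul f0).add
      ((((e0.mul e1).const_mul 2).add ((e1.mul e2).const_mul 2)).mul f1) |>.sub
      (((e0.pow 2).add (e1.pow 2)).mul f2)) ?_
    dsimp
    ring
  · intro t; simp [ha]
  · intro t; simp [hb]

theorem hasDerivAt_slice_right {g : ℝ → ℝ → ℝ} (hg : ContDiff ℝ ∞ (Function.uncurry g))
    (t x : ℝ) : HasDerivAt (g t) (fderiv ℝ (Function.uncurry g) (t, x) (0, 1)) x := by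
  have h := (hg.differentiable (by simp) (t, x)).hasFDerivAt
  exact h.comp_hasDerivAt x ((hasDerivAt_const x t).prodMk (hasDerivAt_id x))

theorem hasDerivAt_slice_left {g : ℝ → ℝ → ℝ} (hg : ContDiff ℝ ∞ (Function.uncurry g))
    (t x : ℝ) :
    HasDerivAt (fun s => g s x) (fderiv ℝ (Function.uncurry g) (t, x) (1, 0)) t := by
  have h := (hg.differentiable (by simp) (t, x)).hasFDerivAt
  exact h.comp_hasDerivAt t ((hasDerivAt_id t).prodMk (hasDerivAt_const t x))

theorem contDiff_deriv_right {g : ℝ → ℝ → ℝ} (hg : ContDiff ℝ ∞ (Function.uncurry g)) :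
    ContDiff ℝ ∞ (Function.uncurry fun t x => deriv (g t) x) := by
  have h : (Function.uncurry fun t x => deriv (g t) x)
      = fun p => fderiv ℝ (Function.uncurry g) p (0, 1) := by
    ext ⟨t, x⟩
    exact (hasDerivAt_slice_right hg t x).deriv
  rw [h]
  exact (hg.fderiv_right (m := ∞) (by simp)).clm_apply contDiff_const

/-- Equality of mixed partial derivatives. -/
theorem hasDerivAt_deriv_right {g : ℝ → ℝ → ℝ} (hg : ContDiff ℝ ∞ (Function.uncurry g))
    (t x : ℝ) :
    HasDerivAt (fun s => deriv (g s) x) (deriv (fun y => deriv (fun s => g s y) t) x) t := by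
  have hD : ContDiff ℝ ∞ (fderiv ℝ (Function.uncurry g)) := hg.fderiv_right (by simp)
  have h2 := (hD.differentiable (by simp) (t, x)).hasFDerivAt
  have hs : IsSymmSndFDerivAt ℝ (Function.uncurry g) (t, x) :=
    hg.contDiffAt.isSymmSndFDerivAt (by
      simpa using WithTop.coe_le_coe.2 (le_top : (2 : ℕ∞) ≤ ⊤))
  have e1 : (fun s => deriv (g s) x) = fun s => fderiv ℝ (Function.uncurry g) (s, x) (0, 1) :=
    funext fun s => (hasDerivAt_slice_right hg s x).deriv
  have e2 : (fun y => deriv (fun s => g s y) t)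
      = fun y => fderiv ℝ (Function.uncurry g) (t, y) (1, 0) :=
    funext fun y => (hasDerivAt_slice_left hg t y).deriv
  have h3 : ∀ w : ℝ × ℝ, HasFDerivAt (fun p => fderiv ℝ (Function.uncurry g) p w)
      ((fderiv ℝ (fderiv ℝ (Function.uncurry g)) (t, x)).flip w) (t, x) := fun w => by
    simpa using h2.clm_apply (hasFDerivAt_const w (t, x))
  have d1 : HasDerivAt (fun s => fderiv ℝ (Function.uncurry g) (s, x) (0, 1))
      (fderiv ℝ (fderiv ℝ (Function.uncurry g)) (t, x) (1, 0) (0, 1)) t :=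
    HasFDerivAt.comp_hasDerivAt (f := fun s : ℝ => (s, x)) t (h3 (0, 1))
      ((hasDerivAt_id t).prodMk (hasDerivAt_const t x))
  have d2 : HasDerivAt (fun y => fderiv ℝ (Function.uncurry g) (t, y) (1, 0))
      (fderiv ℝ (fderiv ℝ (Function.uncurry g)) (t, x) (0, 1) (1, 0)) x :=
    HasFDerivAt.comp_hasDerivAt (f := fun y : ℝ => (t, y)) x (h3 (1, 0))
      ((hasDerivAt_const x t).prodMk (hasDerivAt_id x))
  rw [e1, e2, d2.deriv, ← hs.eq (1, 0) (0, 1)]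
  exact d1

theorem contDiff_iteratedDeriv_right {u : ℝ → ℝ → ℝ} (hu : ContDiff ℝ ∞ (Function.uncurry u))
    (k : ℕ) : ContDiff ℝ ∞ (Function.uncurry fun t x => iteratedDeriv k (u t) x) := by
  induction k with
  | zero => simpa using hu
  | succ k ih =>
    simp only [iteratedDeriv_succ]
    exact contDiff_deriv_right ih

/-- A smooth solution of the quartic gKdV equation generates a solution jet. -/
theorem isGKdVJet_iteratedDeriv {t₁ t₂ : ℝ} {u : ℝ → ℝ → ℝ}
    (hu : ContDiff ℝ ∞ (Function.uncurry u))
    (heq : ∀ t ∈ Icc t₁ t₂, ∀ x : ℝ, deriv (fun s => u s x) t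
      + deriv (fun y => iteratedDeriv 2 (u t) y + (u t y) ^ 4) x = 0) :
    IsGKdVJet t₁ t₂ fun k t x => iteratedDeriv k (u t) x := by
  have hx : ∀ k t x, HasDerivAt (fun y => iteratedDeriv k (u t) y)
      (iteratedDeriv (k + 1) (u t) x) x := by
    intro k t x
    rw [iteratedDeriv_succ]
    exact (hasDerivAt_slice_right
      (contDiff_iteratedDeriv_right hu k) t x).differentiableAt.hasDerivAt
  have h0 : ∀ t ∈ Icc t₁ t₂, ∀ x, deriv (fun s => u s x) t
      = -(iteratedDeriv 3 (u t) x + 4 * iteratedDeriv 0 (u t) x ^ 3 * iteratedDeriv 1 (u t) x) := by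
    intro t ht x
    have h := ((hx 2 t x).add ((hx 0 t x).pow 4)).deriv
    have h' := heq t ht x
    have : (fun y => iteratedDeriv 2 (u t) y + (u t y) ^ 4)
      = ((fun y => iteratedDeriv 2 (u t) y) + (fun y => iteratedDeriv 0 (u t) y) ^ 4) := by
      ext y; simp
    rw [this, h] at h'
    norm_num at h' ⊢
    linarith
  refine ⟨fun k => (contDiff_iteratedDeriv_right hu k).continuous, hx, ?_, ?_⟩
  · intro t ht x
    rw [← h0 t ht x]
    simpa using (hasDerivAt_slice_left hu t x).differentiableAt.hasDerivAt
  · intro t ht x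
    have h := hasDerivAt_deriv_right hu t x
    rw [funext (h0 t ht)] at h
    simp only [iteratedDeriv_one] at h ⊢
    refine h.congr_deriv ?_
    have e0 := hx 0 t x
    have e1 := hx 1 t x
    have e3 := hx 3 t x
    simp only [iteratedDeriv_one, zero_add] at e0 e1
    refine ((e3.add (((e0.pow 3).const_mul 4).mul e1)).neg.deriv).trans ?_
    dsimp
    ring

/-- A smooth monotone step from `0` to `1` with transition in `[0, 4]`, given by its jet. -/
structure IsStep (S : ℕ → ℝ → ℝ) (κ B : ℝ) : Prop where
  jet : IsJet S
  left : ∀ k, ∀ x ≤ 0, S k x = 0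
  right : ∀ k, ∀ x, 4 ≤ x → S (k + 1) x = 0
  right_zero : ∀ x, 4 ≤ x → S 0 x = 1
  deriv_nonneg : ∀ x, 0 ≤ S 1 x
  pos : 0 < κ
  le_deriv : ∀ x ∈ Icc (1 : ℝ) 3, κ ≤ S 1 x
  one_le : 1 ≤ B
  abs_le : ∀ k ≤ 4, ∀ x, |S k x| ≤ B

theorem exists_isStep : ∃ S κ B, IsStep S κ B := by
  set p : ℝ → ℝ := fun y => Real.smoothTransition (2 * y - 1) * Real.smoothTransition (7 - 2 * y)
    with hp
  have ps : ContDiff ℝ ∞ p := by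
    have h1 : ContDiff ℝ ∞ fun y : ℝ => 2 * y - 1 := by fun_prop
    have h2 : ContDiff ℝ ∞ fun y : ℝ => 7 - 2 * y := by fun_prop
    exact (Real.smoothTransition.contDiff.comp h1).mul (Real.smoothTransition.contDiff.comp h2)
  have p0 : ∀ y, 0 ≤ p y := fun y =>
    mul_nonneg (Real.smoothTransition.nonneg _) (Real.smoothTransition.nonneg _)
  have pl : ∀ y ≤ 1 / 2, p y = 0 := fun y hy => by
    simp only [hp]
    rw [Real.smoothTransition.zero_of_nonpos (by linarith), zero_mul]
  have pr : ∀ y, 7 / 2 ≤ y → p y = 0 := fun y hy => by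
    simp only [hp]
    rw [Real.smoothTransition.zero_of_nonpos (x := 7 - 2 * y) (by linarith), mul_zero]
  have p1 : ∀ y ∈ Icc (1 : ℝ) 3, p y = 1 := fun y hy => by
    simp only [hp]
    rw [Real.smoothTransition.one_of_one_le (by linarith [hy.1]),
      Real.smoothTransition.one_of_one_le (by linarith [hy.2]), mul_one]
  have dl : ∀ k, ∀ x ≤ 0, iteratedDeriv k p x = 0 := by
    intro k x hx
    have : p =ᶠ[𝓝 x] fun _ => (0 : ℝ) := by
      filter_upwards [Iio_mem_nhds (show x < 1 / 2 by linarith)] with y hy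
      exact pl y (le_of_lt hy)
    rw [this.iteratedDeriv_eq]
    simp
  have dr : ∀ k, ∀ x, 4 ≤ x → iteratedDeriv k p x = 0 := by
    intro k x hx
    have : p =ᶠ[𝓝 x] fun _ => (0 : ℝ) := by
      filter_upwards [Ioi_mem_nhds (show 7 / 2 < x by linarith)] with y hy
      exact pr y (le_of_lt hy)
    rw [this.iteratedDeriv_eq]
    simp
  have dc : ∀ k, Continuous (iteratedDeriv k p) := fun k =>
    ps.continuous_iteratedDeriv k (by exact_mod_cast le_top)
  have dd : ∀ k x, HasDerivAt (iteratedDeriv k p) (iteratedDeriv (k + 1) p x) x := by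
    intro k x
    rw [iteratedDeriv_succ]
    exact (ps.differentiable_iteratedDeriv k (by exact_mod_cast WithTop.coe_lt_top _) x).hasDerivAt
  have pc : Continuous p := ps.continuous
  set c : ℝ := ∫ y in (0 : ℝ)..4, p y with hc
  have c0 : 0 < c := by
    have h : ∫ y in (1 : ℝ)..3, p y = 2 := by
      rw [intervalIntegral.integral_congr (g := fun _ => (1 : ℝ))]
      · norm_num
      · intro y hy
        rw [uIcc_of_le (by norm_num)] at hy
        exact p1 y hy
    have : ∫ y in (1 : ℝ)..3, p y ≤ c := by
      apply intervalIntegral.integral_mono_interval (by norm_num) (by norm_num) (by norm_num)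
      · exact Eventually.of_forall p0
      · exact pc.intervalIntegrable _ _
    linarith
  have Sl : ∀ x ≤ 0, ∫ y in (0 : ℝ)..x, p y = 0 := by
    intro x hx
    rw [intervalIntegral.integral_congr (g := fun _ => (0 : ℝ))]
    · simp
    · intro y hy
      rw [uIcc_of_ge hx] at hy
      exact pl y (by linarith [hy.2])
  have Sr : ∀ x, 4 ≤ x → ∫ y in (0 : ℝ)..x, p y = c := by
    intro x hx
    rw [← intervalIntegral.integral_add_adjacent_intervals (b := 4)
      (pc.intervalIntegrable _ _) (pc.intervalIntegrable _ _),
      intervalIntegral.integral_congr (a := 4) (g := fun _ => (0 : ℝ))]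
    · simp [hc]
    · intro y hy
      rw [uIcc_of_le hx] at hy
      exact pr y (by linarith [hy.1])
  let S : ℕ → ℝ → ℝ := fun k x =>
    match k with
    | 0 => (∫ y in (0 : ℝ)..x, p y) / c
    | k + 1 => iteratedDeriv k p x / c
  have jet : IsJet S := by
    refine ⟨fun k x => ?_⟩
    cases k with
    | zero =>
      refine ((intervalIntegral.integral_hasDerivAt_right (pc.intervalIntegrable 0 x)
        (pc.stronglyMeasurableAtFilter _ _) pc.continuousAt).div_const c).congr_deriv ?_
      simp [S]
    | succ k => exact (dd k x).div_const c
  have bdd : ∀ k, ∃ b, ∀ x, |S k x| ≤ b := by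
    intro k
    obtain ⟨b, hb⟩ := (isCompact_Icc (a := (0 : ℝ)) (b := 4)).exists_bound_of_continuousOn
      (jet.continuous k).continuousOn
    refine ⟨max b 1, fun x => ?_⟩
    by_cases h1 : x ≤ 0
    · have : S k x = 0 := by
        cases k with
        | zero => simp [S, Sl x h1]
        | succ k => simp [S, dl k x h1]
      simp [this]
    by_cases h2 : 4 ≤ x
    · have : |S k x| ≤ 1 := by
        cases k with
        | zero => simp [S, Sr x h2, c0.ne']
        | succ k => simp [S, dr k x h2]
      exact this.trans (le_max_right _ _)
    · exact (hb x ⟨by linarith, by linarith⟩).trans (le_max_left _ _)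
  choose b hb using bdd
  refine ⟨S, 1 / c, max 1 (max (max (b 0) (b 1)) (max (b 2) (max (b 3) (b 4)))),
    jet, ?_, ?_, ?_, ?_, by positivity, ?_, le_max_left _ _, ?_⟩
  · intro k x hx
    cases k with
    | zero => simp [S, Sl x hx]
    | succ k => simp [S, dl k x hx]
  · intro k x hx
    simp [S, dr k x hx]
  · intro x hx
    simp [S, Sr x hx, c0.ne']
  · intro x
    simpa [S] using div_nonneg (p0 x) c0.le
  · intro x hx
    simp [S, p1 x hx]
  · intro k hk x
    refine (hb k x).trans ?_
    interval_cases k <;> simp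

/-- Derivatives of `phi` up to order three. -/
noncomputable def phiJet (k : ℕ) (y : ℝ) : ℝ :=
  match k with
  | 0 => phi y
  | 1 => 2 / π * (exp y / (1 + exp y ^ 2))
  | 2 => 2 / π * (exp y * (1 - exp y ^ 2) / (1 + exp y ^ 2) ^ 2)
  | _ => 2 / π * (exp y * (1 - 6 * exp y ^ 2 + exp y ^ 4) / (1 + exp y ^ 2) ^ 3)

theorem hasDerivAt_phiJet (k : ℕ) (hk : k < 3) (y : ℝ) :
    HasDerivAt (phiJet k) (phiJet (k + 1) y) y := by
  have e := Real.hasDerivAt_exp y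
  have h1 : 1 + exp y ^ 2 ≠ 0 := by positivity
  have d := (e.pow 2).const_add 1
  interval_cases k
  · refine (e.arctan.const_mul (2 / π)).congr_deriv ?_
    simp only [phiJet]
    field_simp
  · refine ((e.div d h1).const_mul (2 / π)).congr_deriv ?_
    simp only [phiJet, Pi.pow_apply]
    field_simp
    ring
  · refine (((e.mul ((e.pow 2).const_sub 1)).div (d.pow 2) (pow_ne_zero 2 h1)).const_mul
      (2 / π)).congr_deriv ?_
    simp only [phiJet, Pi.pow_apply, Pi.mul_apply]
    field_simp
    ring

theorem continuous_phiJet (k : ℕ) : Continuous (phiJet k) := by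
  have h : ∀ y : ℝ, 1 + exp y ^ 2 ≠ 0 := fun y => by positivity
  have c := Real.continuous_exp
  match k with
  | 0 => exact continuous_const.mul (Real.continuous_arctan.comp c)
  | 1 => exact continuous_const.mul (c.div (by fun_prop) h)
  | 2 => exact continuous_const.mul ((by fun_prop : Continuous fun y : ℝ =>
      exp y * (1 - exp y ^ 2)).div (by fun_prop) fun y => pow_ne_zero 2 (h y))
  | _ + 3 => exact continuous_const.mul ((by fun_prop : Continuous fun y : ℝ =>
      exp y * (1 - 6 * exp y ^ 2 + exp y ^ 4)).div (by fun_prop) fun y => pow_ne_zero 3 (h y))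

theorem two_div_pi_le_one : 2 / π ≤ 1 := by
  rw [div_le_one Real.pi_pos]
  exact Real.two_le_pi

theorem phi_nonneg (y : ℝ) : 0 ≤ phi y :=
  mul_nonneg (by positivity) (Real.arctan_nonneg.2 (exp_pos y).le)

theorem phi_le_one (y : ℝ) : phi y ≤ 1 := by
  have h := Real.arctan_lt_pi_div_two (exp y)
  have : phi y ≤ 2 / π * (π / 2) := mul_le_mul_of_nonneg_left h.le (by positivity)
  refine this.trans (le_of_eq ?_)
  field_simp

theorem phi_le_exp (y : ℝ) : phi y ≤ exp y := by
  have h : Real.arctan (exp y) ≤ exp y := by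
    have h0 := Real.arctan_nonneg.2 (exp_pos y).le
    have := Real.le_tan h0 (Real.arctan_lt_pi_div_two _)
    rwa [Real.tan_arctan] at this
  calc phi y ≤ 1 * exp y := mul_le_mul two_div_pi_le_one h
        (Real.arctan_nonneg.2 (exp_pos y).le) zero_le_one
    _ = exp y := one_mul _

theorem phiJet_one_nonneg (y : ℝ) : 0 ≤ phiJet 1 y := by
  simp only [phiJet]
  positivity

theorem phiJet_one_le_exp (y : ℝ) : phiJet 1 y ≤ exp y := by
  simp only [phiJet]
  have h : exp y / (1 + exp y ^ 2) ≤ exp y :=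
    div_le_self (exp_pos y).le (by nlinarith [exp_pos y])
  calc _ ≤ 1 * exp y := mul_le_mul two_div_pi_le_one h (by positivity) zero_le_one
    _ = exp y := one_mul _

theorem phiJet_one_le_one (y : ℝ) : phiJet 1 y ≤ 1 := by
  simp only [phiJet]
  have h : exp y / (1 + exp y ^ 2) ≤ 1 := by
    rw [div_le_one (by positivity)]
    nlinarith [exp_pos y]
  exact mul_le_one₀ two_div_pi_le_one (by positivity) h

theorem abs_phiJet_two_le_one (y : ℝ) : |phiJet 2 y| ≤ 1 := by
  simp only [phiJet]
  rw [abs_mul, abs_of_pos (by positivity : 0 < 2 / π), abs_div, abs_mul,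
    abs_of_pos (exp_pos y), abs_of_pos (by positivity : 0 < (1 + exp y ^ 2) ^ 2)]
  have h1 : |1 - exp y ^ 2| ≤ 1 + exp y ^ 2 := by
    rw [abs_le]; constructor <;> nlinarith [exp_pos y]
  have h : exp y * |1 - exp y ^ 2| / (1 + exp y ^ 2) ^ 2 ≤ 1 := by
    rw [div_le_one (by positivity), sq (1 + exp y ^ 2)]
    exact mul_le_mul (by nlinarith [exp_pos y]) h1 (abs_nonneg _) (by positivity)
  exact mul_le_one₀ two_div_pi_le_one (by positivity) h

theorem phiJet_three_le (y : ℝ) : phiJet 3 y ≤ phiJet 1 y := by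
  simp only [phiJet]
  apply mul_le_mul_of_nonneg_left _ (by positivity)
  rw [div_le_div_iff₀ (by positivity) (by positivity)]
  have e := exp_pos y
  generalize exp y = E at *
  have : 0 ≤ 8 * E ^ 3 * (1 + E ^ 2) := by positivity
  nlinarith

/-- Local form of the embedding of `H¹` into bounded functions. -/
theorem sq_le_integral_add {f f' : ℝ → ℝ} (hf : ∀ x, HasDerivAt f (f' x) x)
    (hf' : Continuous f') {s : ℝ} (hs : 0 < s) {c x : ℝ} (hx : x ∈ Icc c (c + 2)) :
    f x ^ 2 ≤ (1 + s) * (∫ y in c..(c + 2), f y ^ 2) + 1 / s * ∫ y in c..(c + 2), f' y ^ 2 := by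
  have cf : Continuous f := continuous_iff_continuousAt.2 fun x => (hf x).continuousAt
  set w : ℝ → ℝ := fun y => s * f y ^ 2 + 1 / s * f' y ^ 2 with hw
  have cw : Continuous w := by fun_prop
  have w0 : ∀ y, 0 ≤ w y := fun y => by positivity
  have hsq : ∀ y, HasDerivAt (fun z => f z ^ 2) (2 * f y * f' y) y := fun y => by
    refine ((hf y).pow 2).congr_deriv ?_
    simp
  have key : ∀ y, |2 * f y * f' y| ≤ w y := fun y => by
    have e : w y = ((s * f y) ^ 2 + f' y ^ 2) / s := by
      simp only [hw]; field_simp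
    rw [e, le_div_iff₀ hs, ← abs_of_pos hs, ← abs_mul, abs_of_pos hs, abs_le]
    constructor <;> nlinarith [sq_nonneg (s * f y + f' y), sq_nonneg (s * f y - f' y)]
  have hd : ∀ y ∈ Icc c (c + 2), f x ^ 2 ≤ f y ^ 2 + ∫ z in c..(c + 2), w z := by
    intro y hy
    have ftc : ∀ a b, ∫ z in a..b, 2 * f z * f' z = f b ^ 2 - f a ^ 2 := fun a b =>
      intervalIntegral.integral_eq_sub_of_hasDerivAt (fun z _ => hsq z)
        ((by fun_prop : Continuous fun z => 2 * f z * f' z).intervalIntegrable _ _)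
    have h1 : |∫ z in y..x, 2 * f z * f' z| ≤ |∫ z in y..x, w z| := by
      simpa only [Real.norm_eq_abs] using intervalIntegral.norm_integral_le_abs_of_norm_le
        (f := fun z => 2 * f z * f' z) (Eventually.of_forall key)
        (cw.intervalIntegrable y x)
    have h2 : |∫ z in y..x, w z| ≤ ∫ z in c..(c + 2), w z := by
      rcases le_total y x with h | h
      · rw [abs_of_nonneg (intervalIntegral.integral_nonneg h fun z _ => w0 z)]
        exact intervalIntegral.integral_mono_interval hy.1 h hx.2
          (Eventually.of_forall w0) (cw.intervalIntegrable _ _)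
      · rw [intervalIntegral.integral_symm, abs_neg,
          abs_of_nonneg (intervalIntegral.integral_nonneg h fun z _ => w0 z)]
        exact intervalIntegral.integral_mono_interval hx.1 h hy.2
          (Eventually.of_forall w0) (cw.intervalIntegrable _ _)
    rw [ftc] at h1
    linarith [le_abs_self (f x ^ 2 - f y ^ 2)]
  have hm : ∫ _ in c..(c + 2), f x ^ 2
      ≤ ∫ y in c..(c + 2), (f y ^ 2 + ∫ z in c..(c + 2), w z) :=
    intervalIntegral.integral_mono_on (by linarith) (continuous_const.intervalIntegrable _ _)
      (((cf.pow 2).add continuous_const).intervalIntegrable _ _) hd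
  rw [intervalIntegral.integral_add
    ((by fun_prop : Continuous fun y => f y ^ 2).intervalIntegrable _ _)
    (continuous_const.intervalIntegrable _ _)] at hm
  simp only [intervalIntegral.integral_const, smul_eq_mul] at hm
  have e : ∫ z in c..(c + 2), w z = s * (∫ y in c..(c + 2), f y ^ 2)
      + 1 / s * ∫ y in c..(c + 2), f' y ^ 2 := by
    simp only [hw]
    rw [intervalIntegral.integral_add
      ((by fun_prop : Continuous fun y => s * f y ^ 2).intervalIntegrable _ _)
      ((by fun_prop : Continuous fun y => 1 / s * f' y ^ 2).intervalIntegrable _ _),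
      intervalIntegral.integral_const_mul, intervalIntegral.integral_const_mul]
  have p : 0 ≤ ∫ y in c..(c + 2), f y ^ 2 :=
    intervalIntegral.integral_nonneg (by linarith) fun y _ => sq_nonneg _
  rw [e] at hm
  linarith

theorem slope_eq_integral {f f' : ℝ → ℝ} (hf : ∀ x, HasDerivAt f (f' x) x)
    (hf' : Continuous f') {h : ℝ} (h0 : 0 < h) (x : ℝ) :
    (f (x + h) - f x) / h = ∫ s in (0 : ℝ)..1, f' (x + h * s) := by
  have d : ∀ s, HasDerivAt (fun s => f (x + h * s) / h) (f' (x + h * s)) s := by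
    intro s
    have := ((hf (x + h * s)).comp s (((hasDerivAt_id s).const_mul h).const_add x)).div_const h
    refine this.congr_deriv ?_
    field_simp
  rw [intervalIntegral.integral_eq_sub_of_hasDerivAt (fun s _ => d s)
    ((by fun_prop : Continuous fun s => f' (x + h * s)).intervalIntegrable _ _)]
  simp [sub_div]

/-- Difference quotients are controlled in `L²` by the derivative. -/
theorem integral_sq_slope_le {f f' : ℝ → ℝ} (hf : ∀ x, HasDerivAt f (f' x) x)
    (hf' : Continuous f') {h a b : ℝ} (h0 : 0 < h) (h1 : h ≤ 1) (hab : a ≤ b) :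
    ∫ x in a..b, ((f (x + h) - f x) / h) ^ 2 ≤ ∫ x in a..(b + 1), f' x ^ 2 := by
  have cf : Continuous f := continuous_iff_continuousAt.2 fun x => (hf x).continuousAt
  have jensen : ∀ x, ((f (x + h) - f x) / h) ^ 2 ≤ ∫ s in (0 : ℝ)..1, f' (x + h * s) ^ 2 := by
    intro x
    set m := (f (x + h) - f x) / h with hm
    have c : Continuous fun s => f' (x + h * s) := by fun_prop
    have i1 : 0 ≤ ∫ s in (0 : ℝ)..1, (f' (x + h * s) - m) ^ 2 :=
      intervalIntegral.integral_nonneg zero_le_one fun s _ => sq_nonneg _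
    have i2 : ∫ s in (0 : ℝ)..1, (f' (x + h * s) - m) ^ 2
        = (∫ s in (0 : ℝ)..1, f' (x + h * s) ^ 2) - m ^ 2 := by
      have e : ∀ s, (f' (x + h * s) - m) ^ 2
        = f' (x + h * s) ^ 2 - (2 * m * f' (x + h * s) - m ^ 2) := fun s => by ring
      simp_rw [e]
      rw [intervalIntegral.integral_sub
        ((by fun_prop : Continuous fun s => f' (x + h * s) ^ 2).intervalIntegrable _ _)
        ((by fun_prop : Continuous fun s => 2 * m * f' (x + h * s) - m ^ 2).intervalIntegrable _ _),
        intervalIntegral.integral_sub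
        ((by fun_prop : Continuous fun s => 2 * m * f' (x + h * s)).intervalIntegrable _ _)
        (continuous_const.intervalIntegrable _ _), intervalIntegral.integral_const_mul, 
        ← slope_eq_integral hf hf' h0 x]
      simp [← hm]
      ring
    linarith
  calc ∫ x in a..b, ((f (x + h) - f x) / h) ^ 2
      ≤ ∫ x in a..b, ∫ s in (0 : ℝ)..1, f' (x + h * s) ^ 2 := by
        refine intervalIntegral.integral_mono_on hab
          ((by fun_prop : Continuous fun x => ((f (x + h) - f x) / h) ^ 2).intervalIntegrable _ _)
          ((continuous_integral_slice (g := fun x s => f' (x + h * s) ^ 2)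
            (by fun_prop) 0 1).intervalIntegrable _ _) fun x _ => jensen x
    _ = ∫ s in (0 : ℝ)..1, ∫ x in a..b, f' (x + h * s) ^ 2 :=
        integral_swap (g := fun x s => f' (x + h * s) ^ 2) (by fun_prop) _ _ _ _
    _ ≤ ∫ _ in (0 : ℝ)..1, ∫ x in a..(b + 1), f' x ^ 2 := by
        refine intervalIntegral.integral_mono_on zero_le_one
          ((continuous_integral_slice (g := fun s x => f' (x + h * s) ^ 2)
            (by fun_prop) a b).intervalIntegrable _ _)
          (continuous_const.intervalIntegrable _ _) fun s hs => ?_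
        rw [intervalIntegral.integral_comp_add_right (fun x => f' x ^ 2)]
        have : 0 ≤ h * s := mul_nonneg h0.le hs.1
        have : h * s ≤ 1 := mul_le_one₀ h1 hs.1 hs.2
        exact intervalIntegral.integral_mono_interval (by linarith) (by linarith) (by linarith)
          (Eventually.of_forall fun x => sq_nonneg _) ((hf'.pow 2).intervalIntegrable _ _)
    _ = ∫ x in a..(b + 1), f' x ^ 2 := by simp

theorem integral_eq_of_support {f : ℝ → ℝ} (hf : Continuous f) {A a b B : ℝ}
    (hAa : A ≤ a) (hbB : b ≤ B) (hl : ∀ x ≤ a, f x = 0) (hr : ∀ x, b ≤ x → f x = 0) :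
    ∫ x in A..B, f x = ∫ x in a..b, f x := by
  rw [← intervalIntegral.integral_add_adjacent_intervals (b := a) (hf.intervalIntegrable _ _)
    (hf.intervalIntegrable _ _), ← intervalIntegral.integral_add_adjacent_intervals (b := b)
    (c := B) (hf.intervalIntegrable _ _) (hf.intervalIntegrable _ _),
    intervalIntegral.integral_congr (a := A) (b := a) (g := fun _ => (0 : ℝ)),
    intervalIntegral.integral_congr (a := b) (b := B) (g := fun _ => (0 : ℝ))]
  · simp
  · intro x hx
    rw [uIcc_of_le hbB] at hx
    exact hr x hx.1
  · intro x hx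
    rw [uIcc_of_le hAa] at hx
    exact hl x hx.2

theorem integral_integral_mono {g g' : ℝ → ℝ → ℝ} (hg : Continuous fun p : ℝ × ℝ => g p.1 p.2)
    (hg' : Continuous fun p : ℝ × ℝ => g' p.1 p.2) {s t a b : ℝ} (hst : s ≤ t) (hab : a ≤ b)
    (h : ∀ r ∈ Icc s t, ∀ x ∈ Icc a b, g r x ≤ g' r x) :
    ∫ r in s..t, ∫ x in a..b, g r x ≤ ∫ r in s..t, ∫ x in a..b, g' r x :=
  intervalIntegral.integral_mono_on hst ((continuous_integral_slice hg a b).intervalIntegrable _ _)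
    ((continuous_integral_slice hg' a b).intervalIntegrable _ _) fun r hr =>
    intervalIntegral.integral_mono_on hab ((continuous_slice hg r).intervalIntegrable _ _)
      ((continuous_slice hg' r).intervalIntegrable _ _) (h r hr)

theorem integral_integral_add_of_continuous {g g' : ℝ → ℝ → ℝ}
    (hg : Continuous fun p : ℝ × ℝ => g p.1 p.2)
    (hg' : Continuous fun p : ℝ × ℝ => g' p.1 p.2) (s t a b : ℝ) :
    ∫ r in s..t, ∫ x in a..b, (g r x + g' r x)
      = (∫ r in s..t, ∫ x in a..b, g r x) + ∫ r in s..t, ∫ x in a..b, g' r x := by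
  rw [← intervalIntegral.integral_add ((continuous_integral_slice hg a b).intervalIntegrable _ _)
    ((continuous_integral_slice hg' a b).intervalIntegrable _ _)]
  refine intervalIntegral.integral_congr fun r _ => ?_
  exact intervalIntegral.integral_add ((continuous_slice hg r).intervalIntegrable _ _)
    ((continuous_slice hg' r).intervalIntegrable _ _)

theorem integral_integral_const_mul (c : ℝ) (g : ℝ → ℝ → ℝ) (s t a b : ℝ) :
    ∫ r in s..t, ∫ x in a..b, c * g r x = c * ∫ r in s..t, ∫ x in a..b, g r x := by
  simp only [intervalIntegral.integral_const_mul]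

/-- A nonnegative continuous function with bounded integrals has vanishing right tails. -/
theorem exists_tail_bound {G : ℝ → ℝ} (hG : Continuous G) (h0 : ∀ x, 0 ≤ G x) {A : ℝ}
    (hA : ∀ a b, a ≤ b → ∫ x in a..b, G x ≤ A) :
    ∃ ε : ℕ → ℝ, Tendsto ε atTop (𝓝 0) ∧
      ∀ (n : ℕ) (a b : ℝ), n ≤ a → a ≤ b → ∫ x in a..b, G x ≤ ε n := by
  set I : ℝ → ℝ := fun y => ∫ x in (0 : ℝ)..y, G x with hI
  have sub : ∀ a b, ∫ x in a..b, G x = I b - I a := fun a b =>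
    (intervalIntegral.integral_interval_sub_left (hG.intervalIntegrable _ _)
      (hG.intervalIntegrable _ _)).symm
  have mono : Monotone I := fun a b hab => by
    have := intervalIntegral.integral_nonneg (μ := volume) hab fun x _ => h0 x
    rw [sub] at this
    linarith
  have bdd : BddAbove (range I) := by
    refine ⟨A, ?_⟩
    rintro _ ⟨y, rfl⟩
    have h := hA 0 (max y 0) (le_max_right _ _)
    exact (mono (le_max_left y 0)).trans h
  have lim := tendsto_atTop_ciSup mono bdd
  refine ⟨fun n => (⨆ y, I y) - I n, ?_, ?_⟩
  · have := (lim.comp tendsto_natCast_atTop_atTop).const_sub (⨆ y, I y)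
    simpa using this
  · intro n a b hna hab
    rw [sub]
    have := le_ciSup bdd b
    have := mono hna
    linarith

/-- Sums of overlapping windows are controlled by the tail. -/
theorem sum_window_le {G : ℝ → ℝ} (hG : Continuous G) {e : ℝ} {n : ℕ}
    (h : ∀ a b : ℝ, n ≤ a → a ≤ b → ∫ x in a..b, G x ≤ e) (m : ℕ) :
    ∑ i ∈ Finset.range m, ∫ x in ((n + i : ℕ) : ℝ)..((n + i : ℕ) + 4), G x ≤ 4 * e := by
  set I : ℝ → ℝ := fun y => ∫ x in (0 : ℝ)..y, G x with hI
  have sub : ∀ a b, ∫ x in a..b, G x = I b - I a := fun a b =>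
    (intervalIntegral.integral_interval_sub_left (hG.intervalIntegrable _ _)
      (hG.intervalIntegrable _ _)).symm
  have key : ∑ i ∈ Finset.range m, ∫ x in ((n + i : ℕ) : ℝ)..((n + i : ℕ) + 4), G x
      = (I (n + m) - I n) + (I (n + 1 + m) - I (n + 1)) + (I (n + 2 + m) - I (n + 2))
        + (I (n + 3 + m) - I (n + 3)) := by
    induction m with
    | zero => simp
    | succ m ih =>
      rw [Finset.sum_range_succ, ih, sub]
      push_cast
      rw [show (n : ℝ) + (m + 1) = n + 1 + m by ring,
        show (n : ℝ) + 1 + (m + 1) = n + 2 + m by ring,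
        show (n : ℝ) + 2 + (m + 1) = n + 3 + m by ring,
        show (n : ℝ) + 3 + (m + 1) = n + m + 4 by ring]
      ring
  rw [key, ← sub, ← sub, ← sub, ← sub]
  have m0 : (0 : ℝ) ≤ m := m.cast_nonneg
  have h1 := h n (n + m) le_rfl (by linarith)
  have h2 := h (n + 1) (n + 1 + m) (by linarith) (by linarith)
  have h3 := h (n + 2) (n + 2 + m) (by linarith) (by linarith)
  have h4 := h (n + 3) (n + 3 + m) (by linarith) (by linarith)
  linarith

theorem abs_mul_le_mul {a b A B : ℝ} (ha : |a| ≤ A) (hb : |b| ≤ B) : |a * b| ≤ A * B := by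
  rw [abs_mul]
  exact mul_le_mul ha hb (abs_nonneg _) ((abs_nonneg _).trans ha)

theorem IsJet.comp_sub_const {χ : ℕ → ℝ → ℝ} (h : IsJet χ) (c : ℝ) :
    IsJet fun k x => χ k (x - c) :=
  ⟨fun k x => (h.hasDerivAt k (x - c)).comp_sub_const x c⟩

theorem IsJet.succ {χ : ℕ → ℝ → ℝ} (h : IsJet χ) : IsJet fun k => χ (k + 1) :=
  ⟨fun k => h.hasDerivAt (k + 1)⟩

theorem IsJet.sub {χ ξ : ℕ → ℝ → ℝ} (h : IsJet χ) (h' : IsJet ξ) :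
    IsJet fun k x => χ k x - ξ k x :=
  ⟨fun k x => (h.hasDerivAt k x).sub (h'.hasDerivAt k x)⟩

/-- The `H¹` density of a jet. -/
def dens (u : ℕ → ℝ → ℝ → ℝ) (t x : ℝ) : ℝ := u 0 t x ^ 2 + u 1 t x ^ 2

theorem dens_nonneg (u : ℕ → ℝ → ℝ → ℝ) (t x : ℝ) : 0 ≤ dens u t x := by
  unfold dens; positivity

theorem IsGKdVJet.cont_dens {t₁ t₂ : ℝ} {u : ℕ → ℝ → ℝ → ℝ} (hu : IsGKdVJet t₁ t₂ u) :
    Continuous fun p : ℝ × ℝ => dens u p.1 p.2 :=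
  ((hu.cont 0).pow 2).add ((hu.cont 1).pow 2)

/-- The jet of a solution whose `H¹` density has integral at most `E` over every interval. -/
structure IsBoundedJet (t₁ t₂ : ℝ) (u : ℕ → ℝ → ℝ → ℝ) (E : ℝ) : Prop
    extends IsGKdVJet t₁ t₂ u where
  le : t₁ ≤ t₂
  bound : ∀ t ∈ Icc t₁ t₂, ∀ a b, a ≤ b → ∫ x in a..b, dens u t x ≤ E

/-- The initial `H¹` density plus the time integral of the `H¹` density. -/
noncomputable def totalDens (t₁ t₂ : ℝ) (u : ℕ → ℝ → ℝ → ℝ) (x : ℝ) : ℝ :=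
  dens u t₁ x + ∫ t in t₁..t₂, dens u t x

namespace IsBoundedJet

variable {t₁ t₂ E : ℝ} {u : ℕ → ℝ → ℝ → ℝ}

theorem nonneg (hu : IsBoundedJet t₁ t₂ u E) : 0 ≤ E := by
  simpa using hu.bound t₁ ⟨le_rfl, hu.le⟩ 0 0 le_rfl

theorem cont_slice (hu : IsBoundedJet t₁ t₂ u E) (k : ℕ) (t : ℝ) : Continuous (u k t) :=
  continuous_slice (hu.cont k) t

theorem integral_sq_zero_le (hu : IsBoundedJet t₁ t₂ u E) (t : ℝ) {a b : ℝ} (hab : a ≤ b) :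
    ∫ x in a..b, u 0 t x ^ 2 ≤ ∫ x in a..b, dens u t x :=
  intervalIntegral.integral_mono_on hab (((hu.cont_slice 0 t).pow 2).intervalIntegrable _ _)
    ((continuous_slice hu.cont_dens t).intervalIntegrable _ _) fun _ _ =>
    le_add_of_nonneg_right (sq_nonneg _)

theorem integral_sq_one_le (hu : IsBoundedJet t₁ t₂ u E) (t : ℝ) {a b : ℝ} (hab : a ≤ b) :
    ∫ x in a..b, u 1 t x ^ 2 ≤ ∫ x in a..b, dens u t x :=
  intervalIntegral.integral_mono_on hab (((hu.cont_slice 1 t).pow 2).intervalIntegrable _ _)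
    ((continuous_slice hu.cont_dens t).intervalIntegrable _ _) fun _ _ =>
    le_add_of_nonneg_left (sq_nonneg _)

theorem sq_le (hu : IsBoundedJet t₁ t₂ u E) {t : ℝ} (ht : t ∈ Icc t₁ t₂) (x : ℝ) :
    u 0 t x ^ 2 ≤ 3 * E := by
  have h := sq_le_integral_add (hu.hasDerivAt_x 0 t) (hu.cont_slice 1 t) one_pos
    (c := x) (x := x) ⟨le_rfl, by linarith⟩
  have h0 := hu.integral_sq_zero_le t (a := x) (b := x + 2) (by linarith)
  have h1 := hu.integral_sq_one_le t (a := x) (b := x + 2) (by linarith)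
  have := hu.bound t ht x (x + 2) (by linarith)
  norm_num at h
  linarith

theorem abs_cube_le (hu : IsBoundedJet t₁ t₂ u E) {t : ℝ} (ht : t ∈ Icc t₁ t₂) (x : ℝ) :
    |u 0 t x| ^ 3 ≤ (1 + 3 * E) ^ 2 := by
  have h := hu.sq_le ht x
  have h0 := abs_nonneg (u 0 t x)
  rw [← sq_abs] at h
  have hE := hu.nonneg
  generalize |u 0 t x| = y at *
  have h1 : y ≤ 1 + 3 * E := by nlinarith [sq_nonneg (y - 1)]
  calc y ^ 3 = y ^ 2 * y := by ring
    _ ≤ (1 + 3 * E) * (1 + 3 * E) := mul_le_mul (by linarith) h1 h0 (by linarith)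
    _ = _ := by ring

theorem cont_totalDens (hu : IsBoundedJet t₁ t₂ u E) : Continuous (totalDens t₁ t₂ u) :=
  (continuous_slice hu.cont_dens t₁).add
    (continuous_integral_slice (g := fun x t => dens u t x)
      (hu.cont_dens.comp continuous_swap) t₁ t₂)

theorem totalDens_nonneg (hu : IsBoundedJet t₁ t₂ u E) (x : ℝ) : 0 ≤ totalDens t₁ t₂ u x :=
  add_nonneg (dens_nonneg _ _ _)
    (intervalIntegral.integral_nonneg hu.le fun _ _ => dens_nonneg _ _ _)

theorem integral_totalDens (hu : IsBoundedJet t₁ t₂ u E) (a b : ℝ) :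
    ∫ x in a..b, totalDens t₁ t₂ u x
      = (∫ x in a..b, dens u t₁ x) + ∫ t in t₁..t₂, ∫ x in a..b, dens u t x := by
  rw [integral_swap hu.cont_dens]
  exact intervalIntegral.integral_add ((continuous_slice hu.cont_dens t₁).intervalIntegrable _ _)
    ((continuous_integral_slice (g := fun x t => dens u t x)
      (hu.cont_dens.comp continuous_swap) t₁ t₂).intervalIntegrable _ _)

theorem integral_dens_le (hu : IsBoundedJet t₁ t₂ u E) {a b : ℝ} (hab : a ≤ b) :
    ∫ x in a..b, dens u t₁ x ≤ ∫ x in a..b, totalDens t₁ t₂ u x := by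
  rw [hu.integral_totalDens]
  exact le_add_of_nonneg_right (intervalIntegral.integral_nonneg hu.le fun _ _ =>
    intervalIntegral.integral_nonneg hab fun _ _ => dens_nonneg _ _ _)

theorem integral_integral_dens_le (hu : IsBoundedJet t₁ t₂ u E) {a b : ℝ} (hab : a ≤ b) :
    ∫ t in t₁..t₂, ∫ x in a..b, dens u t x ≤ ∫ x in a..b, totalDens t₁ t₂ u x := by
  rw [hu.integral_totalDens]
  exact le_add_of_nonneg_left (intervalIntegral.integral_nonneg hab fun _ _ => dens_nonneg _ _ _)

theorem integral_integral_dens_le_const (hu : IsBoundedJet t₁ t₂ u E) {a b : ℝ} (hab : a ≤ b) :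
    ∫ t in t₁..t₂, ∫ x in a..b, dens u t x ≤ (t₂ - t₁) * E := by
  have h : ∫ t in t₁..t₂, ∫ x in a..b, dens u t x ≤ ∫ _ in t₁..t₂, E :=
    intervalIntegral.integral_mono_on hu.le
      ((continuous_integral_slice hu.cont_dens a b).intervalIntegrable _ _)
      (continuous_const.intervalIntegrable _ _) fun t ht => hu.bound t ht a b hab
  simpa using h

theorem integral_totalDens_le_const (hu : IsBoundedJet t₁ t₂ u E) {a b : ℝ} (hab : a ≤ b) :
    ∫ x in a..b, totalDens t₁ t₂ u x ≤ E + (t₂ - t₁) * E := by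
  rw [hu.integral_totalDens]
  exact add_le_add (hu.bound _ ⟨le_rfl, hu.le⟩ _ _ hab) (hu.integral_integral_dens_le_const hab)

theorem restrict (hu : IsBoundedJet t₁ t₂ u E) {t : ℝ} (ht : t ∈ Icc t₁ t₂) :
    IsBoundedJet t₁ t u E where
  cont := hu.cont
  hasDerivAt_x := hu.hasDerivAt_x
  hasDerivAt_t s hs := hu.hasDerivAt_t s ⟨hs.1, hs.2.trans ht.2⟩
  hasDerivAt_t_one s hs := hu.hasDerivAt_t_one s ⟨hs.1, hs.2.trans ht.2⟩
  le := ht.1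
  bound s hs := hu.bound s ⟨hs.1, hs.2.trans ht.2⟩

/-- The mass in a window is bounded, uniformly in time, by the total density near the window. -/
theorem integral_sq_window_le (hu : IsBoundedJet t₁ t₂ u E) {S : ℕ → ℝ → ℝ} {κ B : ℝ}
    (hS : IsStep S κ B) {t : ℝ} (ht : t ∈ Icc t₁ t₂) (j : ℝ) :
    ∫ x in (j + 1)..(j + 3), u 0 t x ^ 2
      ≤ 8 * B * (1 + 3 * E) ^ 2 / κ * ∫ x in j..(j + 4), totalDens t₁ t₂ u x := by
  have hE := hu.nonneg
  have hB := hS.one_le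
  have hκ := hS.pos
  set D := (1 + 3 * E) ^ 2 with hD
  have hD1 : 1 ≤ D := by nlinarith
  have jet : IsJet fun k x => S (k + 1) (x - j) := hS.jet.succ.comp_sub_const j
  have c0 := hu.cont 0
  have c1 := hu.cont 1
  have hr := hu.restrict ht
  have bal := mass_balance (a := j) (b := j + 4) ht.1 (v := u) (q := fun t x => u 0 t x ^ 3)
    (q' := fun t x => 3 * u 0 t x ^ 2 * u 1 t x) hu.cont (by fun_prop) (by fun_prop)
    hu.hasDerivAt_x
    (fun s x => ((hu.hasDerivAt_x 0 s x).pow 3).congr_deriv (by simp))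
    (fun s hs x => by
      refine (hr.hasDerivAt_t s hs x).congr_deriv ?_
      ring) jet (fun k => by simp [hS.left]) (fun k => by simp [hS.right])
  have s1 : Continuous (S 1) := hS.jet.continuous 1
  have s2 : Continuous (S 2) := hS.jet.continuous 2
  have s4 : Continuous (S 4) := hS.jet.continuous 4
  have upper := integral_integral_mono (s := t₁) (t := t) (a := j) (b := j + 4)
    (g := fun t x => -3 * u 1 t x ^ 2 * S (1 + 1) (x - j) + u 0 t x ^ 2 * S (3 + 1) (x - j)
          - u 0 t x ^ 2 * (3 * u 0 t x ^ 2 * u 1 t x) * S (0 + 1) (x - j)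
          + u 0 t x ^ 2 * u 0 t x ^ 3 * S (1 + 1) (x - j))
    (g' := fun t x => 8 * B * D * dens u t x) (by fun_prop)
    (continuous_const.mul hu.cont_dens) ht.1 (by linarith) (by
      intro s hs x _
      have hc := hr.abs_cube_le hs x
      have b1 := hS.abs_le 1 (by norm_num) (x - j)
      have b2 := hS.abs_le 2 (by norm_num) (x - j)
      have b4 := hS.abs_le 4 (by norm_num) (x - j)
      have hd := dens_nonneg u s x
      have hc' : |u 0 s x ^ 3| ≤ D := by rwa [abs_pow]
      have d0 : |u 0 s x ^ 2| ≤ dens u s x := by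
        rw [abs_of_nonneg (sq_nonneg _)]; unfold dens; nlinarith [sq_nonneg (u 1 s x)]
      have d1 : |u 1 s x ^ 2| ≤ dens u s x := by
        rw [abs_of_nonneg (sq_nonneg _)]; unfold dens; nlinarith [sq_nonneg (u 0 s x)]
      have d01 : |u 0 s x * u 1 s x| ≤ dens u s x := by
        unfold dens
        rw [abs_le]
        constructor <;> nlinarith [sq_nonneg (u 0 s x + u 1 s x), sq_nonneg (u 0 s x - u 1 s x)]
      have m1 := abs_le.1 (abs_mul_le_mul b2 d1)
      have m2 := abs_le.1 (abs_mul_le_mul b4 d0)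
      have m3 := abs_le.1 (abs_mul_le_mul (abs_mul_le_mul b1 hc') d01)
      have m4 := abs_le.1 (abs_mul_le_mul (abs_mul_le_mul b2 hc') d0)
      have m5 : B * dens u s x ≤ B * D * dens u s x := by
        apply mul_le_mul_of_nonneg_right _ hd
        nlinarith
      simp only [Nat.reduceAdd]
      linarith [m1.1, m2.2, m3.1, m4.2])
  rw [integral_integral_const_mul] at upper
  rw [← bal] at upper
  have low : κ * ∫ x in (j + 1)..(j + 3), u 0 t x ^ 2
      ≤ ∫ x in j..(j + 4), u 0 t x ^ 2 * S (0 + 1) (x - j) := by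
    have cc : Continuous fun x => u 0 t x ^ 2 * S 1 (x - j) := by
      have := hu.cont_slice 0 t
      fun_prop
    rw [← intervalIntegral.integral_const_mul]
    calc ∫ x in (j + 1)..(j + 3), κ * u 0 t x ^ 2
        ≤ ∫ x in (j + 1)..(j + 3), u 0 t x ^ 2 * S 1 (x - j) := by
          refine intervalIntegral.integral_mono_on (by linarith)
            ((continuous_const.mul ((hu.cont_slice 0 t).pow 2)).intervalIntegrable _ _)
            (cc.intervalIntegrable _ _) fun x hx => ?_
          rw [mul_comm]
          exact mul_le_mul_of_nonneg_left (hS.le_deriv _ ⟨by linarith [hx.1], by linarith [hx.2]⟩)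
            (sq_nonneg _)
      _ ≤ _ := intervalIntegral.integral_mono_interval (by linarith) (by linarith) (by linarith)
          (Eventually.of_forall fun x => mul_nonneg (sq_nonneg _) (hS.deriv_nonneg _))
          (cc.intervalIntegrable _ _)
  have init : ∫ x in j..(j + 4), u 0 t₁ x ^ 2 * S (0 + 1) (x - j)
      ≤ 8 * B * D * ∫ x in j..(j + 4), dens u t₁ x := by
    rw [← intervalIntegral.integral_const_mul]
    refine intervalIntegral.integral_mono_on (by linarith)
      ((((hu.cont_slice 0 t₁).pow 2).mul (s1.comp (continuous_id.sub continuous_const))).intervalIntegrable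
        _ _)
      ((continuous_const.mul (continuous_slice hu.cont_dens t₁)).intervalIntegrable _ _)
      fun x _ => ?_
    have b1 := (abs_le.1 (hS.abs_le 1 (by norm_num) (x - j))).2
    have hd : u 0 t₁ x ^ 2 ≤ dens u t₁ x := le_add_of_nonneg_right (sq_nonneg _)
    calc u 0 t₁ x ^ 2 * S 1 (x - j) ≤ dens u t₁ x * (8 * B * D) :=
          mul_le_mul hd (by nlinarith) (hS.deriv_nonneg _) (dens_nonneg _ _ _)
      _ = _ := mul_comm _ _
  have tmono : ∫ s in t₁..t, ∫ x in j..(j + 4), dens u s x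
      ≤ ∫ s in t₁..t₂, ∫ x in j..(j + 4), dens u s x :=
    intervalIntegral.integral_mono_interval le_rfl ht.1 ht.2
      (Eventually.of_forall fun s =>
        intervalIntegral.integral_nonneg (by linarith) fun _ _ => dens_nonneg _ _ _)
      ((continuous_integral_slice hu.cont_dens _ _).intervalIntegrable _ _)
  have tm := mul_le_mul_of_nonneg_left tmono (by positivity : 0 ≤ 8 * B * D)
  rw [hu.integral_totalDens, div_mul_eq_mul_div, le_div_iff₀ hκ]
  linarith

end IsBoundedJet

theorem abs_energy_le {D a b : ℝ} (hD : 1 ≤ D) (ha : |a| ^ 3 ≤ D) :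
    |a ^ 2 + b ^ 2 - 2 / 5 * a ^ 5| ≤ 2 * D * (a ^ 2 + b ^ 2) := by
  have h := abs_le.1 (abs_mul_le_mul (by rwa [abs_pow] : |a ^ 3| ≤ D) (abs_sq a).le)
  rw [abs_le]
  constructor <;> nlinarith [h.1, h.2, sq_nonneg a, sq_nonneg b,
    mul_nonneg (sub_nonneg.2 hD) (sq_nonneg a), mul_nonneg (sub_nonneg.2 hD) (sq_nonneg b)]

theorem abs_flux_le {D a b : ℝ} (hD : 1 ≤ D) (ha : |a| ^ 3 ≤ D) :
    |-3 * b ^ 2 + 8 / 5 * a ^ 5 + 8 * a ^ 3 * b ^ 2| ≤ 11 * D * (a ^ 2 + b ^ 2) := by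
  have h := abs_le.1 (abs_mul_le_mul (by rwa [abs_pow] : |a ^ 3| ≤ D) (abs_sq a).le)
  have h' := abs_le.1 (abs_mul_le_mul (by rwa [abs_pow] : |a ^ 3| ≤ D) (abs_sq b).le)
  rw [abs_le]
  constructor <;> nlinarith [h.1, h.2, h'.1, h'.2, sq_nonneg a, sq_nonneg b,
    mul_nonneg (sub_nonneg.2 hD) (sq_nonneg a), mul_nonneg (sub_nonneg.2 hD) (sq_nonneg b)]

/-- The jet of a cutoff that rises on `[a, a + 4]` and decays on `[m, m + 4]`. -/
def plateau (S : ℕ → ℝ → ℝ) (a m : ℝ) (k : ℕ) (x : ℝ) : ℝ := S k (x - a) - S k (x - m)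

namespace IsStep

variable {S : ℕ → ℝ → ℝ} {κ B a m : ℝ}

theorem monotone (hS : IsStep S κ B) : Monotone (S 0) :=
  monotone_of_deriv_nonneg (fun x => (hS.jet.hasDerivAt 0 x).differentiableAt) fun x => by
    rw [(hS.jet.hasDerivAt 0 x).deriv]
    exact hS.deriv_nonneg x

theorem nonneg (hS : IsStep S κ B) (x : ℝ) : 0 ≤ S 0 x := by
  rw [← hS.left 0 (min x 0) (min_le_right _ _)]
  exact hS.monotone (min_le_left _ _)

theorem le_one (hS : IsStep S κ B) (x : ℝ) : S 0 x ≤ 1 := by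
  rw [← hS.right_zero (max x 4) (le_max_right _ _)]
  exact hS.monotone (le_max_left _ _)

theorem isJet_plateau (hS : IsStep S κ B) (a m : ℝ) : IsJet (plateau S a m) :=
  (hS.jet.comp_sub_const a).sub (hS.jet.comp_sub_const m)

theorem plateau_left (hS : IsStep S κ B) (ham : a ≤ m) (k : ℕ) {x : ℝ} (hx : x ≤ a) :
    plateau S a m k x = 0 := by
  rw [plateau, hS.left k _ (by linarith), hS.left k _ (by linarith), sub_zero]

theorem plateau_right (hS : IsStep S κ B) (ham : a ≤ m) (k : ℕ) {x : ℝ} (hx : m + 4 ≤ x) :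
    plateau S a m k x = 0 := by
  rcases k with _ | k
  · rw [plateau, hS.right_zero _ (by linarith), hS.right_zero _ (by linarith), sub_self]
  · rw [plateau, hS.right k _ (by linarith), hS.right k _ (by linarith), sub_self]

theorem abs_plateau_le (hS : IsStep S κ B) (a m : ℝ) {k : ℕ} (hk : k ≤ 4) (x : ℝ) :
    |plateau S a m k x| ≤ 2 * B := by
  have h := _root_.abs_le.1 (hS.abs_le k hk (x - a))
  have h' := _root_.abs_le.1 (hS.abs_le k hk (x - m))
  rw [plateau, _root_.abs_le]
  constructor <;> linarith

theorem plateau_nonneg (hS : IsStep S κ B) (ham : a ≤ m) (x : ℝ) : 0 ≤ plateau S a m 0 x :=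
  sub_nonneg.2 (hS.monotone (by linarith))

theorem plateau_le_one (hS : IsStep S κ B) (a m x : ℝ) : plateau S a m 0 x ≤ 1 := by
  have h := hS.le_one (x - a)
  have h' := hS.nonneg (x - m)
  rw [plateau]
  linarith

end IsStep

namespace IsBoundedJet

variable {t₁ t₂ E : ℝ} {u : ℕ → ℝ → ℝ → ℝ}

/-- Local smoothing: second derivatives are square integrable on windows, uniformly in the
position of the window. -/
theorem exists_integral_sq_two_le (hu : IsBoundedJet t₁ t₂ u E) :
    ∃ K, ∀ j : ℝ, 0 ≤ j → ∫ t in t₁..t₂, ∫ x in (j + 1)..(j + 3), u 2 t x ^ 2 ≤ K := by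
  obtain ⟨S, κ, B, hS⟩ := exists_isStep
  have hE := hu.nonneg
  have hB := hS.one_le
  have hκ := hS.pos
  set D := (1 + 3 * E) ^ 2 with hD
  have hD1 : 1 ≤ D := by nlinarith
  set Y : ℝ → ℝ → ℝ := fun t x => -3 * u 1 t x ^ 2 + 8 / 5 * u 0 t x ^ 5
    - (u 2 t x + u 0 t x ^ 4) ^ 2 - 2 * u 2 t x ^ 2 + 8 * u 0 t x ^ 3 * u 1 t x ^ 2 with hY
  have c0 := hu.cont 0
  have c1 := hu.cont 1
  have c2 := hu.cont 2
  have s1 : Continuous (S 1) := hS.jet.continuous 1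
  have s3 : Continuous (S 3) := hS.jet.continuous 3
  have cd := hu.cont_dens
  have cY : Continuous fun p : ℝ × ℝ => Y p.1 p.2 := by simp only [hY]; fun_prop
  refine ⟨(8 * D * B * E - (∫ t in t₁..t₂, ∫ x in (0 : ℝ)..4, Y t x * S 1 (x - 0))
    + 13 * D * B * ((t₂ - t₁) * E)) / κ, fun j hj => ?_⟩
  have jet := hS.isJet_plateau 0 j
  have bal := energy_balance (a := 0) (b := j + 4) hu.le hu.toIsGKdVJet
    (Ψ := fun k _ x => plateau S 0 j k x) (Ψt := fun _ _ => 0)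
    (fun k => (jet.continuous k).comp continuous_snd) continuous_const
    (fun k _ _ x => jet.hasDerivAt k x) (fun t x => hasDerivAt_const _ _)
    (fun k _ => hS.plateau_left hj k le_rfl) (fun k _ => hS.plateau_right hj k le_rfl)
  have hj4 : (0 : ℝ) ≤ j + 4 := by linarith
  have low := integral_integral_mono (s := t₁) (t := t₂) (a := 0) (b := j + 4)
    (g := fun t x => Y t x * S 1 (x - 0)
      + (2 * (u 2 t x ^ 2 * S 1 (x - j)) + -(13 * D * B) * dens u t x))
    (g' := fun t x => (u 0 t x ^ 2 + u 1 t x ^ 2 - 2 / 5 * u 0 t x ^ 5) * 0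
          + (-3 * u 1 t x ^ 2 + 8 / 5 * u 0 t x ^ 5 - (u 2 t x + u 0 t x ^ 4) ^ 2
            - 2 * u 2 t x ^ 2 + 8 * u 0 t x ^ 3 * u 1 t x ^ 2) * plateau S 0 j 1 x
          + (u 0 t x ^ 2 + u 1 t x ^ 2) * plateau S 0 j 3 x)
    (by fun_prop) (by
      have j1 := jet.continuous 1
      have j3 := jet.continuous 3
      fun_prop) hu.le hj4 (by
      intro t ht x _
      have hc := hu.abs_cube_le ht x
      have p0 := hS.deriv_nonneg (x - j)
      have b1 := hS.abs_le 1 (by norm_num) (x - j)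
      have b3 := hS.abs_plateau_le 0 j (by norm_num : 3 ≤ 4) x
      have hd := dens_nonneg u t x
      have fl := abs_flux_le (b := u 1 t x) hD1 hc
      have m1 := abs_le.1 (abs_mul_le_mul fl b1)
      have m2 := abs_le.1 (abs_mul_le_mul (abs_of_nonneg hd).le b3)
      have m4 := mul_nonneg (sq_nonneg (u 2 t x + u 0 t x ^ 4)) p0
      have m5 : B * dens u t x ≤ D * B * dens u t x :=
        mul_le_mul_of_nonneg_right (by nlinarith) hd
      simp only [hY]
      rw [plateau]
      simp only [dens] at *
      linarith [m1.2, m2.1])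
  rw [← bal, integral_integral_add_of_continuous (by fun_prop) (by fun_prop),
    integral_integral_add_of_continuous (by fun_prop) (by fun_prop), integral_integral_const_mul,
    integral_integral_const_mul] at low
  have supp : ∫ t in t₁..t₂, ∫ x in (0 : ℝ)..(j + 4), Y t x * S 1 (x - 0)
      = ∫ t in t₁..t₂, ∫ x in (0 : ℝ)..4, Y t x * S 1 (x - 0) := by
    refine intervalIntegral.integral_congr fun t _ => ?_
    exact integral_eq_of_support ((continuous_slice cY t).mul
      (s1.comp (continuous_id.sub continuous_const))) le_rfl (by linarith)
      (fun x hx => by simp [hS.left 1 x hx]) (fun x hx => by simp [hS.right 0 x hx])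
  have ed : ∀ t ∈ Icc t₁ t₂, |∫ x in (0 : ℝ)..(j + 4),
      (u 0 t x ^ 2 + u 1 t x ^ 2 - 2 / 5 * u 0 t x ^ 5) * plateau S 0 j 0 x|
        ≤ 4 * D * B * E := by
    intro t ht
    have hb := hu.bound t ht 0 (j + 4) hj4
    have h1 : |∫ x in (0 : ℝ)..(j + 4),
      (u 0 t x ^ 2 + u 1 t x ^ 2 - 2 / 5 * u 0 t x ^ 5) * plateau S 0 j 0 x|
        ≤ ∫ x in (0 : ℝ)..(j + 4), 4 * D * B * dens u t x := by
      rw [← Real.norm_eq_abs]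
      refine intervalIntegral.norm_integral_le_of_norm_le hj4
        (Eventually.of_forall fun x _ => ?_)
        ((continuous_const.mul (continuous_slice hu.cont_dens t)).intervalIntegrable _ _)
      have b := hS.abs_plateau_le 0 j (by norm_num : 0 ≤ 4) x
      refine (abs_mul_le_mul (abs_energy_le hD1 (hu.abs_cube_le ht x)) b).trans (le_of_eq ?_)
      simp only [dens]
      ring
    rw [intervalIntegral.integral_const_mul] at h1
    exact h1.trans (mul_le_mul_of_nonneg_left hb (by positivity))
  have ed1 := abs_le.1 (ed t₁ ⟨le_rfl, hu.le⟩)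
  have ed2 := abs_le.1 (ed t₂ ⟨hu.le, le_rfl⟩)
  have hdE := mul_le_mul_of_nonneg_left (hu.integral_integral_dens_le_const (b := j + 4) hj4)
    (by positivity : 0 ≤ 13 * D * B)
  have win : κ * ∫ t in t₁..t₂, ∫ x in (j + 1)..(j + 3), u 2 t x ^ 2
      ≤ ∫ t in t₁..t₂, ∫ x in (0 : ℝ)..(j + 4), u 2 t x ^ 2 * S 1 (x - j) := by
    rw [← integral_integral_const_mul]
    have cw : Continuous fun p : ℝ × ℝ => u 2 p.1 p.2 ^ 2 * S 1 (p.2 - j) := by fun_prop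
    refine (integral_integral_mono (g' := fun t x => u 2 t x ^ 2 * S 1 (x - j)) (by fun_prop) cw
      hu.le (by linarith) fun t _ x hx => ?_).trans ?_
    · rw [mul_comm]
      exact mul_le_mul_of_nonneg_left
        (hS.le_deriv _ ⟨by linarith [hx.1], by linarith [hx.2]⟩) (sq_nonneg _)
    · exact intervalIntegral.integral_mono hu.le
        ((continuous_integral_slice (g := fun t x => u 2 t x ^ 2 * S 1 (x - j)) cw
          _ _).intervalIntegrable _ _)
        ((continuous_integral_slice (g := fun t x => u 2 t x ^ 2 * S 1 (x - j)) cw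
          _ _).intervalIntegrable _ _) fun t =>
        intervalIntegral.integral_mono_interval (by linarith) (by linarith) (by linarith)
          (Eventually.of_forall fun x => mul_nonneg (sq_nonneg _) (hS.deriv_nonneg _))
          ((continuous_slice (g := fun t x => u 2 t x ^ 2 * S 1 (x - j)) cw t).intervalIntegrable
            _ _)
  have pos : 0 ≤ ∫ t in t₁..t₂, ∫ x in (j + 1)..(j + 3), u 2 t x ^ 2 :=
    intervalIntegral.integral_nonneg hu.le fun t _ =>
      intervalIntegral.integral_nonneg (by linarith) fun x _ => sq_nonneg _
  have pos' := mul_nonneg hκ.le pos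
  rw [le_div_iff₀ hκ]
  rw [supp] at low
  linarith [ed1.1, ed2.2]

end IsBoundedJet

/-- The jet of the difference quotient of a jet. -/
noncomputable def diffQuot (h : ℝ) (u : ℕ → ℝ → ℝ → ℝ) (k : ℕ) (t x : ℝ) : ℝ :=
  (u k t (x + h) - u k t x) / h

/-- The quotient of the increment of the fourth power by the increment. -/
def diffPot (h : ℝ) (u : ℕ → ℝ → ℝ → ℝ) (t x : ℝ) : ℝ :=
  u 0 t (x + h) ^ 3 + u 0 t (x + h) ^ 2 * u 0 t x + u 0 t (x + h) * u 0 t x ^ 2 + u 0 t x ^ 3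

/-- The spatial derivative of `diffPot`. -/
def diffPotDeriv (h : ℝ) (u : ℕ → ℝ → ℝ → ℝ) (t x : ℝ) : ℝ :=
  3 * u 0 t (x + h) ^ 2 * u 1 t (x + h)
    + (2 * u 0 t (x + h) * u 1 t (x + h) * u 0 t x + u 0 t (x + h) ^ 2 * u 1 t x)
    + (u 1 t (x + h) * u 0 t x ^ 2 + u 0 t (x + h) * (2 * u 0 t x * u 1 t x))
    + 3 * u 0 t x ^ 2 * u 1 t x

theorem abs_mul_le_of_sq_le {a b X : ℝ} (ha : a ^ 2 ≤ X) (hb : b ^ 2 ≤ X) : |a * b| ≤ X := by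
  rw [abs_le]
  constructor <;> nlinarith [sq_nonneg (a + b), sq_nonneg (a - b)]

theorem abs_cubic_le {a b D : ℝ} (ha : |a| ^ 3 ≤ D) (hb : |b| ^ 3 ≤ D) :
    |a ^ 3 + a ^ 2 * b + a * b ^ 2 + b ^ 3| ≤ 4 * D := by
  have hm : max |a| |b| ^ 3 ≤ D := by
    rcases max_choice |a| |b| with h | h <;> rwa [h]
  have h0 : ∀ {p q r : ℝ}, |p| ≤ max |a| |b| → |q| ≤ max |a| |b| → |r| ≤ max |a| |b| →
      |p * q * r| ≤ D := fun hp hq hr =>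
    (abs_mul_le_mul (abs_mul_le_mul hp hq) hr).trans (by linarith)
  have la := le_max_left |a| |b|
  have lb := le_max_right |a| |b|
  have h1 := abs_le.1 (h0 la la la)
  have h2 := abs_le.1 (h0 la la lb)
  have h3 := abs_le.1 (h0 la lb lb)
  have h4 := abs_le.1 (h0 lb lb lb)
  rw [abs_le]
  constructor <;> linarith [h1.1, h1.2, h2.1, h2.2, h3.1, h3.2, h4.1, h4.2]

theorem abs_cubic_deriv_le {a b a' b' X s : ℝ} (ha : a ^ 2 ≤ X) (hb : b ^ 2 ≤ X)
    (ha' : |a'| ≤ s) (hb' : |b'| ≤ s) :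
    |3 * a ^ 2 * a' + (2 * a * a' * b + a ^ 2 * b') + (a' * b ^ 2 + a * (2 * b * b'))
      + 3 * b ^ 2 * b'| ≤ 12 * (X * s) := by
  have haa := abs_mul_le_of_sq_le ha ha
  have hab := abs_mul_le_of_sq_le ha hb
  have hbb := abs_mul_le_of_sq_le hb hb
  have h1 := abs_le.1 (abs_mul_le_mul haa ha')
  have h2 := abs_le.1 (abs_mul_le_mul hab ha')
  have h3 := abs_le.1 (abs_mul_le_mul haa hb')
  have h4 := abs_le.1 (abs_mul_le_mul hbb ha')
  have h5 := abs_le.1 (abs_mul_le_mul hab hb')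
  have h6 := abs_le.1 (abs_mul_le_mul hbb hb')
  rw [abs_le]
  constructor <;> linarith [h1.1, h1.2, h2.1, h2.2, h3.1, h3.2, h4.1, h4.2, h5.1, h5.2, h6.1, h6.2]

namespace IsGKdVJet

variable {t₁ t₂ : ℝ} {u : ℕ → ℝ → ℝ → ℝ}

theorem continuous_shift (hu : IsGKdVJet t₁ t₂ u) (h : ℝ) (k : ℕ) :
    Continuous fun p : ℝ × ℝ => u k p.1 (p.2 + h) :=
  (hu.cont k).comp (continuous_fst.prodMk (continuous_snd.add continuous_const))

theorem continuous_diffQuot (hu : IsGKdVJet t₁ t₂ u) (h : ℝ) (k : ℕ) :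
    Continuous fun p : ℝ × ℝ => diffQuot h u k p.1 p.2 :=
  ((hu.continuous_shift h k).sub (hu.cont k)).div_const h

theorem continuous_diffPot (hu : IsGKdVJet t₁ t₂ u) (h : ℝ) :
    Continuous fun p : ℝ × ℝ => diffPot h u p.1 p.2 := by
  have c0 := hu.cont 0
  have d0 := hu.continuous_shift h 0
  unfold diffPot
  fun_prop

theorem continuous_diffPotDeriv (hu : IsGKdVJet t₁ t₂ u) (h : ℝ) :
    Continuous fun p : ℝ × ℝ => diffPotDeriv h u p.1 p.2 := by
  have c0 := hu.cont 0
  have d0 := hu.continuous_shift h 0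
  have c1 := hu.cont 1
  have d1 := hu.continuous_shift h 1
  unfold diffPotDeriv
  fun_prop

theorem hasDerivAt_diffQuot (hu : IsGKdVJet t₁ t₂ u) (h : ℝ) (k : ℕ) (t x : ℝ) :
    HasDerivAt (diffQuot h u k t) (diffQuot h u (k + 1) t x) x :=
  (((hu.hasDerivAt_x k t (x + h)).comp_add_const x h).sub (hu.hasDerivAt_x k t x)).div_const h

theorem hasDerivAt_diffPot (hu : IsGKdVJet t₁ t₂ u) (h t x : ℝ) :
    HasDerivAt (diffPot h u t) (diffPotDeriv h u t x) x := by
  have a := (hu.hasDerivAt_x 0 t (x + h)).comp_add_const x h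
  have b := hu.hasDerivAt_x 0 t x
  refine ((((a.pow 3).add ((a.pow 2).mul b)).add (a.mul (b.pow 2))).add (b.pow 3)).congr_deriv ?_
  simp [diffPotDeriv]

theorem hasDerivAt_t_diffQuot (hu : IsGKdVJet t₁ t₂ u) (h : ℝ) {t : ℝ} (ht : t ∈ Icc t₁ t₂)
    (x : ℝ) : HasDerivAt (fun s => diffQuot h u 0 s x)
      (-(diffQuot h u 3 t x + diffQuot h u 1 t x * diffPot h u t x
        + diffQuot h u 0 t x * diffPotDeriv h u t x)) t := by
  refine (((hu.hasDerivAt_t t ht (x + h)).sub (hu.hasDerivAt_t t ht x)).div_const h).congr_deriv ?_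
  simp only [diffQuot, diffPot, diffPotDeriv]
  ring

end IsGKdVJet

namespace IsBoundedJet

variable {t₁ t₂ E : ℝ} {u : ℕ → ℝ → ℝ → ℝ}

theorem integral_sq_diffQuot_le (hu : IsBoundedJet t₁ t₂ u E) {h : ℝ} (h0 : 0 < h) (h1 : h ≤ 1)
    (t : ℝ) {a b : ℝ} (hab : a ≤ b) :
    ∫ x in a..b, diffQuot h u 0 t x ^ 2 ≤ ∫ x in a..(b + 1), dens u t x :=
  (integral_sq_slope_le (hu.hasDerivAt_x 0 t) (hu.cont_slice 1 t) h0 h1 hab).trans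
    (hu.integral_sq_one_le t (by linarith))

/-- The potential term in the mass balance of difference quotients on a unit interval is linear in
the total density near that interval. -/
theorem exists_integral_diffPotDeriv_le (hu : IsBoundedJet t₁ t₂ u E) :
    ∃ C, ∀ h, 0 < h → h ≤ 1 → ∀ j : ℝ, 0 ≤ j →
      ∫ t in t₁..t₂, ∫ x in (j + 1)..(j + 2), diffQuot h u 0 t x ^ 2 * |diffPotDeriv h u t x|
        ≤ C * ∫ x in j..(j + 4), totalDens t₁ t₂ u x := by
  obtain ⟨S, κ, B, hS⟩ := exists_isStep
  obtain ⟨K, hK⟩ := hu.exists_integral_sq_two_le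
  have hE := hu.nonneg
  have hκ := hS.pos
  have hB := hS.one_le
  set A := 8 * B * (1 + 3 * E) ^ 2 / κ with hA
  have hA0 : 0 ≤ A := by positivity
  refine ⟨12 * E * (2 * A * ((1 + 3 * E) * (t₂ - t₁) + K) + 1), fun h h0 h1 j hj => ?_⟩
  set W := ∫ x in j..(j + 4), totalDens t₁ t₂ u x with hW
  have hW0 : 0 ≤ W := intervalIntegral.integral_nonneg (by linarith) fun x _ =>
    hu.totalDens_nonneg x
  set M : ℝ → ℝ := fun t => ∫ x in (j + 1)..(j + 3), u 2 t x ^ 2 with hM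
  set N : ℝ → ℝ := fun t => ∫ x in (j + 1)..(j + 3), dens u t x with hN
  have cM : Continuous M := continuous_integral_slice (g := fun t x => u 2 t x ^ 2)
    ((hu.cont 2).pow 2) _ _
  have cN : Continuous N := continuous_integral_slice hu.cont_dens _ _
  have cv := hu.continuous_diffQuot h 0
  have cq := hu.continuous_diffPotDeriv h
  have e3 : j + 1 + 2 = j + 3 := by ring
  have pt : ∀ t ∈ Icc t₁ t₂, ∀ x ∈ Icc (j + 1) (j + 2),
      |diffPotDeriv h u t x| ≤ 12 * (2 * (1 + 3 * E + M t) * (A * W) + N t) := by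
    intro t ht x hx
    have M0 : 0 ≤ M t := intervalIntegral.integral_nonneg (by linarith) fun x _ => sq_nonneg _
    have N0 : 0 ≤ N t := intervalIntegral.integral_nonneg (by linarith) fun x _ =>
      dens_nonneg _ _ _
    have NE : N t ≤ E := hu.bound t ht _ _ (by linarith)
    have N1 : ∫ x in (j + 1)..(j + 3), u 1 t x ^ 2 ≤ N t := hu.integral_sq_one_le t (by linarith)
    have WA : ∫ x in (j + 1)..(j + 3), u 0 t x ^ 2 ≤ A * W := hu.integral_sq_window_le hS ht j
    set s := √(1 + 3 * E + M t) with hs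
    have s2 : s ^ 2 = 1 + 3 * E + M t := Real.sq_sqrt (by positivity)
    have s1 : 1 ≤ s := by
      rw [hs, Real.one_le_sqrt]
      linarith
    have s0 : 0 < s := by linarith
    have z0 : ∀ z ∈ Icc (j + 1) (j + 3), u 0 t z ^ 2 ≤ (1 + s) * (A * W) + 1 / s * N t := by
      intro z hz
      have h := sq_le_integral_add (hu.hasDerivAt_x 0 t) (hu.cont_slice 1 t) s0
        (c := j + 1) (x := z) (by rwa [e3])
      rw [e3] at h
      refine h.trans (add_le_add (mul_le_mul_of_nonneg_left WA (by linarith))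
        (mul_le_mul_of_nonneg_left N1 (by positivity)))
    have z1 : ∀ z ∈ Icc (j + 1) (j + 3), |u 1 t z| ≤ s := by
      intro z hz
      have h := sq_le_integral_add (hu.hasDerivAt_x 1 t) (hu.cont_slice 2 t) one_pos
        (c := j + 1) (x := z) (by rwa [e3])
      rw [e3] at h
      refine abs_le_of_sq_le_sq (le_trans h ?_) s0.le
      rw [s2]
      simp only [hM] at *
      norm_num
      linarith
    have hx1 : x ∈ Icc (j + 1) (j + 3) := ⟨hx.1, by linarith [hx.2]⟩
    have hx2 : x + h ∈ Icc (j + 1) (j + 3) := ⟨by linarith [hx.1], by linarith [hx.2]⟩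
    refine (abs_cubic_deriv_le (z0 _ hx2) (z0 _ hx1) (z1 _ hx2) (z1 _ hx1)).trans ?_
    have : ((1 + s) * (A * W) + 1 / s * N t) * s = (s + s ^ 2) * (A * W) + N t := by
      field_simp
    rw [this, ← s2]
    have : (s + s ^ 2) * (A * W) ≤ (2 * s ^ 2) * (A * W) :=
      mul_le_mul_of_nonneg_right (by nlinarith) (by positivity)
    linarith
  have slice : ∀ t ∈ Icc t₁ t₂,
      ∫ x in (j + 1)..(j + 2), diffQuot h u 0 t x ^ 2 * |diffPotDeriv h u t x|
        ≤ 12 * E * (2 * (1 + 3 * E + M t) * (A * W) + N t) := by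
    intro t ht
    have cv' := continuous_slice cv t
    have cq' := continuous_slice cq t
    have h2 : ∫ x in (j + 1)..(j + 2), diffQuot h u 0 t x ^ 2 * |diffPotDeriv h u t x|
        ≤ ∫ x in (j + 1)..(j + 2), diffQuot h u 0 t x ^ 2
          * (12 * (2 * (1 + 3 * E + M t) * (A * W) + N t)) :=
      intervalIntegral.integral_mono_on (by linarith)
        ((by fun_prop : Continuous fun x =>
          diffQuot h u 0 t x ^ 2 * |diffPotDeriv h u t x|).intervalIntegrable _ _)
        (((cv'.pow 2).mul continuous_const).intervalIntegrable _ _)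
        fun x hx => mul_le_mul_of_nonneg_left (pt t ht x hx) (sq_nonneg _)
    rw [intervalIntegral.integral_mul_const] at h2
    have h3 := (hu.integral_sq_diffQuot_le h0 h1 t (a := j + 1) (b := j + 2) (by linarith)).trans
      (hu.bound t ht _ _ (by linarith))
    have q0 := (abs_nonneg _).trans (pt t ht (j + 1) ⟨le_rfl, by linarith⟩)
    linarith [mul_le_mul_of_nonneg_right h3 q0]
  have total : ∫ t in t₁..t₂, ∫ x in (j + 1)..(j + 2),
        diffQuot h u 0 t x ^ 2 * |diffPotDeriv h u t x|
      ≤ ∫ t in t₁..t₂, (12 * E * (2 * (1 + 3 * E) * (A * W)) + 12 * E * (2 * (A * W)) * M t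
        + 12 * E * N t) := by
    refine intervalIntegral.integral_mono_on hu.le
      ((continuous_integral_slice (g := fun t x =>
        diffQuot h u 0 t x ^ 2 * |diffPotDeriv h u t x|) (by fun_prop) _ _).intervalIntegrable _ _)
      ((by fun_prop : Continuous fun t => 12 * E * (2 * (1 + 3 * E) * (A * W))
        + 12 * E * (2 * (A * W)) * M t + 12 * E * N t).intervalIntegrable _ _) fun t ht => ?_
    refine (slice t ht).trans (le_of_eq ?_)
    ring
  rw [intervalIntegral.integral_add ((by fun_prop : Continuous fun t =>
      12 * E * (2 * (1 + 3 * E) * (A * W)) + 12 * E * (2 * (A * W)) * M t).intervalIntegrable _ _)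
      ((by fun_prop : Continuous fun t => 12 * E * N t).intervalIntegrable _ _),
    intervalIntegral.integral_add (continuous_const.intervalIntegrable _ _)
      ((by fun_prop : Continuous fun t => 12 * E * (2 * (A * W)) * M t).intervalIntegrable _ _),
    intervalIntegral.integral_const,
    intervalIntegral.integral_const_mul, intervalIntegral.integral_const_mul, smul_eq_mul] at total
  have hNW : ∫ t in t₁..t₂, N t ≤ W := by
    refine (hu.integral_integral_dens_le (by linarith)).trans ?_
    exact intervalIntegral.integral_mono_interval (by linarith) (by linarith) (by linarith)
      (Eventually.of_forall hu.totalDens_nonneg) (hu.cont_totalDens.intervalIntegrable _ _)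
  have hMK := mul_le_mul_of_nonneg_left (hK j hj) (by positivity : 0 ≤ 12 * E * (2 * (A * W)))
  have hN' := mul_le_mul_of_nonneg_left hNW (by positivity : 0 ≤ 12 * E)
  linarith

/-- The potential term in the mass balance of difference quotients on a half line. -/
theorem exists_integral_diffPotDeriv_tail (hu : IsBoundedJet t₁ t₂ u E) :
    ∃ C, 0 ≤ C ∧ ∀ (n : ℕ) (e : ℝ),
      (∀ a b : ℝ, n ≤ a → a ≤ b → ∫ x in a..b, totalDens t₁ t₂ u x ≤ e) →
      ∀ h, 0 < h → h ≤ 1 → ∀ m : ℕ,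
      ∫ t in t₁..t₂, ∫ x in ((n : ℝ) + 1)..(n + 1 + m),
        diffQuot h u 0 t x ^ 2 * |diffPotDeriv h u t x| ≤ C * e := by
  obtain ⟨C, hC⟩ := hu.exists_integral_diffPotDeriv_le
  refine ⟨4 * |C|, by positivity, fun n e he h h0 h1 m => ?_⟩
  have cv := hu.continuous_diffQuot h 0
  have cq := hu.continuous_diffPotDeriv h
  have cg : Continuous fun p : ℝ × ℝ =>
      diffQuot h u 0 p.1 p.2 ^ 2 * |diffPotDeriv h u p.1 p.2| := by fun_prop
  have split : ∀ t, ∫ x in ((n : ℝ) + 1)..(n + 1 + m),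
      diffQuot h u 0 t x ^ 2 * |diffPotDeriv h u t x|
        = ∑ i ∈ Finset.range m, ∫ x in (((n + i : ℕ) : ℝ) + 1)..(((n + i : ℕ) : ℝ) + 2),
          diffQuot h u 0 t x ^ 2 * |diffPotDeriv h u t x| := by
    intro t
    have := intervalIntegral.sum_integral_adjacent_intervals (μ := volume)
      (f := fun x => diffQuot h u 0 t x ^ 2 * |diffPotDeriv h u t x|)
      (a := fun i : ℕ => (n : ℝ) + 1 + i) (n := m)
      (fun k _ => (continuous_slice (g := fun t x =>
        diffQuot h u 0 t x ^ 2 * |diffPotDeriv h u t x|) cg t).intervalIntegrable _ _)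
    simp only [Nat.cast_zero, add_zero] at this
    rw [← this]
    refine Finset.sum_congr rfl fun i _ => ?_
    push_cast
    congr 1 <;> ring
  simp only [split]
  rw [intervalIntegral.integral_finsetSum fun i _ => (continuous_integral_slice (g := fun t x =>
    diffQuot h u 0 t x ^ 2 * |diffPotDeriv h u t x|) cg _ _).intervalIntegrable _ _]
  calc _ ≤ ∑ i ∈ Finset.range m,
        |C| * ∫ x in ((n + i : ℕ) : ℝ)..((n + i : ℕ) + 4), totalDens t₁ t₂ u x := by
        refine Finset.sum_le_sum fun i _ => (hC h h0 h1 _ (Nat.cast_nonneg _)).trans ?_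
        exact mul_le_mul_of_nonneg_right (le_abs_self C)
          (intervalIntegral.integral_nonneg (by linarith) fun x _ => hu.totalDens_nonneg x)
    _ ≤ |C| * (4 * e) := by
        rw [← Finset.mul_sum]
        exact mul_le_mul_of_nonneg_left (sum_window_le hu.cont_totalDens he m) (abs_nonneg C)
    _ = _ := by ring

theorem integral_sq_diffQuot_one_le (hu : IsBoundedJet t₁ t₂ u E) {h : ℝ} (h0 : 0 < h)
    (h1 : h ≤ 1) (t : ℝ) {a b : ℝ} (hab : a ≤ b) :
    ∫ x in a..b, diffQuot h u 1 t x ^ 2 ≤ 4 / h ^ 2 * ∫ x in a..(b + 1), dens u t x := by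
  have c1 := hu.cont_slice 1 t
  have cd := continuous_slice hu.cont_dens t
  have step : ∫ x in a..b, diffQuot h u 1 t x ^ 2
      ≤ ∫ x in a..b, 2 / h ^ 2 * (u 1 t (x + h) ^ 2 + u 1 t x ^ 2) := by
    refine intervalIntegral.integral_mono_on hab
      (((continuous_slice (hu.continuous_diffQuot h 1) t).pow 2).intervalIntegrable _ _)
      ((by fun_prop : Continuous fun x =>
        2 / h ^ 2 * (u 1 t (x + h) ^ 2 + u 1 t x ^ 2)).intervalIntegrable _ _) fun x _ => ?_
    rw [diffQuot, div_pow, div_mul_eq_mul_div]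
    apply div_le_div_of_nonneg_right _ (sq_nonneg h)
    nlinarith [sq_nonneg (u 1 t (x + h) + u 1 t x)]
  rw [intervalIntegral.integral_const_mul, intervalIntegral.integral_add
    ((by fun_prop : Continuous fun x => u 1 t (x + h) ^ 2).intervalIntegrable _ _)
    ((by fun_prop : Continuous fun x => u 1 t x ^ 2).intervalIntegrable _ _),
    intervalIntegral.integral_comp_add_right (fun x => u 1 t x ^ 2)] at step
  have mono : ∀ c d, a ≤ c → c ≤ d → d ≤ b + 1 →
      ∫ x in c..d, u 1 t x ^ 2 ≤ ∫ x in a..(b + 1), dens u t x := fun c d hc hcd hd =>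
    (hu.integral_sq_one_le t hcd).trans (intervalIntegral.integral_mono_interval hc hcd hd
      (Eventually.of_forall fun x => dens_nonneg u t x) (cd.intervalIntegrable _ _))
  have m1 := mono (a + h) (b + h) (by linarith) (by linarith) (by linarith)
  have m2 := mono a b le_rfl hab (by linarith)
  have := mul_le_mul_of_nonneg_left (add_le_add m1 m2) (by positivity : 0 ≤ 2 / h ^ 2)
  refine step.trans (this.trans (le_of_eq ?_))
  ring

/-- Local smoothing for difference quotients near `+∞`. -/
theorem exists_integral_diffQuot_le (hu : IsBoundedJet t₁ t₂ u E) {S : ℕ → ℝ → ℝ} {κ B : ℝ}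
    (hS : IsStep S κ B) {ε : ℕ → ℝ} (hε : Tendsto ε atTop (𝓝 0))
    (he : ∀ (n : ℕ) (a b : ℝ), n ≤ a → a ≤ b → ∫ x in a..b, totalDens t₁ t₂ u x ≤ ε n) :
    ∃ C, ∀ (n : ℕ) (h : ℝ), 0 < h → h ≤ 1 →
      ∫ t in t₁..t₂, ∫ x in ((n : ℝ) + 1)..(n + 1 + 4),
        diffQuot h u 1 t x ^ 2 * S 1 (x - (n + 1)) ≤ C * ε n := by
  obtain ⟨C, hC0, hC⟩ := hu.exists_integral_diffPotDeriv_tail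
  have hE := hu.nonneg
  have hB := hS.one_le
  set D := (1 + 3 * E) ^ 2 with hD
  have hD1 : 1 ≤ D := by nlinarith
  refine ⟨(1 + 10 * D * B + C) / 3, fun n h h0 h1 => ?_⟩
  have cv0 := hu.continuous_diffQuot h 0
  have cv1 := hu.continuous_diffQuot h 1
  have cq := hu.continuous_diffPot h
  have cq' := hu.continuous_diffPotDeriv h
  have s1 : Continuous (S 1) := hS.jet.continuous 1
  have cp : ∀ c : ℝ, Continuous fun p : ℝ × ℝ =>
    diffQuot h u 1 p.1 p.2 ^ 2 * S 1 (p.2 - c) := fun c => by fun_prop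
  set J := ∫ t in t₁..t₂, ∫ x in ((n : ℝ) + 1)..(n + 1 + 4),
        diffQuot h u 1 t x ^ 2 * S 1 (x - (n + 1)) with hJ
  have key : ∀ l : ℕ, 3 * J ≤ (1 + 10 * D * B + C) * ε n + 12 * B / h ^ 2 * ε (n + 1 + l) := by
    intro l
    have l0 : (0 : ℝ) ≤ l := l.cast_nonneg
    set a : ℝ := (n : ℝ) + 1 with ha
    set m : ℝ := a + l with hm
    have ham : a ≤ m := by linarith
    have jet := hS.isJet_plateau a m
    have bal := mass_balance (a := a) (b := m + 4) hu.le (v := diffQuot h u)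
      (hu.continuous_diffQuot h) cq cq' (hu.hasDerivAt_diffQuot h) (hu.hasDerivAt_diffPot h)
      (fun t ht x => hu.hasDerivAt_t_diffQuot h ht x) jet
      (fun k => hS.plateau_left ham k le_rfl) (fun k => hS.plateau_right ham k le_rfl)
    have j0 := jet.continuous 0
    have j1 := jet.continuous 1
    have j3 := jet.continuous 3
    have upper := integral_integral_mono (s := t₁) (t := t₂) (a := a) (b := m + 4)
      (g := fun t x => 3 * (diffQuot h u 1 t x ^ 2 * S 1 (x - a))
        + (-3 * diffQuot h u 1 t x ^ 2 * plateau S a m 1 x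
          + diffQuot h u 0 t x ^ 2 * plateau S a m 3 x
          - diffQuot h u 0 t x ^ 2 * diffPotDeriv h u t x * plateau S a m 0 x
          + diffQuot h u 0 t x ^ 2 * diffPot h u t x * plateau S a m 1 x))
      (g' := fun t x => 3 * (diffQuot h u 1 t x ^ 2 * S 1 (x - m))
        + (10 * D * B * diffQuot h u 0 t x ^ 2
          + diffQuot h u 0 t x ^ 2 * |diffPotDeriv h u t x|))
      (by fun_prop) (by fun_prop) hu.le (by linarith) (by
        intro t ht x _
        have b0 := hS.plateau_nonneg ham x
        have b0' := hS.plateau_le_one a m x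
        have b1 := hS.abs_plateau_le a m (by norm_num : 1 ≤ 4) x
        have b3 := hS.abs_plateau_le a m (by norm_num : 3 ≤ 4) x
        have qb := abs_cubic_le (hu.abs_cube_le ht (x + h)) (hu.abs_cube_le ht x)
        have q1 : diffPot h u t x * plateau S a m 1 x ≤ 4 * D * (2 * B) :=
          (le_abs_self _).trans (abs_mul_le_mul qb b1)
        have q2 : -(diffPotDeriv h u t x * plateau S a m 0 x) ≤ |diffPotDeriv h u t x| := by
          refine (neg_le_abs _).trans ?_
          rw [abs_mul, abs_of_nonneg b0]
          exact mul_le_of_le_one_right (abs_nonneg _) b0'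
        have q3 : plateau S a m 3 x ≤ 2 * B := (le_abs_self _).trans b3
        have v0 := sq_nonneg (diffQuot h u 0 t x)
        have e1 := mul_le_mul_of_nonneg_left q1 v0
        have e2 := mul_le_mul_of_nonneg_left q2 v0
        have e3 := mul_le_mul_of_nonneg_left q3 v0
        have e4 : diffQuot h u 0 t x ^ 2 * (2 * B) ≤ diffQuot h u 0 t x ^ 2 * (2 * D * B) :=
          mul_le_mul_of_nonneg_left (by nlinarith) v0
        have e5 : plateau S a m 1 x = S 1 (x - a) - S 1 (x - m) := rfl
        have e6 : -3 * diffQuot h u 1 t x ^ 2 * plateau S a m 1 x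
          = -3 * diffQuot h u 1 t x ^ 2 * (S 1 (x - a) - S 1 (x - m)) := by rw [e5]
        linarith)
    rw [integral_integral_add_of_continuous (by fun_prop) (by fun_prop), ← bal,
      integral_integral_add_of_continuous (by fun_prop) (by fun_prop),
      integral_integral_add_of_continuous (by fun_prop) (by fun_prop),
      integral_integral_const_mul, integral_integral_const_mul,
      integral_integral_const_mul] at upper
    have left : ∫ t in t₁..t₂, ∫ x in a..(m + 4), diffQuot h u 1 t x ^ 2 * S 1 (x - a) = J := by
      refine intervalIntegral.integral_congr fun t _ => ?_
      exact integral_eq_of_support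
        (continuous_slice (g := fun t x => diffQuot h u 1 t x ^ 2 * S 1 (x - a)) (cp a) t)
        le_rfl (by linarith)
        (fun x hx => by rw [hS.left 1 (x - a) (by linarith), mul_zero])
        (fun x hx => by rw [hS.right 0 (x - a) (by linarith), mul_zero])
    have right : ∫ t in t₁..t₂, ∫ x in a..(m + 4), diffQuot h u 1 t x ^ 2 * S 1 (x - m)
        ≤ 4 * B / h ^ 2 * ε (n + 1 + l) := by
      have r1 : ∫ t in t₁..t₂, ∫ x in a..(m + 4), diffQuot h u 1 t x ^ 2 * S 1 (x - m)
          ≤ ∫ t in t₁..t₂, 4 * B / h ^ 2 * ∫ x in m..(m + 4 + 1), dens u t x := by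
        refine intervalIntegral.integral_mono_on hu.le
          ((continuous_integral_slice (g := fun t x => diffQuot h u 1 t x ^ 2 * S 1 (x - m)) (cp m)
            _ _).intervalIntegrable _ _)
          ((continuous_const.mul
            (continuous_integral_slice hu.cont_dens _ _)).intervalIntegrable _ _) fun t _ => ?_
        have cs := continuous_slice (g := fun t x => diffQuot h u 1 t x ^ 2 * S 1 (x - m)) (cp m) t
        rw [integral_eq_of_support (a := m) (b := m + 4) cs ham le_rfl
          (fun x hx => by rw [hS.left 1 (x - m) (by linarith), mul_zero])
          (fun x hx => by rw [hS.right 0 (x - m) (by linarith), mul_zero])]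
        have r2 : ∫ x in m..(m + 4), diffQuot h u 1 t x ^ 2 * S 1 (x - m)
            ≤ ∫ x in m..(m + 4), diffQuot h u 1 t x ^ 2 * B :=
          intervalIntegral.integral_mono_on (by linarith) (cs.intervalIntegrable _ _)
            ((((continuous_slice cv1 t).pow 2).mul continuous_const).intervalIntegrable _ _)
            fun x _ => mul_le_mul_of_nonneg_left
              ((le_abs_self _).trans (hS.abs_le 1 (by norm_num) _)) (sq_nonneg _)
        rw [intervalIntegral.integral_mul_const] at r2
        have r3 := mul_le_mul_of_nonneg_right (hu.integral_sq_diffQuot_one_le h0 h1 t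
          (a := m) (b := m + 4) (by linarith)) (by linarith : 0 ≤ B)
        refine r2.trans (r3.trans (le_of_eq ?_))
        ring
      rw [intervalIntegral.integral_const_mul] at r1
      refine r1.trans (mul_le_mul_of_nonneg_left ?_ (by positivity))
      refine (hu.integral_integral_dens_le (by linarith)).trans (he _ _ _ ?_ (by linarith))
      push_cast
      linarith
    have init : ∫ x in a..(m + 4), diffQuot h u 0 t₁ x ^ 2 * plateau S a m 0 x ≤ ε n := by
      have i1 : ∫ x in a..(m + 4), diffQuot h u 0 t₁ x ^ 2 * plateau S a m 0 x
          ≤ ∫ x in a..(m + 4), diffQuot h u 0 t₁ x ^ 2 :=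
        intervalIntegral.integral_mono_on (by linarith)
          ((((continuous_slice cv0 t₁).pow 2).mul j0).intervalIntegrable _ _)
          (((continuous_slice cv0 t₁).pow 2).intervalIntegrable _ _)
          fun x _ => mul_le_of_le_one_right (sq_nonneg _) (hS.plateau_le_one a m x)
      refine i1.trans ((hu.integral_sq_diffQuot_le h0 h1 t₁ (by linarith)).trans
        ((hu.integral_dens_le (by linarith)).trans (he _ _ _ (by linarith) (by linarith))))
    have fin : 0 ≤ ∫ x in a..(m + 4), diffQuot h u 0 t₂ x ^ 2 * plateau S a m 0 x :=
      intervalIntegral.integral_nonneg (by linarith) fun x _ =>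
        mul_nonneg (sq_nonneg _) (hS.plateau_nonneg ham x)
    have mid : ∫ t in t₁..t₂, ∫ x in a..(m + 4), diffQuot h u 0 t x ^ 2 ≤ ε n := by
      have m1 : ∫ t in t₁..t₂, ∫ x in a..(m + 4), diffQuot h u 0 t x ^ 2
          ≤ ∫ t in t₁..t₂, ∫ x in a..(m + 4 + 1), dens u t x :=
        intervalIntegral.integral_mono hu.le
          ((continuous_integral_slice (g := fun t x => diffQuot h u 0 t x ^ 2) (cv0.pow 2)
            _ _).intervalIntegrable _ _)
          ((continuous_integral_slice hu.cont_dens _ _).intervalIntegrable _ _)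
          fun t => hu.integral_sq_diffQuot_le h0 h1 t (by linarith)
      exact m1.trans ((hu.integral_integral_dens_le (by linarith)).trans
        (he _ _ _ (by linarith) (by linarith)))
    have pot := hC n (ε n) (he n) h h0 h1 (l + 4)
    rw [show (n : ℝ) + 1 + (l + 4 : ℕ) = m + 4 by push_cast; ring] at pot
    rw [left] at upper
    have mid' := mul_le_mul_of_nonneg_left mid (by positivity : 0 ≤ 10 * D * B)
    have right' : 3 * ∫ t in t₁..t₂, ∫ x in a..(m + 4), diffQuot h u 1 t x ^ 2 * S 1 (x - m)
        ≤ 12 * B / h ^ 2 * ε (n + 1 + l) := by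
      calc _ ≤ 3 * (4 * B / h ^ 2 * ε (n + 1 + l)) := mul_le_mul_of_nonneg_left right (by norm_num)
        _ = _ := by ring
    linarith
  have lim : Tendsto (fun l : ℕ => (1 + 10 * D * B + C) * ε n + 12 * B / h ^ 2 * ε (n + 1 + l))
      atTop (𝓝 ((1 + 10 * D * B + C) * ε n + 12 * B / h ^ 2 * 0)) := by
    refine (Tendsto.const_mul _ ?_).const_add _
    exact hε.comp (tendsto_atTop_mono (fun l => by omega : ∀ l : ℕ, l ≤ n + 1 + l) tendsto_id)
  have := ge_of_tendsto' lim key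
  linarith

/-- Local smoothing near `+∞`: second derivatives are square integrable in moving windows, with
integrals tending to zero. -/
theorem exists_integral_sq_two_tail (hu : IsBoundedJet t₁ t₂ u E) {S : ℕ → ℝ → ℝ} {κ B : ℝ}
    (hS : IsStep S κ B) : ∃ ε : ℕ → ℝ, Tendsto ε atTop (𝓝 0) ∧ ∀ n : ℕ,
      ∫ t in t₁..t₂, ∫ x in ((n : ℝ) + 1)..(n + 1 + 4), u 2 t x ^ 2 * S 1 (x - (n + 1)) ≤ ε n := by
  obtain ⟨ε, hε, he⟩ := exists_tail_bound hu.cont_totalDens hu.totalDens_nonneg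
    fun a b hab => hu.integral_totalDens_le_const hab
  obtain ⟨C, hC⟩ := hu.exists_integral_diffQuot_le hS hε he
  refine ⟨fun n => C * ε n, by simpa using hε.const_mul C, fun n => ?_⟩
  have s1 : Continuous (S 1) := hS.jet.continuous 1
  have c2 := hu.cont 2
  set H : ℝ → ℝ := fun h => ∫ t in t₁..t₂, ∫ x in ((n : ℝ) + 1)..(n + 1 + 4),
    (∫ s in (0 : ℝ)..1, u 2 t (x + h * s)) ^ 2 * S 1 (x - (n + 1)) with hH
  have ci : Continuous fun p : (ℝ × ℝ) × ℝ => ∫ s in (0 : ℝ)..1, u 2 p.1.2 (p.2 + p.1.1 * s) := by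
    refine intervalIntegral.continuous_parametric_intervalIntegral_of_continuous'
      (f := fun (p : (ℝ × ℝ) × ℝ) s => u 2 p.1.2 (p.2 + p.1.1 * s)) ?_ 0 1
    exact c2.comp (by fun_prop :
      Continuous fun q : ((ℝ × ℝ) × ℝ) × ℝ => (q.1.1.2, q.1.2 + q.1.1.1 * q.2))
  have cx : Continuous fun p : ℝ × ℝ => ∫ x in ((n : ℝ) + 1)..(n + 1 + 4),
      (∫ s in (0 : ℝ)..1, u 2 p.2 (x + p.1 * s)) ^ 2 * S 1 (x - (n + 1)) := by
    refine intervalIntegral.continuous_parametric_intervalIntegral_of_continuous'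
      (f := fun (p : ℝ × ℝ) x =>
        (∫ s in (0 : ℝ)..1, u 2 p.2 (x + p.1 * s)) ^ 2 * S 1 (x - (n + 1))) ?_ _ _
    exact (ci.pow 2).mul (s1.comp (by fun_prop))
  have cH : Continuous H :=
    intervalIntegral.continuous_parametric_intervalIntegral_of_continuous'
      (f := fun h t => ∫ x in ((n : ℝ) + 1)..(n + 1 + 4),
        (∫ s in (0 : ℝ)..1, u 2 t (x + h * s)) ^ 2 * S 1 (x - (n + 1))) cx _ _
  have H0 : H 0 = ∫ t in t₁..t₂, ∫ x in ((n : ℝ) + 1)..(n + 1 + 4),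
      u 2 t x ^ 2 * S 1 (x - (n + 1)) := by
    simp [hH]
  rw [← H0]
  have lim : Tendsto H (𝓝[>] 0) (𝓝 (H 0)) := cH.continuousAt.tendsto.mono_left nhdsWithin_le_nhds
  refine le_of_tendsto lim ?_
  filter_upwards [Ioc_mem_nhdsGT (zero_lt_one (α := ℝ))] with h hh
  refine le_trans (le_of_eq ?_) (hC n h hh.1 hh.2)
  simp only [hH]
  refine intervalIntegral.integral_congr fun t _ => intervalIntegral.integral_congr fun x _ => ?_
  simp only [diffQuot]
  rw [slope_eq_integral (hu.hasDerivAt_x 1 t) (hu.cont_slice 2 t) hh.1]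

end IsBoundedJet

/-- The first derivatives of the travelling weight with speed `c`. -/
noncomputable def weight (c k d : ℝ) (j : ℕ) (t x : ℝ) : ℝ := k ^ j * phiJet j (k * (x - c * t - d))

/-- The first three derivatives of the product of a time dependent weight and a cutoff. -/
def cutWeight (ψ : ℕ → ℝ → ℝ → ℝ) (θ : ℕ → ℝ → ℝ) : ℕ → ℝ → ℝ → ℝ
  | 0 => fun t x => ψ 0 t x * θ 0 x
  | 1 => fun t x => ψ 1 t x * θ 0 x + ψ 0 t x * θ 1 x
  | 2 => fun t x => ψ 2 t x * θ 0 x + 2 * ψ 1 t x * θ 1 x + ψ 0 t x * θ 2 x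
  | _ + 3 => fun t x =>
    ψ 3 t x * θ 0 x + 3 * ψ 2 t x * θ 1 x + 3 * ψ 1 t x * θ 2 x + ψ 0 t x * θ 3 x

theorem continuous_weight (c k d : ℝ) (j : ℕ) :
    Continuous fun p : ℝ × ℝ => weight c k d j p.1 p.2 :=
  continuous_const.mul ((continuous_phiJet j).comp (by fun_prop))

theorem hasDerivAt_weight (c k d : ℝ) {j : ℕ} (hj : j < 3) (t x : ℝ) :
    HasDerivAt (weight c k d j t) (weight c k d (j + 1) t x) x := by
  have h := (((hasDerivAt_id x).sub_const (c * t)).sub_const d).const_mul k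
  refine (((hasDerivAt_phiJet j hj (k * (x - c * t - d))).comp x h).const_mul
    (k ^ j)).congr_deriv ?_
  simp only [weight]
  ring

theorem hasDerivAt_t_weight (c k d t x : ℝ) :
    HasDerivAt (fun s => weight c k d 0 s x) (-c * weight c k d 1 t x) t := by
  have h := (((((hasDerivAt_id t).const_mul c).const_sub x).sub_const d)).const_mul k
  refine (((hasDerivAt_phiJet 0 (by norm_num) (k * (x - c * t - d))).comp t h).const_mul
    (k ^ 0)).congr_deriv ?_
  simp only [weight]
  ring

theorem continuous_cutWeight {ψ : ℕ → ℝ → ℝ → ℝ} {θ : ℕ → ℝ → ℝ}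
    (hψ : ∀ k, Continuous fun p : ℝ × ℝ => ψ k p.1 p.2) (hθ : ∀ k, Continuous (θ k)) (k : ℕ) :
    Continuous fun p : ℝ × ℝ => cutWeight ψ θ k p.1 p.2 := by
  have ψ0 := hψ 0
  have ψ1 := hψ 1
  have ψ2 := hψ 2
  have ψ3 := hψ 3
  have θ0 := hθ 0
  have θ1 := hθ 1
  have θ2 := hθ 2
  have θ3 := hθ 3
  match k with
  | 0 | 1 | 2 | _ + 3 => simp only [cutWeight]; fun_prop

theorem hasDerivAt_cutWeight {ψ : ℕ → ℝ → ℝ → ℝ} {θ : ℕ → ℝ → ℝ}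
    (hψ : ∀ k < 3, ∀ t x, HasDerivAt (ψ k t) (ψ (k + 1) t x) x) (hθ : IsJet θ) (k : ℕ)
    (hk : k < 3) (t x : ℝ) :
    HasDerivAt (cutWeight ψ θ k t) (cutWeight ψ θ (k + 1) t x) x := by
  have ψ0 := hψ 0 (by norm_num) t x
  have ψ1 := hψ 1 (by norm_num) t x
  have ψ2 := hψ 2 (by norm_num) t x
  have θ0 := hθ.hasDerivAt 0 x
  have θ1 := hθ.hasDerivAt 1 x
  have θ2 := hθ.hasDerivAt 2 x
  interval_cases k
  · exact ψ0.mul θ0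
  · refine ((ψ1.mul θ0).add (ψ0.mul θ1)).congr_deriv ?_
    simp only [cutWeight]
    ring
  · refine (((ψ2.mul θ0).add ((ψ1.const_mul 2).mul θ1)).add (ψ0.mul θ2)).congr_deriv ?_
    simp only [cutWeight]
    ring

theorem cutWeight_eq_zero (ψ : ℕ → ℝ → ℝ → ℝ) {θ : ℕ → ℝ → ℝ} {x : ℝ} (h : ∀ k, θ k x = 0)
    (k : ℕ) (t : ℝ) : cutWeight ψ θ k t x = 0 := by
  match k with
  | 0 | 1 | 2 | _ + 3 => simp [cutWeight, h]

/-- The bulk part of the energy production. -/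
theorem bulk_le {c σ δ a b e p p₃ : ℝ} (hc : 0 ≤ c) (hp : 0 ≤ p) (hp₃ : p₃ ≤ σ * p)
    (ha : |a| ^ 3 ≤ δ) :
    (a ^ 2 + b ^ 2 - 2 / 5 * a ^ 5) * (-c * p)
      + (-3 * b ^ 2 + 8 / 5 * a ^ 5 - (e + a ^ 4) ^ 2 - 2 * e ^ 2 + 8 * a ^ 3 * b ^ 2) * p
      + (a ^ 2 + b ^ 2) * p₃ ≤ ((10 + c) * δ - (c - σ)) * (a ^ 2 + b ^ 2) * p := by
  have hδ : 0 ≤ δ := le_trans (by positivity) ha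
  have h1 : a ^ 5 ≤ δ * a ^ 2 := by
    have := (le_abs_self _).trans
      (abs_mul_le_mul (by rwa [abs_pow] : |a ^ 3| ≤ δ) (abs_sq a).le)
    linarith
  have h2 : a ^ 3 * b ^ 2 ≤ δ * b ^ 2 :=
    (le_abs_self _).trans (abs_mul_le_mul (by rwa [abs_pow] : |a ^ 3| ≤ δ) (abs_sq b).le)
  have h3 := mul_le_mul_of_nonneg_left hp₃ (by positivity : 0 ≤ a ^ 2 + b ^ 2)
  have h4 : -c * (a ^ 2 + b ^ 2) + (8 + 2 * c) / 5 * a ^ 5 - 3 * b ^ 2 - (e + a ^ 4) ^ 2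
      - 2 * e ^ 2 + 8 * (a ^ 3 * b ^ 2) + σ * (a ^ 2 + b ^ 2)
        ≤ ((10 + c) * δ - (c - σ)) * (a ^ 2 + b ^ 2) := by
    have h5 := mul_le_mul_of_nonneg_left h1 (by positivity : 0 ≤ (8 + 2 * c) / 5)
    have h6 : 0 ≤ (c + 2) * (δ * b ^ 2) := by positivity
    have h7 : 0 ≤ (42 + 3 * c) / 5 * (δ * a ^ 2) := by positivity
    nlinarith [sq_nonneg (e + a ^ 4), sq_nonneg e, sq_nonneg b]
  have h5 := mul_le_mul_of_nonneg_right h4 hp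
  linarith

/-- The part of the energy production caused by the cutoff. -/
theorem cutoff_error_le {D k a b e p₀ p₁ p₂ s₁ s₂ s₃ r₁ r₂ r₃ : ℝ} (hD : 1 ≤ D)
    (ha : |a| ^ 3 ≤ D) (hp : 0 ≤ p₀) (hp₀ : p₀ ≤ 1) (hp₁ : |p₁| ≤ k) (hp₂ : |p₂| ≤ k ^ 2)
    (hs : 0 ≤ s₁) (hr : 0 ≤ r₁) :
    (-3 * b ^ 2 + 8 / 5 * a ^ 5 - (e + a ^ 4) ^ 2 - 2 * e ^ 2 + 8 * a ^ 3 * b ^ 2)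
        * (p₀ * (s₁ - r₁))
      + (a ^ 2 + b ^ 2) * (3 * p₂ * (s₁ - r₁) + 3 * p₁ * (s₂ - r₂) + p₀ * (s₃ - r₃))
      ≤ (13 * D ^ 2 + 3 * k ^ 2 + 3 * k + 1)
          * ((a ^ 2 + b ^ 2) * ((|s₁| + |s₂| + |s₃|) + (|r₁| + |r₂| + |r₃|)))
        + 4 * (e ^ 2 * r₁) := by
  have k0 : 0 ≤ k := (abs_nonneg _).trans hp₁
  set d := a ^ 2 + b ^ 2 with hd
  have d0 : 0 ≤ d := by positivity
  have fl := abs_le.1 (abs_flux_le (b := b) hD ha)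
  rw [← hd] at fl
  have a8 : a ^ 8 ≤ D ^ 2 * d := by
    calc a ^ 8 = (|a| ^ 3) ^ 2 * a ^ 2 := by rw [← abs_pow, sq_abs]; ring
      _ ≤ D ^ 2 * d := mul_le_mul (pow_le_pow_left₀ (by positivity) ha 2)
          (by rw [hd]; nlinarith [sq_nonneg b]) (sq_nonneg a) (by positivity)
  have ps : 0 ≤ p₀ * s₁ := mul_nonneg hp hs
  have pr : 0 ≤ p₀ * r₁ := mul_nonneg hp hr
  have ps' : p₀ * s₁ ≤ s₁ := mul_le_of_le_one_left hs hp₀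
  have pr' : p₀ * r₁ ≤ r₁ := mul_le_of_le_one_left hr hp₀
  have hDd : D * d ≤ D ^ 2 * d := mul_le_mul_of_nonneg_right (by nlinarith) d0
  have t1 : (-3 * b ^ 2 + 8 / 5 * a ^ 5 - (e + a ^ 4) ^ 2 - 2 * e ^ 2 + 8 * a ^ 3 * b ^ 2)
      * (p₀ * s₁) ≤ 13 * D ^ 2 * d * s₁ := by
    calc _ ≤ (13 * D ^ 2 * d) * (p₀ * s₁) := mul_le_mul_of_nonneg_right
          (by nlinarith [sq_nonneg (e + a ^ 4), sq_nonneg e, fl.2, hDd,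
            mul_nonneg (sq_nonneg D) d0]) ps
      _ ≤ _ := mul_le_mul_of_nonneg_left ps' (by positivity)
  have t2 : -(-3 * b ^ 2 + 8 / 5 * a ^ 5 - (e + a ^ 4) ^ 2 - 2 * e ^ 2 + 8 * a ^ 3 * b ^ 2)
      * (p₀ * r₁) ≤ (13 * D ^ 2 * d + 4 * e ^ 2) * r₁ := by
    calc _ ≤ (13 * D ^ 2 * d + 4 * e ^ 2) * (p₀ * r₁) := mul_le_mul_of_nonneg_right
          (by nlinarith [sq_nonneg (e - a ^ 4), fl.1]) pr
      _ ≤ _ := mul_le_mul_of_nonneg_left pr' (by positivity)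
  have m : ∀ {p q y z : ℝ}, |p| ≤ q → p * (y - z) ≤ q * (|y| + |z|) := fun hpq =>
    (le_abs_self _).trans (abs_mul_le_mul hpq (abs_sub _ _))
  have m1 := mul_le_mul_of_nonneg_left (m (y := s₁) (z := r₁) hp₂) d0
  have m2 := mul_le_mul_of_nonneg_left (m (y := s₂) (z := r₂) hp₁) d0
  have m3 := mul_le_mul_of_nonneg_left
    (m (y := s₃) (z := r₃) ((abs_of_nonneg hp).le.trans hp₀)) d0
  have hs' : |s₁| = s₁ := abs_of_nonneg hs
  have hr' : |r₁| = r₁ := abs_of_nonneg hr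
  have n1 : 0 ≤ (3 * k + 1) * (d * (|s₁| + |r₁|)) := by positivity
  have n2 : 0 ≤ (13 * D ^ 2 + 3 * k ^ 2 + 1) * (d * (|s₂| + |r₂|)) := by positivity
  have n3 : 0 ≤ (13 * D ^ 2 + 3 * k ^ 2 + 3 * k) * (d * (|s₃| + |r₃|)) := by positivity
  rw [hs', hr'] at m1 n1 ⊢
  linarith

namespace IsBoundedJet

variable {t₁ t₂ E : ℝ} {u : ℕ → ℝ → ℝ → ℝ}

theorem integral_dens_mul_step_le (hu : IsBoundedJet t₁ t₂ u E) {S : ℕ → ℝ → ℝ} {κ B : ℝ}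
    (hS : IsStep S κ B) {a b c : ℝ} (hac : a ≤ c) (hcb : c + 4 ≤ b) :
    ∫ t in t₁..t₂, ∫ x in a..b, dens u t x * (|S 1 (x - c)| + |S 2 (x - c)| + |S 3 (x - c)|)
      ≤ 3 * B * ∫ x in c..(c + 4), totalDens t₁ t₂ u x := by
  have hB := hS.one_le
  have s1 : Continuous (S 1) := hS.jet.continuous 1
  have s2 : Continuous (S 2) := hS.jet.continuous 2
  have s3 : Continuous (S 3) := hS.jet.continuous 3
  have cd := hu.cont_dens
  have cg : Continuous fun p : ℝ × ℝ =>
    dens u p.1 p.2 * (|S 1 (p.2 - c)| + |S 2 (p.2 - c)| + |S 3 (p.2 - c)|) := by fun_prop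
  have supp : ∀ t, ∫ x in a..b, dens u t x * (|S 1 (x - c)| + |S 2 (x - c)| + |S 3 (x - c)|)
      = ∫ x in c..(c + 4), dens u t x * (|S 1 (x - c)| + |S 2 (x - c)| + |S 3 (x - c)|) := by
    intro t
    refine integral_eq_of_support (continuous_slice (g := fun t x =>
      dens u t x * (|S 1 (x - c)| + |S 2 (x - c)| + |S 3 (x - c)|)) cg t) hac hcb ?_ ?_
    · intro x hx
      simp [hS.left _ (x - c) (by linarith)]
    · intro x hx
      simp [hS.right 0 (x - c) (by linarith), hS.right 1 (x - c) (by linarith),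
        hS.right 2 (x - c) (by linarith)]
  simp only [supp]
  refine (integral_integral_mono (g' := fun t x => 3 * B * dens u t x) cg
    (continuous_const.mul cd) hu.le (by linarith) fun t _ x _ => ?_).trans ?_
  · have b1 := hS.abs_le 1 (by norm_num) (x - c)
    have b2 := hS.abs_le 2 (by norm_num) (x - c)
    have b3 := hS.abs_le 3 (by norm_num) (x - c)
    rw [mul_comm (3 * B)]
    exact mul_le_mul_of_nonneg_left (by linarith) (dens_nonneg _ _ _)
  · rw [integral_integral_const_mul]
    exact mul_le_mul_of_nonneg_left (hu.integral_integral_dens_le (by linarith)) (by positivity)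

/-- The energy production caused by a cutoff tends to zero along a sequence of cutoffs. -/
theorem exists_cutoff_error_tail (hu : IsBoundedJet t₁ t₂ u E) {S : ℕ → ℝ → ℝ} {κ B : ℝ}
    (hS : IsStep S κ B) {A : ℝ} (hA : 0 ≤ A) :
    ∃ η N : ℕ → ℝ, Tendsto η atTop (𝓝 0) ∧ Tendsto N atTop atTop ∧ (∀ n, 0 ≤ N n) ∧
      ∀ n, ∫ t in t₁..t₂, ∫ x in (-N n)..(N n + 4),
        (A * (dens u t x * ((|S 1 (x - -N n)| + |S 2 (x - -N n)| + |S 3 (x - -N n)|)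
          + (|S 1 (x - N n)| + |S 2 (x - N n)| + |S 3 (x - N n)|)))
          + 4 * (u 2 t x ^ 2 * S 1 (x - N n))) ≤ η n := by
  obtain ⟨ε, hε, he⟩ := exists_tail_bound hu.cont_totalDens hu.totalDens_nonneg
    fun a b hab => hu.integral_totalDens_le_const hab
  obtain ⟨ε', hε', he'⟩ := exists_tail_bound (hu.cont_totalDens.comp continuous_neg)
    (fun x => hu.totalDens_nonneg (-x)) (A := E + (t₂ - t₁) * E) fun a b hab => by
      have h := hu.integral_totalDens_le_const (neg_le_neg hab)
      rwa [← intervalIntegral.integral_comp_neg] at h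
  obtain ⟨ε'', hε'', he''⟩ := hu.exists_integral_sq_two_tail hS
  have hB := hS.one_le
  have shift : Tendsto (fun n : ℕ => n + 4) atTop atTop := tendsto_add_atTop_nat 4
  refine ⟨fun n => A * (3 * B * ε' n + 3 * B * ε n) + 4 * ε'' (n + 4),
    fun n => ((n + 4 : ℕ) : ℝ) + 1, ?_, ?_, fun n => by positivity, fun n => ?_⟩
  · have := (((hε'.const_mul (3 * B)).add (hε.const_mul (3 * B))).const_mul A).add
      ((hε''.comp shift).const_mul 4)
    simpa using this
  · exact tendsto_atTop_add_const_right _ _ (tendsto_natCast_atTop_atTop.comp shift)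
  · have n0 : (0 : ℝ) ≤ n := n.cast_nonneg
    have hN : ((n + 4 : ℕ) : ℝ) + 1 = n + 5 := by push_cast; ring
    have hv₂ := he'' (n + 4)
    simp only [hN] at hv₂ ⊢
    set N : ℝ := n + 5 with hNdef
    have s1 : Continuous (S 1) := hS.jet.continuous 1
    have s2 : Continuous (S 2) := hS.jet.continuous 2
    have s3 : Continuous (S 3) := hS.jet.continuous 3
    have cd := hu.cont_dens
    have c2 := hu.cont 2
    rw [integral_integral_add_of_continuous (by fun_prop) (by fun_prop),
      integral_integral_const_mul, integral_integral_const_mul]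
    simp only [mul_add (dens u _ _) (|_| + |_| + |_|) (|_| + |_| + |_|)]
    rw [integral_integral_add_of_continuous (by fun_prop) (by fun_prop)]
    have hl : ∫ x in (-N)..(-N + 4), totalDens t₁ t₂ u x ≤ ε' n := by
      have h := he' n (N - 4) N (by linarith) (by linarith)
      simp only [Function.comp_def] at h
      rw [intervalIntegral.integral_comp_neg] at h
      rwa [show -N + 4 = -(N - 4) by ring]
    have left := (hu.integral_dens_mul_step_le hS (a := -N) (b := N + 4) (c := -N) le_rfl
      (by linarith)).trans (mul_le_mul_of_nonneg_left hl (by positivity : 0 ≤ 3 * B))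
    have right := (hu.integral_dens_mul_step_le hS (a := -N) (b := N + 4) (c := N)
      (by linarith) le_rfl).trans (mul_le_mul_of_nonneg_left
        (he n N (N + 4) (by linarith) (by linarith)) (by positivity : 0 ≤ 3 * B))
    have supp : ∫ t in t₁..t₂, ∫ x in (-N)..(N + 4), u 2 t x ^ 2 * S 1 (x - N)
        = ∫ t in t₁..t₂, ∫ x in N..(N + 4), u 2 t x ^ 2 * S 1 (x - N) := by
      refine intervalIntegral.integral_congr fun t _ => ?_
      have c2' := hu.cont_slice 2 t
      exact integral_eq_of_support (by fun_prop) (by linarith) le_rfl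
        (fun x hx => by rw [hS.left 1 (x - N) (by linarith), mul_zero])
        (fun x hx => by rw [hS.right 0 (x - N) (by linarith), mul_zero])
    rw [supp]
    exact add_le_add (mul_le_mul_of_nonneg_left (add_le_add left right) hA)
      (mul_le_mul_of_nonneg_left hv₂ (by norm_num))

end IsBoundedJet

theorem weight_zero_nonneg (c k d t x : ℝ) : 0 ≤ weight c k d 0 t x := by
  rw [weight, pow_zero, one_mul]
  exact phi_nonneg _

theorem weight_zero_le_one (c k d t x : ℝ) : weight c k d 0 t x ≤ 1 := by
  rw [weight, pow_zero, one_mul]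
  exact phi_le_one _

theorem weight_zero_le_exp (c k d t x : ℝ) : weight c k d 0 t x ≤ exp (k * (x - c * t - d)) := by
  rw [weight, pow_zero, one_mul]
  exact phi_le_exp _

theorem weight_one_nonneg {k : ℝ} (hk : 0 ≤ k) (c d t x : ℝ) : 0 ≤ weight c k d 1 t x :=
  mul_nonneg (by positivity) (phiJet_one_nonneg _)

theorem weight_one_le_exp {k : ℝ} (hk : 0 ≤ k) (c d t x : ℝ) :
    weight c k d 1 t x ≤ k * exp (k * (x - c * t - d)) := by
  rw [weight, pow_one]
  exact mul_le_mul_of_nonneg_left (phiJet_one_le_exp _) hk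

theorem abs_weight_one_le {k : ℝ} (hk : 0 ≤ k) (c d t x : ℝ) : |weight c k d 1 t x| ≤ k := by
  rw [abs_of_nonneg (weight_one_nonneg hk c d t x), weight, pow_one]
  exact mul_le_of_le_one_right hk (phiJet_one_le_one _)

theorem abs_weight_two_le (c k d t x : ℝ) : |weight c k d 2 t x| ≤ k ^ 2 := by
  rw [weight, abs_mul, abs_sq]
  exact mul_le_of_le_one_right (sq_nonneg k) (abs_phiJet_two_le_one _)

theorem weight_three_le {k : ℝ} (hk : 0 ≤ k) (c d t x : ℝ) :
    weight c k d 3 t x ≤ k ^ 2 * weight c k d 1 t x := by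
  have h := mul_le_mul_of_nonneg_left (phiJet_three_le (k * (x - c * t - d)))
    (by positivity : 0 ≤ k ^ 3)
  rw [weight, weight]
  linarith

/-- Where the weight is not small, the nonlinear part of the energy is absorbed. -/
theorem abs_pow_five_mul_le {D δ a b p X : ℝ} (hp : 0 ≤ p) (hX : 0 ≤ X) (ha : |a| ^ 3 ≤ D)
    (hδ : δ ≤ 1 / 2) (h : |a| ^ 3 ≤ δ ∨ p ≤ X) :
    |2 / 5 * a ^ 5| * p ≤ 1 / 3 * ((a ^ 2 + b ^ 2) * p) + D * X * (a ^ 2 + b ^ 2) := by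
  have hD : 0 ≤ D := le_trans (by positivity) ha
  have e : |2 / 5 * a ^ 5| = 2 / 5 * (|a| ^ 3 * a ^ 2) := by
    rw [abs_mul, abs_pow, abs_of_pos (by norm_num : (0 : ℝ) < 2 / 5), ← sq_abs a]
    ring
  have hb := sq_nonneg b
  rw [e]
  rcases h with h | h
  · have h1 : |a| ^ 3 * a ^ 2 ≤ 1 / 2 * a ^ 2 :=
      mul_le_mul_of_nonneg_right (h.trans hδ) (sq_nonneg a)
    have h2 : 2 / 5 * (|a| ^ 3 * a ^ 2) ≤ 1 / 3 * (a ^ 2 + b ^ 2) := by linarith [sq_nonneg a]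
    have h3 := mul_le_mul_of_nonneg_right h2 hp
    have h4 : 0 ≤ D * X * (a ^ 2 + b ^ 2) := by positivity
    linarith
  · have h1 : |a| ^ 3 * a ^ 2 * p ≤ D * (a ^ 2 + b ^ 2) * X :=
      mul_le_mul (mul_le_mul ha (by linarith) (sq_nonneg a) hD) h hp (by positivity)
    have h2 : 0 ≤ |a| ^ 3 * a ^ 2 * p := by positivity
    have h3 : 0 ≤ 1 / 3 * ((a ^ 2 + b ^ 2) * p) := by positivity
    linarith

theorem integral_exp_neg_mul_sub_le {l : ℝ} (hl : 0 < l) (s t : ℝ) :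
    ∫ r in s..t, exp (-(l * (t - r))) ≤ 1 / l := by
  have d : ∀ r, HasDerivAt (fun r => exp (-(l * (t - r))) / l) (exp (-(l * (t - r)))) r := by
    intro r
    refine ((((hasDerivAt_id r).const_sub t).const_mul l).neg.exp.div_const l).congr_deriv ?_
    simp
    field_simp
  rw [intervalIntegral.integral_eq_sub_of_hasDerivAt (fun r _ => d r)
    ((by fun_prop : Continuous fun r => exp (-(l * (t - r)))).intervalIntegrable _ _)]
  simp only [sub_self, mul_zero, neg_zero, exp_zero]
  have : 0 ≤ exp (-(l * (t - s))) / l := by positivity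
  linarith

namespace IsBoundedJet

variable {t₁ t₂ E : ℝ} {u : ℕ → ℝ → ℝ → ℝ}

/-- Almost monotonicity of the energy localized by a travelling weight and a cutoff, for
solutions that are small to the right of the line `x = c₀ t + R`. -/
theorem energy_cutWeight_le (hu : IsBoundedJet t₁ t₂ u E) {S : ℕ → ℝ → ℝ} {κ B : ℝ}
    (hS : IsStep S κ B) {k c c₀ δ R x₀ : ℝ} (hk : 0 < k) (hc : 0 ≤ c) (hcc : c < c₀)
    (hδ : (10 + c) * δ ≤ c - k ^ 2)
    (hsmall : ∀ t ∈ Icc t₁ t₂, ∀ x, c₀ * t + R ≤ x → |u 0 t x| ^ 3 ≤ δ) {N : ℝ} (hN : 0 ≤ N) :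
    ∫ x in (-N)..(N + 4), (u 0 t₂ x ^ 2 + u 1 t₂ x ^ 2 - 2 / 5 * u 0 t₂ x ^ 5)
        * (weight c k ((c₀ - c) * t₂ + x₀) 0 t₂ x * plateau S (-N) N 0 x)
      ≤ (∫ x in (-N)..(N + 4), (u 0 t₁ x ^ 2 + u 1 t₁ x ^ 2 - 2 / 5 * u 0 t₁ x ^ 5)
        * (weight c k ((c₀ - c) * t₂ + x₀) 0 t₁ x * plateau S (-N) N 0 x))
        + (10 + c) * (1 + 3 * E) ^ 2 * E / (c₀ - c) * exp (k * (R - x₀))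
        + ∫ t in t₁..t₂, ∫ x in (-N)..(N + 4),
          ((13 * ((1 + 3 * E) ^ 2) ^ 2 + 3 * k ^ 2 + 3 * k + 1)
            * (dens u t x * ((|S 1 (x - -N)| + |S 2 (x - -N)| + |S 3 (x - -N)|)
              + (|S 1 (x - N)| + |S 2 (x - N)| + |S 3 (x - N)|)))
            + 4 * (u 2 t x ^ 2 * S 1 (x - N))) := by
  have hE := hu.nonneg
  set d := (c₀ - c) * t₂ + x₀ with hd
  set D := (1 + 3 * E) ^ 2 with hD
  have hD1 : 1 ≤ D := by nlinarith
  have c0 := hu.cont 0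
  have c1 := hu.cont 1
  have c2 := hu.cont 2
  have cd := hu.cont_dens
  have s1 : Continuous (S 1) := hS.jet.continuous 1
  have s2 : Continuous (S 2) := hS.jet.continuous 2
  have s3 : Continuous (S 3) := hS.jet.continuous 3
  have hθ := hS.isJet_plateau (-N) N
  have cθ := hθ.continuous 0
  have hNN : -N ≤ N := by linarith
  have cw := continuous_cutWeight (continuous_weight c k d) hθ.continuous
  have cw1 := cw 1
  have cw3 := cw 3
  have cp := continuous_weight c k d 1
  have bal := energy_balance (a := -N) (b := N + 4) hu.le hu.toIsGKdVJet
    (Ψ := cutWeight (weight c k d) (plateau S (-N) N))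
    (Ψt := fun t x => -c * weight c k d 1 t x * plateau S (-N) N 0 x) cw (by fun_prop)
    (hasDerivAt_cutWeight (fun j hj => hasDerivAt_weight c k d hj) hθ)
    (fun t x => (hasDerivAt_t_weight c k d t x).mul_const _)
    (fun j t => cutWeight_eq_zero _ (fun i => hS.plateau_left hNN i le_rfl) j t)
    (fun j t => cutWeight_eq_zero _ (fun i => hS.plateau_right hNN i le_rfl) j t)
  set ρ : ℝ → ℝ := fun t =>
    (10 + c) * D * k * exp (k * (R - x₀)) * exp (-(k * (c₀ - c) * (t₂ - t))) with hρ
  have cρ : Continuous ρ := by fun_prop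
  have main : ∫ t in t₁..t₂, ∫ x in (-N)..(N + 4),
      ((u 0 t x ^ 2 + u 1 t x ^ 2 - 2 / 5 * u 0 t x ^ 5)
          * (-c * weight c k d 1 t x * plateau S (-N) N 0 x)
        + (-3 * u 1 t x ^ 2 + 8 / 5 * u 0 t x ^ 5 - (u 2 t x + u 0 t x ^ 4) ^ 2
          - 2 * u 2 t x ^ 2 + 8 * u 0 t x ^ 3 * u 1 t x ^ 2)
          * cutWeight (weight c k d) (plateau S (-N) N) 1 t x
        + (u 0 t x ^ 2 + u 1 t x ^ 2) * cutWeight (weight c k d) (plateau S (-N) N) 3 t x)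
      ≤ ∫ t in t₁..t₂, ∫ x in (-N)..(N + 4), (ρ t * dens u t x
        + ((13 * D ^ 2 + 3 * k ^ 2 + 3 * k + 1)
            * (dens u t x * ((|S 1 (x - -N)| + |S 2 (x - -N)| + |S 3 (x - -N)|)
              + (|S 1 (x - N)| + |S 2 (x - N)| + |S 3 (x - N)|)))
            + 4 * (u 2 t x ^ 2 * S 1 (x - N)))) := by
    refine integral_integral_mono (g := fun t x => _) (g' := fun t x => _)
      (by fun_prop) (by fun_prop) hu.le (by linarith) fun t ht x _ => ?_
    have err := cutoff_error_le (b := u 1 t x) (e := u 2 t x) (s₂ := S 2 (x - -N))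
      (s₃ := S 3 (x - -N)) (r₂ := S 2 (x - N)) (r₃ := S 3 (x - N)) hD1
      (hu.abs_cube_le ht x) (weight_zero_nonneg c k d t x) (weight_zero_le_one c k d t x)
      (abs_weight_one_le hk.le c d t x) (abs_weight_two_le c k d t x)
      (hS.deriv_nonneg (x - -N)) (hS.deriv_nonneg (x - N))
    have p0 := weight_one_nonneg hk.le c d t x
    have p3 := weight_three_le hk.le c d t x
    have d0 := dens_nonneg u t x
    have ρ0 : 0 ≤ ρ t := by simp only [hρ]; positivity
    have bulk : (u 0 t x ^ 2 + u 1 t x ^ 2 - 2 / 5 * u 0 t x ^ 5) * (-c * weight c k d 1 t x)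
        + (-3 * u 1 t x ^ 2 + 8 / 5 * u 0 t x ^ 5 - (u 2 t x + u 0 t x ^ 4) ^ 2
          - 2 * u 2 t x ^ 2 + 8 * u 0 t x ^ 3 * u 1 t x ^ 2) * weight c k d 1 t x
        + (u 0 t x ^ 2 + u 1 t x ^ 2) * weight c k d 3 t x ≤ ρ t * dens u t x := by
      rcases le_total (c₀ * t + R) x with hx | hx
      · have h := bulk_le (b := u 1 t x) (e := u 2 t x) hc p0 p3 (hsmall t ht x hx)
        have h1 : ((10 + c) * δ - (c - k ^ 2)) * dens u t x * weight c k d 1 t x ≤ 0 :=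
          mul_nonpos_of_nonpos_of_nonneg (mul_nonpos_of_nonpos_of_nonneg (by linarith) d0) p0
        have h2 : 0 ≤ ρ t * dens u t x := mul_nonneg ρ0 d0
        exact h.trans (h1.trans h2)
      · have h := bulk_le (b := u 1 t x) (e := u 2 t x) hc p0 p3 (hu.abs_cube_le ht x)
        have hck : 0 ≤ c - k ^ 2 := by
          by_contra hneg
          have hD0 := hsmall t ht (c₀ * t + R) le_rfl
          have : 0 ≤ δ := le_trans (by positivity) hD0
          have : 0 ≤ (10 + c) * δ := by positivity
          linarith
        have h1 : ((10 + c) * D - (c - k ^ 2)) * dens u t x * weight c k d 1 t x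
            ≤ (10 + c) * D * dens u t x * (k * exp (k * (x - c * t - d))) :=
          mul_le_mul (mul_le_mul_of_nonneg_right (by linarith) d0)
            (weight_one_le_exp hk.le c d t x) p0 (by positivity)
        have h2 : exp (k * (x - c * t - d))
            ≤ exp (k * (R - x₀)) * exp (-(k * (c₀ - c) * (t₂ - t))) := by
          rw [← exp_add, exp_le_exp, hd]
          have := mul_le_mul_of_nonneg_left hx hk.le
          linarith
        have h3 := mul_le_mul_of_nonneg_left h2
          (by positivity : 0 ≤ (10 + c) * D * dens u t x * k)
        refine h.trans (h1.trans ?_)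
        simp only [hρ]
        linarith
    have bulk' : ((u 0 t x ^ 2 + u 1 t x ^ 2 - 2 / 5 * u 0 t x ^ 5) * (-c * weight c k d 1 t x)
        + (-3 * u 1 t x ^ 2 + 8 / 5 * u 0 t x ^ 5 - (u 2 t x + u 0 t x ^ 4) ^ 2
          - 2 * u 2 t x ^ 2 + 8 * u 0 t x ^ 3 * u 1 t x ^ 2) * weight c k d 1 t x
        + (u 0 t x ^ 2 + u 1 t x ^ 2) * weight c k d 3 t x) * plateau S (-N) N 0 x
          ≤ ρ t * dens u t x :=
      (mul_le_mul_of_nonneg_right bulk (hS.plateau_nonneg hNN x)).trans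
        (mul_le_of_le_one_right (mul_nonneg ρ0 d0) (hS.plateau_le_one (-N) N x))
    refine le_trans (le_of_eq ?_) (add_le_add bulk' err)
    simp only [cutWeight]
    rw [show plateau S (-N) N 1 x = S 1 (x - -N) - S 1 (x - N) from rfl,
      show plateau S (-N) N 2 x = S 2 (x - -N) - S 2 (x - N) from rfl,
      show plateau S (-N) N 3 x = S 3 (x - -N) - S 3 (x - N) from rfl]
    ring
  rw [integral_integral_add_of_continuous (g := fun t x => ρ t * dens u t x) (by fun_prop)
    (by fun_prop)] at main
  have hρE : ∫ t in t₁..t₂, ∫ x in (-N)..(N + 4), ρ t * dens u t x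
      ≤ (10 + c) * D * E / (c₀ - c) * exp (k * (R - x₀)) := by
    have hl : 0 < k * (c₀ - c) := mul_pos hk (by linarith)
    calc ∫ t in t₁..t₂, ∫ x in (-N)..(N + 4), ρ t * dens u t x
        ≤ ∫ t in t₁..t₂, ((10 + c) * D * k * exp (k * (R - x₀)) * E)
          * exp (-(k * (c₀ - c) * (t₂ - t))) := by
          refine intervalIntegral.integral_mono_on hu.le
            ((continuous_integral_slice (g := fun t x => ρ t * dens u t x) (by fun_prop)
              _ _).intervalIntegrable _ _)
            ((by fun_prop : Continuous fun t => ((10 + c) * D * k * exp (k * (R - x₀)) * E)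
              * exp (-(k * (c₀ - c) * (t₂ - t)))).intervalIntegrable _ _) fun t ht => ?_
          rw [intervalIntegral.integral_const_mul]
          have ρ0 : 0 ≤ ρ t := by simp only [hρ]; positivity
          refine (mul_le_mul_of_nonneg_left
            (hu.bound t ht (-N) (N + 4) (by linarith)) ρ0).trans (le_of_eq ?_)
          simp only [hρ]
          ring
      _ ≤ ((10 + c) * D * k * exp (k * (R - x₀)) * E) * (1 / (k * (c₀ - c))) := by
          rw [intervalIntegral.integral_const_mul]
          exact mul_le_mul_of_nonneg_left (integral_exp_neg_mul_sub_le hl _ _) (by positivity)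
      _ = _ := by
          have : c₀ - c ≠ 0 := by linarith
          field_simp
  simp only [cutWeight] at bal main
  linarith

/-- The nonlinear part of the localized energy is controlled by the localized `H¹` norm. -/
theorem integral_abs_pow_five_le (hu : IsBoundedJet t₁ t₂ u E) {S : ℕ → ℝ → ℝ} {κ B : ℝ}
    (hS : IsStep S κ B) {k c c₀ δ R x₀ : ℝ} (hk : 0 < k) (hcc : c < c₀) (hδ : δ ≤ 1 / 2)
    (hsmall : ∀ t ∈ Icc t₁ t₂, ∀ x, c₀ * t + R ≤ x → |u 0 t x| ^ 3 ≤ δ) {N : ℝ} (hN : 0 ≤ N)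
    {t : ℝ} (ht : t ∈ Icc t₁ t₂) :
    ∫ x in (-N)..(N + 4), |2 / 5 * u 0 t x ^ 5|
        * (weight c k ((c₀ - c) * t₂ + x₀) 0 t x * plateau S (-N) N 0 x)
      ≤ 1 / 3 * (∫ x in (-N)..(N + 4),
          dens u t x * (weight c k ((c₀ - c) * t₂ + x₀) 0 t x * plateau S (-N) N 0 x))
        + (1 + 3 * E) ^ 2 * E * exp (k * (R - x₀)) := by
  have hE := hu.nonneg
  have c0 := hu.cont_slice 0 t
  have cd : Continuous (dens u t) := continuous_slice hu.cont_dens t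
  have cw : Continuous (weight c k ((c₀ - c) * t₂ + x₀) 0 t) :=
    continuous_slice (continuous_weight c k _ 0) t
  have cθ := (hS.isJet_plateau (-N) N).continuous 0
  have hNN : -N ≤ N := by linarith
  have hb := hu.bound t ht (-N) (N + 4) (by linarith)
  have key : ∫ x in (-N)..(N + 4), |2 / 5 * u 0 t x ^ 5|
        * (weight c k ((c₀ - c) * t₂ + x₀) 0 t x * plateau S (-N) N 0 x)
      ≤ ∫ x in (-N)..(N + 4), (1 / 3 * (dens u t x
          * (weight c k ((c₀ - c) * t₂ + x₀) 0 t x * plateau S (-N) N 0 x))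
        + (1 + 3 * E) ^ 2 * exp (k * (R - x₀)) * dens u t x) := by
    refine intervalIntegral.integral_mono_on (by linarith)
      (Continuous.intervalIntegrable (by fun_prop) _ _)
      (Continuous.intervalIntegrable (by fun_prop) _ _) fun x _ => ?_
    have w0 := weight_zero_nonneg c k ((c₀ - c) * t₂ + x₀) t x
    refine abs_pow_five_mul_le (mul_nonneg w0 (hS.plateau_nonneg hNN x)) (exp_pos _).le
      (hu.abs_cube_le ht x) hδ ?_
    rcases le_total (c₀ * t + R) x with hx | hx
    · exact Or.inl (hsmall t ht x hx)
    · refine Or.inr ((mul_le_of_le_one_right w0 (hS.plateau_le_one (-N) N x)).trans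
        ((weight_zero_le_exp _ _ _ _ _).trans ?_))
      rw [exp_le_exp]
      refine mul_le_mul_of_nonneg_left ?_ hk.le
      have := mul_nonneg (sub_nonneg.2 hcc.le) (sub_nonneg.2 ht.2)
      linarith
  rw [intervalIntegral.integral_add (Continuous.intervalIntegrable (by fun_prop) _ _)
    (Continuous.intervalIntegrable (by fun_prop) _ _), intervalIntegral.integral_const_mul,
    intervalIntegral.integral_const_mul] at key
  have := mul_le_mul_of_nonneg_left hb
    (by positivity : 0 ≤ (1 + 3 * E) ^ 2 * exp (k * (R - x₀)))
  linarith

/-- Almost monotonicity of the localized `H¹` norm with a cutoff. -/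
theorem dens_cutWeight_le (hu : IsBoundedJet t₁ t₂ u E) {S : ℕ → ℝ → ℝ} {κ B : ℝ}
    (hS : IsStep S κ B) {k c c₀ δ R x₀ : ℝ} (hk : 0 < k) (hc : 0 ≤ c) (hcc : c < c₀)
    (hδ : (10 + c) * δ ≤ c - k ^ 2) (hδ' : δ ≤ 1 / 2)
    (hsmall : ∀ t ∈ Icc t₁ t₂, ∀ x, c₀ * t + R ≤ x → |u 0 t x| ^ 3 ≤ δ) {N η : ℝ} (hN : 0 ≤ N)
    (hη : ∫ t in t₁..t₂, ∫ x in (-N)..(N + 4),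
      ((13 * ((1 + 3 * E) ^ 2) ^ 2 + 3 * k ^ 2 + 3 * k + 1)
        * (dens u t x * ((|S 1 (x - -N)| + |S 2 (x - -N)| + |S 3 (x - -N)|)
          + (|S 1 (x - N)| + |S 2 (x - N)| + |S 3 (x - N)|)))
        + 4 * (u 2 t x ^ 2 * S 1 (x - N))) ≤ η) :
    ∫ x in (-N)..(N + 4),
        dens u t₂ x * (weight c k ((c₀ - c) * t₂ + x₀) 0 t₂ x * plateau S (-N) N 0 x)
      ≤ 2 * (∫ x in (-N)..(N + 4),
          dens u t₁ x * (weight c k ((c₀ - c) * t₂ + x₀) 0 t₁ x * plateau S (-N) N 0 x))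
        + (3 * (1 + 3 * E) ^ 2 * E + 3 / 2 * ((10 + c) * (1 + 3 * E) ^ 2 * E / (c₀ - c)))
          * exp (k * (R - x₀)) + 3 / 2 * η := by
  have hNN : -N ≤ N := by linarith
  have cθ := (hS.isJet_plateau (-N) N).continuous 0
  have split : ∀ t, |(∫ x in (-N)..(N + 4), (u 0 t x ^ 2 + u 1 t x ^ 2 - 2 / 5 * u 0 t x ^ 5)
        * (weight c k ((c₀ - c) * t₂ + x₀) 0 t x * plateau S (-N) N 0 x))
      - ∫ x in (-N)..(N + 4),
        dens u t x * (weight c k ((c₀ - c) * t₂ + x₀) 0 t x * plateau S (-N) N 0 x)|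
      ≤ ∫ x in (-N)..(N + 4), |2 / 5 * u 0 t x ^ 5|
        * (weight c k ((c₀ - c) * t₂ + x₀) 0 t x * plateau S (-N) N 0 x) := by
    intro t
    have c0 := hu.cont_slice 0 t
    have c1 := hu.cont_slice 1 t
    have cd : Continuous (dens u t) := continuous_slice hu.cont_dens t
    have cw : Continuous (weight c k ((c₀ - c) * t₂ + x₀) 0 t) :=
      continuous_slice (continuous_weight c k _ 0) t
    rw [← intervalIntegral.integral_sub (Continuous.intervalIntegrable (by fun_prop) _ _)
      (Continuous.intervalIntegrable (by fun_prop) _ _)]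
    refine (intervalIntegral.abs_integral_le_integral_abs (by linarith)).trans (le_of_eq ?_)
    refine intervalIntegral.integral_congr fun x _ => ?_
    have w0 := mul_nonneg (weight_zero_nonneg c k ((c₀ - c) * t₂ + x₀) t x)
      (hS.plateau_nonneg hNN x)
    simp only [dens]
    rw [← abs_of_nonneg w0, ← abs_mul, abs_of_nonneg w0, ← abs_neg]
    congr 1
    ring
  have f := hu.energy_cutWeight_le hS (x₀ := x₀) hk hc hcc hδ hsmall hN
  have e₁ := hu.integral_abs_pow_five_le hS (x₀ := x₀) hk hcc hδ' hsmall hN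
    (left_mem_Icc.2 hu.le)
  have e₂ := hu.integral_abs_pow_five_le hS (x₀ := x₀) hk hcc hδ' hsmall hN
    (right_mem_Icc.2 hu.le)
  have l₁ := (abs_le.1 (split t₁)).2
  have l₂ := (abs_le.1 (split t₂)).1
  linarith

/-- Almost monotonicity of the localized `H¹` norm. -/
theorem integral_dens_mul_weight_le (hu : IsBoundedJet t₁ t₂ u E)
    (hi : ∀ t ∈ Icc t₁ t₂, Integrable (dens u t))
    {k c c₀ δ R x₀ : ℝ} (hk : 0 < k) (hc : 0 ≤ c) (hcc : c < c₀)
    (hδ : (10 + c) * δ ≤ c - k ^ 2) (hδ' : δ ≤ 1 / 2)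
    (hsmall : ∀ t ∈ Icc t₁ t₂, ∀ x, c₀ * t + R ≤ x → |u 0 t x| ^ 3 ≤ δ) :
    ∫ x, dens u t₂ x * weight c k ((c₀ - c) * t₂ + x₀) 0 t₂ x
      ≤ 2 * (∫ x, dens u t₁ x * weight c k ((c₀ - c) * t₂ + x₀) 0 t₁ x)
        + (3 * (1 + 3 * E) ^ 2 * E + 3 / 2 * ((10 + c) * (1 + 3 * E) ^ 2 * E / (c₀ - c)))
          * exp (k * (R - x₀)) := by
  obtain ⟨S, κ, B, hS⟩ := exists_isStep
  obtain ⟨η, N, hη, hN, hN0, herr⟩ := hu.exists_cutoff_error_tail hS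
    (by positivity : 0 ≤ 13 * ((1 + 3 * E) ^ 2) ^ 2 + 3 * k ^ 2 + 3 * k + 1)
  set ψ := weight c k ((c₀ - c) * t₂ + x₀) 0 with hψ
  have cψ : ∀ t, Continuous (ψ t) := continuous_slice (continuous_weight c k _ 0)
  have cd : ∀ t, Continuous (dens u t) := continuous_slice hu.cont_dens
  have ψ0 : ∀ t x, 0 ≤ ψ t x := weight_zero_nonneg c k _
  have ψ1 : ∀ t x, ψ t x ≤ 1 := weight_zero_le_one c k _
  have cθ : ∀ n, Continuous (plateau S (-N n) (N n) 0) := fun n =>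
    (hS.isJet_plateau (-N n) (N n)).continuous 0
  have hNN : ∀ n, -N n ≤ N n := fun n => by linarith [hN0 n]
  have θ0 : ∀ n x, 0 ≤ plateau S (-N n) (N n) 0 x := fun n x => hS.plateau_nonneg (hNN n) x
  have θ1 : ∀ n x, plateau S (-N n) (N n) 0 x ≤ 1 := fun n x => hS.plateau_le_one _ _ x
  have whole : ∀ n t, ∫ x in (-N n)..(N n + 4), dens u t x * (ψ t x * plateau S (-N n) (N n) 0 x)
      = ∫ x, dens u t x * (ψ t x * plateau S (-N n) (N n) 0 x) := by
    intro n t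
    refine intervalIntegral.integral_eq_integral_of_support_subset fun x hx => ?_
    by_contra h
    apply hx
    rw [mem_Ioc, not_and_or, not_lt, not_le] at h
    rcases h with h | h
    · simp [hS.plateau_left (hNN n) 0 h]
    · simp [hS.plateau_right (hNN n) 0 h.le]
  have le_dens : ∀ n t x, ‖dens u t x * (ψ t x * plateau S (-N n) (N n) 0 x)‖ ≤ dens u t x := by
    intro n t x
    have h := mul_nonneg (ψ0 t x) (θ0 n x)
    rw [norm_of_nonneg (mul_nonneg (dens_nonneg u t x) h)]
    exact mul_le_of_le_one_right (dens_nonneg u t x) (mul_le_one₀ (ψ1 t x) (θ0 n x) (θ1 n x))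
  have lim : Tendsto (fun n => ∫ x, dens u t₂ x * (ψ t₂ x * plateau S (-N n) (N n) 0 x)) atTop
      (𝓝 (∫ x, dens u t₂ x * ψ t₂ x)) := by
    refine tendsto_integral_of_dominated_convergence (dens u t₂)
      (fun n => (((cd t₂).mul ((cψ t₂).mul (cθ n)))).aestronglyMeasurable)
      (hi t₂ (right_mem_Icc.2 hu.le)) (fun n => Eventually.of_forall (le_dens n t₂))
      (Eventually.of_forall fun x => ?_)
    refine tendsto_const_nhds.congr' ?_
    filter_upwards [hN.eventually_ge_atTop (4 - x), hN.eventually_ge_atTop x] with n h₁ h₂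
    rw [plateau, hS.right_zero _ (by linarith), hS.left 0 _ (by linarith), sub_zero, mul_one]
  have init : ∀ n, ∫ x, dens u t₁ x * (ψ t₁ x * plateau S (-N n) (N n) 0 x)
      ≤ ∫ x, dens u t₁ x * ψ t₁ x := by
    intro n
    have hi₁ := hi t₁ (left_mem_Icc.2 hu.le)
    refine integral_mono
      (hi₁.mono' ((cd t₁).mul ((cψ t₁).mul (cθ n))).aestronglyMeasurable
        (Eventually.of_forall (le_dens n t₁)))
      (hi₁.mono' ((cd t₁).mul (cψ t₁)).aestronglyMeasurable (Eventually.of_forall fun x => ?_))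
      fun x => ?_
    · rw [norm_of_nonneg (mul_nonneg (dens_nonneg u t₁ x) (ψ0 t₁ x))]
      exact mul_le_of_le_one_right (dens_nonneg u t₁ x) (ψ1 t₁ x)
    · exact mul_le_mul_of_nonneg_left (mul_le_of_le_one_right (ψ0 t₁ x) (θ1 n x))
        (dens_nonneg u t₁ x)
  have lim' := (hη.const_mul (3 / 2)).const_add (2 * (∫ x, dens u t₁ x * ψ t₁ x)
    + (3 * (1 + 3 * E) ^ 2 * E + 3 / 2 * ((10 + c) * (1 + 3 * E) ^ 2 * E / (c₀ - c)))
      * exp (k * (R - x₀)))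
  rw [mul_zero, add_zero] at lim'
  refine le_of_tendsto_of_tendsto' lim lim' fun n => ?_
  have h := hu.dens_cutWeight_le hS (x₀ := x₀) hk hc hcc hδ hδ' hsmall (hN0 n) (herr n)
  simp only [← hψ] at h
  rw [whole, whole] at h
  linarith [init n]

end IsBoundedJet

/-- A function with bounded `H¹` norm is small where its mass is small. -/
theorem abs_cube_le_of_mass_le {f f' : ℝ → ℝ} (hf : ∀ x, HasDerivAt f (f' x) x)
    (hf' : Continuous f') {α E x : ℝ} (hα : 0 < α) (hα1 : α * (2 + E) ≤ 1) (hE : 0 ≤ E)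
    (hm : ∫ y in x..(x + 2), f y ^ 2 ≤ α ^ 2) (he : ∫ y in x..(x + 2), f' y ^ 2 ≤ E) :
    |f x| ^ 3 ≤ α * (2 + E) := by
  have h := sq_le_integral_add hf hf' (inv_pos.2 hα) (c := x) (x := x) ⟨le_rfl, by linarith⟩
  rw [one_div, inv_inv] at h
  have hα2 : α ≤ 1 := by nlinarith
  have h1 := mul_le_mul_of_nonneg_left hm (by positivity : 0 ≤ 1 + α⁻¹)
  have h2 := mul_le_mul_of_nonneg_left he hα.le
  have h3 : (1 + α⁻¹) * α ^ 2 = α ^ 2 + α := by field_simp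
  have h4 : f x ^ 2 ≤ α * (2 + E) := by nlinarith
  rw [← sq_abs] at h4
  have h5 : |f x| ≤ 1 := by nlinarith [abs_nonneg (f x)]
  calc |f x| ^ 3 = |f x| ^ 2 * |f x| := by ring
    _ ≤ |f x| ^ 2 := mul_le_of_le_one_right (by positivity) h5
    _ ≤ _ := h4

/-- Mass-energy monotonicity lemma for solutions of the quartic gKdV
equation on a time interval `[t₁, t₂]`. -/
theorem mass_energy_monotonicity
    (σ σ' c₀ C₀ : ℝ) (hσ : 0 < σ) (hσσ' : σ < σ') (hσ'c₀ : σ' < c₀) (hC₀ : 0 < C₀) :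
    ∃ α₀ : ℝ, 0 < α₀ ∧ ∀ R : ℝ, 1 < R → ∃ C : ℝ, 0 < C ∧
      ∀ t₁ t₂ : ℝ, t₁ < t₂ → ∀ u : ℝ → ℝ → ℝ,
        ContDiff ℝ (⊤ : ℕ∞) (Function.uncurry u) →
        (∀ t ∈ Set.Icc t₁ t₂, ∀ x : ℝ,
          deriv (fun s => u s x) t
            + deriv (fun y => iteratedDeriv 2 (u t) y + (u t y) ^ 4) x = 0) →
        (∀ t ∈ Set.Icc t₁ t₂, ∀ k : ℕ,
          Integrable (fun x => (iteratedDeriv k (u t) x) ^ 2)) →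
        (∀ t ∈ Set.Icc t₁ t₂,
          (∫ x : ℝ, ((deriv (u t) x) ^ 2 + (u t x) ^ 2)) ≤ C₀ ^ 2) →
        (∀ t ∈ Set.Icc t₁ t₂,
          (∫ x in Set.Ioi (c₀ * t + R), (u t x) ^ 2) ≤ α₀ ^ 2) →
        ∀ x₀ : ℝ, 0 < x₀ →
          (∫ x : ℝ, ((deriv (u t₂) x) ^ 2 + (u t₂ x) ^ 2)
              * phi (Real.sqrt σ * (x - c₀ * t₂ - x₀)))
            ≤ 2 * (∫ x : ℝ, ((deriv (u t₁) x) ^ 2 + (u t₁ x) ^ 2)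
              * phi (Real.sqrt σ * (x - c₀ * t₁ - (c₀ - σ') * (t₂ - t₁) - x₀)))
              + C * Real.exp (-(Real.sqrt σ) * x₀) := by
  have hσ' : 0 < σ' := hσ.trans hσσ'
  have hk : 0 < √σ := Real.sqrt_pos.2 hσ
  have hcc : 0 < c₀ - σ' := sub_pos.2 hσ'c₀
  have hm : 0 < min 1 (σ' - σ) := lt_min one_pos (sub_pos.2 hσσ')
  set E := C₀ ^ 2 with hE
  have hE0 : 0 < E := by positivity
  set α₀ := min 1 (σ' - σ) / ((2 + E) * (10 + σ')) with hα
  have hα0 : 0 < α₀ := by positivity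
  have hδ : (10 + σ') * (α₀ * (2 + E)) = min 1 (σ' - σ) := by
    rw [hα]
    field_simp
  have hδ' : α₀ * (2 + E) ≤ 1 / 2 := by
    have h1 := min_le_left 1 (σ' - σ)
    have h2 : 0 < α₀ * (2 + E) := by positivity
    nlinarith
  refine ⟨α₀, hα0, fun R _ => ⟨(3 * (1 + 3 * E) ^ 2 * E
    + 3 / 2 * ((10 + σ') * (1 + 3 * E) ^ 2 * E / (c₀ - σ'))) * exp (√σ * R), by positivity, ?_⟩⟩
  intro t₁ t₂ h12 u hu heq hL2 hen hmass x₀ _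
  set v : ℕ → ℝ → ℝ → ℝ := fun k t x => iteratedDeriv k (u t) x with hv
  have jet : IsGKdVJet t₁ t₂ v := isGKdVJet_iteratedDeriv hu heq
  have v0 : ∀ t x, v 0 t x = u t x := fun t x => by simp only [hv, iteratedDeriv_zero]
  have dv : ∀ t x, deriv (u t) x ^ 2 + u t x ^ 2 = dens v t x := fun t x => by
    simp only [dens, hv, iteratedDeriv_zero, iteratedDeriv_one]
    ring
  have hi : ∀ t ∈ Icc t₁ t₂, Integrable (dens v t) := fun t ht => (hL2 t ht 0).add (hL2 t ht 1)
  simp only [dv] at hen ⊢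
  have bdd : IsBoundedJet t₁ t₂ v E :=
    { jet with
      le := h12.le
      bound := fun t ht a b hab => by
        rw [intervalIntegral.integral_of_le hab]
        exact (setIntegral_le_integral (hi t ht)
          (Eventually.of_forall (dens_nonneg v t))).trans (hen t ht) }
  have small : ∀ t ∈ Icc t₁ t₂, ∀ x, c₀ * t + R ≤ x → |v 0 t x| ^ 3 ≤ α₀ * (2 + E) := by
    intro t ht x hx
    refine abs_cube_le_of_mass_le (jet.hasDerivAt_x 0 t) (bdd.cont_slice 1 t) hα0
      (by linarith) hE0.le ?_ ((bdd.integral_sq_one_le t (by linarith)).trans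
        (bdd.bound t ht _ _ (by linarith)))
    rw [intervalIntegral.integral_of_le (by linarith)]
    simp only [v0]
    have h0 := hL2 t ht 0
    simp only [iteratedDeriv_zero] at h0
    exact (setIntegral_mono_set h0.integrableOn
      (Eventually.of_forall fun y => sq_nonneg (u t y))
      (LE.le.eventuallyLE fun y (hy : y ∈ Ioc x (x + 2)) => hx.trans_lt hy.1)).trans (hmass t ht)
  have main := bdd.integral_dens_mul_weight_le hi (x₀ := x₀) hk hσ'.le hσ'c₀
    (by rw [hδ, Real.sq_sqrt hσ.le]; exact min_le_right _ _) hδ' small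
  have w₂ : ∀ x, weight σ' (√σ) ((c₀ - σ') * t₂ + x₀) 0 t₂ x = phi (√σ * (x - c₀ * t₂ - x₀)) := by
    intro x
    rw [weight, pow_zero, one_mul]
    exact congrArg phi (by ring)
  have w₁ : ∀ x, weight σ' (√σ) ((c₀ - σ') * t₂ + x₀) 0 t₁ x
      = phi (√σ * (x - c₀ * t₁ - (c₀ - σ') * (t₂ - t₁) - x₀)) := by
    intro x
    rw [weight, pow_zero, one_mul]
    exact congrArg phi (by ring)
  have hexp : exp (√σ * (R - x₀)) = exp (√σ * R) * exp (-√σ * x₀) := by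
    rw [← exp_add]
    congr 1
    ring
  simp only [w₁, w₂] at main
  rw [hexp, ← mul_assoc] at main
  exact main
end

section
/- Let N ≥ 2 and 0 < c_N < … < c_2 < c_1 = 1 with ∑_{j=2}^N (1 − c_j)² ≤ 1/16. Let j₀ ∈ {1,…,N−1} attain σ₀ := min_{1≤j≤N−1} √(c_{j+1})(c_j − c_{j+1}) and set γ₀ = √(c_{j₀} − (3/4)c_{j₀+1}) − (1/2)√(c_{j₀+1}). Then: (1) σ₀/γ₀ ≥ √(c_{j₀+1} c_{j₀}); (2) 4σ₀ / (σ₀/γ₀ − (1 − c_{j₀})) < 1; and (3) σ₀/γ₀ + c_{j₀} − (max(4/5, 4σ₀/(σ₀/γ₀ − (1 − c_{j₀}))))² > 5σ₀. -/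
open Real

/-- With `s = √b` and `u = √(a - 3b/4)`, the bound `4σ ≤ (23/25) (σ/γ - (1 - a))`
in the range `3/4 ≤ b ≤ a ≤ 1`. -/
lemma four_sigma_le {s u : ℝ} (hs0 : 0 < s) (hs : 3 / 4 ≤ s ^ 2) (hs1 : s ≤ 1)
    (hu : s / 2 ≤ u) (hsu : u ^ 2 + 3 / 4 * s ^ 2 ≤ 1) :
    4 * (s * (u ^ 2 - s ^ 2 / 4)) ≤ 23 / 25 * (s * u + s ^ 2 / 2 + (u ^ 2 + 3 / 4 * s ^ 2) - 1) := by
  have hs' : 866 / 1000 ≤ s := by nlinarith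
  obtain ⟨L, hL⟩ : ∃ L : ℝ, L = (19981 / 10000 - 1299 / 1000 * s) / (132 / 100) := ⟨_, rfl⟩
  have huL : u ≤ L := by
    rw [hL, le_div_iff₀ (by norm_num)]
    nlinarith [sq_nonneg (u - 66 / 100), sq_nonneg (s - 866 / 1000)]
  have hchord : u ^ 2 ≤ (s / 2 + L) * u - s / 2 * L := by
    nlinarith [mul_nonneg (sub_nonneg.2 hu) (sub_nonneg.2 huL)]
  have hstart : (4 * s - 23 / 25) * (s / 2) ^ 2 - 23 / 25 * s * (s / 2) - s ^ 3
      - 23 / 25 * (5 / 4 * s ^ 2 - 1) ≤ 0 := by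
    nlinarith
  have hend : (4 * s - 23 / 25) * L ^ 2 - 23 / 25 * s * L - s ^ 3
      - 23 / 25 * (5 / 4 * s ^ 2 - 1) ≤ 0 := by
    rw [hL]
    nlinarith [mul_nonneg (sub_nonneg.2 hs') (sub_nonneg.2 hs1),
      mul_nonneg (mul_nonneg (sub_nonneg.2 hs') (sub_nonneg.2 hs1)) hs0.le]
  have hcoef : 0 ≤ 4 * s - 23 / 25 := by linarith
  rcases (hu.trans huL).eq_or_lt with h | h
  · have : u = s / 2 := le_antisymm (by linarith) hu
    subst this
    nlinarith
  · have hpos : 0 < L - s / 2 := by linarith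
    have hmul := mul_le_mul_of_nonneg_left hchord hcoef
    have h1 := mul_nonpos_of_nonneg_of_nonpos (sub_nonneg.2 huL) hstart
    have h2 := mul_nonpos_of_nonneg_of_nonpos (sub_nonneg.2 hu) hend
    have hmul' := mul_le_mul_of_nonneg_left hmul hpos.le
    have : (L - s / 2) * (4 * (s * (u ^ 2 - s ^ 2 / 4))
        - 23 / 25 * (s * u + s ^ 2 / 2 + (u ^ 2 + 3 / 4 * s ^ 2) - 1)) ≤ 0 := by
      linarith
    linarith [nonpos_of_mul_nonpos_right this hpos]

/-- Elementary inequalities on the parameters `σ₀`, `γ₀` built from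
speeds `0 < c_N < … < c_1 = 1` with `∑_{j=2}^N (1 − c_j)² ≤ 1/16`. -/
theorem sigma_gamma_inequalities
    (N : ℕ) (hN : 2 ≤ N) (c : ℕ → ℝ)
    (hc1 : c 1 = 1)
    (hcpos : ∀ j, 1 ≤ j → j ≤ N → 0 < c j)
    (hcdec : ∀ j, 1 ≤ j → j < N → c (j + 1) < c j)
    (hspeeds : ∑ j ∈ Finset.Icc 2 N, (1 - c j) ^ 2 ≤ 1 / 16)
    (j₀ : ℕ) (hj₀1 : 1 ≤ j₀) (hj₀N : j₀ < N)
    (σ₀ γ₀ : ℝ)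
    (hσ₀ : σ₀ = Real.sqrt (c (j₀ + 1)) * (c j₀ - c (j₀ + 1)))
    (hmin : ∀ j, 1 ≤ j → j < N → σ₀ ≤ Real.sqrt (c (j + 1)) * (c j - c (j + 1)))
    (hγ₀ : γ₀ = Real.sqrt (c j₀ - 3 / 4 * c (j₀ + 1)) - 1 / 2 * Real.sqrt (c (j₀ + 1))) :
    Real.sqrt (c (j₀ + 1) * c j₀) ≤ σ₀ / γ₀ ∧
    4 * σ₀ / (σ₀ / γ₀ - (1 - c j₀)) < 1 ∧
    5 * σ₀ < σ₀ / γ₀ + c j₀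
      - (max (4 / 5) (4 * σ₀ / (σ₀ / γ₀ - (1 - c j₀)))) ^ 2 := by
  have hle1 : ∀ j, 1 ≤ j → j ≤ N → c j ≤ 1 := by
    intro j hj
    induction j, hj using Nat.le_induction with
    | base => exact fun _ => hc1.le
    | succ k hk ih => exact fun hkN => (hcdec k hk (by omega)).le.trans (ih (by omega))
  have ha1 := hle1 j₀ hj₀1 hj₀N.le
  have hba := hcdec j₀ hj₀1 hj₀N
  have hb : 3 / 4 ≤ c (j₀ + 1) := by
    have h := Finset.single_le_sum (f := fun j => (1 - c j) ^ 2) (fun j _ => sq_nonneg _)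
      (Finset.mem_Icc.2 ⟨by omega, hj₀N⟩ : j₀ + 1 ∈ Finset.Icc 2 N)
    nlinarith [h.trans hspeeds]
  generalize c j₀ = a at *
  generalize c (j₀ + 1) = b at *
  obtain ⟨s, hs⟩ : ∃ s, s = √b := ⟨_, rfl⟩
  obtain ⟨u, hu⟩ : ∃ u, u = √(a - 3 / 4 * b) := ⟨_, rfl⟩
  have hs0 : 0 < s := hs ▸ Real.sqrt_pos.2 (by linarith)
  have hu0 : 0 < u := hu ▸ Real.sqrt_pos.2 (by linarith)
  have hs2 : s ^ 2 = b := hs ▸ Real.sq_sqrt (by linarith)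
  have hu2 : u ^ 2 = a - 3 / 4 * b := hu ▸ Real.sq_sqrt (by linarith)
  rw [← hs] at hσ₀ hγ₀
  rw [← hu] at hγ₀
  have hsu : s / 2 < u := by nlinarith
  have hγpos : 0 < γ₀ := by linarith
  have hσpos : 0 < σ₀ := hσ₀ ▸ mul_pos hs0 (by linarith)
  have hR : σ₀ / γ₀ = s * u + b / 2 := by
    rw [div_eq_iff hγpos.ne', hσ₀, hγ₀]
    linear_combination (-s) * hu2 + u / 2 * hs2
  have hkey : 4 * σ₀ ≤ 23 / 25 * (s * u + b / 2 - (1 - a)) := by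
    have h := four_sigma_le hs0 (by linarith) (by nlinarith) hsu.le (by linarith)
    have e : u ^ 2 - s ^ 2 / 4 = a - b := by linarith
    rw [e, ← hσ₀, hu2, hs2] at h
    linarith
  have hD1 : s * u + b / 2 - (1 - a) ≤ 1 := by
    have h : s * u ≤ 1 - b / 2 := by
      refine abs_le_of_sq_le_sq' ?_ ?_ |>.2
      · rw [mul_pow, hs2, hu2]
        nlinarith [sq_nonneg (1 - b)]
      · linarith
    linarith
  rw [hR]
  obtain ⟨D, hD⟩ : ∃ D, D = s * u + b / 2 - (1 - a) := ⟨_, rfl⟩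
  rw [← hD] at hkey hD1 ⊢
  have hDpos : 0 < D := by linarith
  obtain ⟨m, hm⟩ : ∃ m, m = 4 * σ₀ / D := ⟨_, rfl⟩
  have hmD : m * D = 4 * σ₀ := hm ▸ div_mul_cancel₀ _ hDpos.ne'
  have hm1 : m ≤ 23 / 25 := hm ▸ (div_le_iff₀ hDpos).2 hkey
  have hm0 : 0 < m := hm ▸ by positivity
  rw [← hm]
  refine ⟨?_, by linarith, ?_⟩
  · apply Real.sqrt_le_iff.2
    refine ⟨by nlinarith, ?_⟩
    have h : a ≤ (u + s / 2) ^ 2 := by nlinarith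
    calc b * a ≤ s ^ 2 * (u + s / 2) ^ 2 := by
          rw [hs2]; exact mul_le_mul_of_nonneg_left h (by linarith)
      _ = (s * u + b / 2) ^ 2 := by rw [← hs2]; ring
  · rcases le_total m (4 / 5) with h | h
    · rw [max_eq_left h]
      linarith [mul_le_mul_of_nonneg_right h hDpos.le]
    · rw [max_eq_right h]
      have hmsq : m ^ 2 ≤ (23 / 25) ^ 2 := pow_le_pow_left₀ hm0.le hm1 2
      linarith [mul_le_mul_of_nonneg_left hD1 (by linarith : 0 ≤ 5 / 4 * m - 1)]
end
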